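/- arXiv:2207.07393 — 11 statements merged into one kernel-verified Lean document; each statement's English description precedes it below -/
import Mathlib

section
/- Let p₂ and p₃ be primes with 3 < p₂ < p₃, p₂ ≡ 1 (mod 3) and p₃ > 3p₂. If p₃ ≡ 2 (mod 3p₂), then 9·p₂·hw(Φ_{3p₂p₃}) = 7(p₂² − 1)(p₃ − 2) + 3p₂(4p₂ − 1); and if p₃ ≡ 3p₂ − 2 (mod 3p₂), then 9·p₂·hw(Φ_{3p₂p₃}) = 7(p₂² − 1)(p₃ + 2) − 3p₂(4p₂ − 1). Equivalently, hw(Φ_{3p₂p₃}) = N(p₃ − 2) + (4p₂ − 1)/3 in the first case and N(p₃ + 2) − (4p₂ − 1)/3 in the second, where N = 7(p₂² − 1)/(9p₂). -/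
open Polynomial

/-- The Hamming weight of a polynomial: its number of nonzero coefficients. -/
noncomputable def hw (f : Polynomial ℤ) : ℕ := f.support.card


set_option linter.unusedSimpArgs false
set_option linter.unusedVariables false

/-- coefficients of the cyclotomic polynomial of index `3 (6k+1)` -/
def cA (k j : ℤ) : ℤ :=
  if j % 3 = 0 then (if 0 ≤ j ∧ j ≤ 12 * k then 1 else 0)
  else if j % 3 = 1 then (if 0 ≤ j ∧ j ≤ 6 * k then -1 else 0)
  else (if 6 * k + 1 ≤ j ∧ j ≤ 12 * k then -1 else 0)

/-- truncated coefficients -/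
def tA (k s j : ℤ) : ℤ := if j ≤ s then cA k j else 0

/-- the six term formula -/
def tH (k s w : ℤ) : ℤ :=
  tA k s w + tA k s (w - 1) - tA k s (w + 6 * k + 1) - tA k s (w + 6 * k)
   - tA k s (w - 12 * k - 2) - tA k s (w - 12 * k - 3)
   + tA k s (w - 9 * k - 2) + tA k s (w + 9 * k + 1) - tA k s (w - 3 * k - 1)

lemma tA0 {k s j : ℤ} (i : ℤ) (hj : j = 3 * i) (hs : s < 12 * k) :
    tA k s j = if 0 ≤ i ∧ 3 * i ≤ s then 1 else 0 := by
  subst hj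
  have : (3 * i) % 3 = 0 := by omega
  simp only [tA, cA, this, if_true]
  split_ifs <;> omega

lemma tA1 {k s j : ℤ} (i : ℤ) (hj : j = 3 * i + 1) :
    tA k s j = if 0 ≤ i ∧ i < 2 * k ∧ 3 * i + 1 ≤ s then -1 else 0 := by
  subst hj
  have : (3 * i + 1) % 3 = 1 := by omega
  simp only [tA, cA, this]
  split_ifs <;> omega

lemma tA2 {k s j : ℤ} (i : ℤ) (hj : j = 3 * i + 2) (hs : s < 12 * k) :
    tA k s j = if 2 * k ≤ i ∧ 3 * i + 2 ≤ s then -1 else 0 := by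
  subst hj
  have : (3 * i + 2) % 3 = 2 := by omega
  simp only [tA, cA, this]
  split_ifs <;> omega

lemma tH_0 {k s w : ℤ} (y : ℤ) (hw : w = 3 * y) (hs : s < 12 * k) :
    tH k s w = (if 0 ≤ y ∧ 3 * (y) ≤ s then 1 else 0)
      + (if 2 * k ≤ y - 1 ∧ 3 * (y - 1) + 2 ≤ s then -1 else 0)
      - (if 0 ≤ y + 2 * k ∧ y + 2 * k < 2 * k ∧ 3 * (y + 2 * k) + 1 ≤ s then -1 else 0)
      - (if 0 ≤ y + 2 * k ∧ 3 * (y + 2 * k) ≤ s then 1 else 0)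
      - (if 0 ≤ y - 4 * k - 1 ∧ y - 4 * k - 1 < 2 * k ∧ 3 * (y - 4 * k - 1) + 1 ≤ s then -1 else 0)
      - (if 0 ≤ y - 4 * k - 1 ∧ 3 * (y - 4 * k - 1) ≤ s then 1 else 0)
      + (if 0 ≤ y - 3 * k - 1 ∧ y - 3 * k - 1 < 2 * k ∧ 3 * (y - 3 * k - 1) + 1 ≤ s then -1 else 0)
      + (if 0 ≤ y + 3 * k ∧ y + 3 * k < 2 * k ∧ 3 * (y + 3 * k) + 1 ≤ s then -1 else 0)
      - (if 2 * k ≤ y - k - 1 ∧ 3 * (y - k - 1) + 2 ≤ s then -1 else 0) := by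
  unfold tH
  rw [tA0 y (by omega) hs,
    tA2 (y - 1) (by omega) hs,
    tA1 (y + 2 * k) (by omega),
    tA0 (y + 2 * k) (by omega) hs,
    tA1 (y - 4 * k - 1) (by omega),
    tA0 (y - 4 * k - 1) (by omega) hs,
    tA1 (y - 3 * k - 1) (by omega),
    tA1 (y + 3 * k) (by omega),
    tA2 (y - k - 1) (by omega) hs]

lemma tH_1 {k s w : ℤ} (y : ℤ) (hw : w = 3 * y + 1) (hs : s < 12 * k) :
    tH k s w = (if 0 ≤ y ∧ y < 2 * k ∧ 3 * (y) + 1 ≤ s then -1 else 0)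
      + (if 0 ≤ y ∧ 3 * (y) ≤ s then 1 else 0)
      - (if 2 * k ≤ y + 2 * k ∧ 3 * (y + 2 * k) + 2 ≤ s then -1 else 0)
      - (if 0 ≤ y + 2 * k ∧ y + 2 * k < 2 * k ∧ 3 * (y + 2 * k) + 1 ≤ s then -1 else 0)
      - (if 2 * k ≤ y - 4 * k - 1 ∧ 3 * (y - 4 * k - 1) + 2 ≤ s then -1 else 0)
      - (if 0 ≤ y - 4 * k - 1 ∧ y - 4 * k - 1 < 2 * k ∧ 3 * (y - 4 * k - 1) + 1 ≤ s then -1 else 0)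
      + (if 2 * k ≤ y - 3 * k - 1 ∧ 3 * (y - 3 * k - 1) + 2 ≤ s then -1 else 0)
      + (if 2 * k ≤ y + 3 * k ∧ 3 * (y + 3 * k) + 2 ≤ s then -1 else 0)
      - (if 0 ≤ y - k ∧ 3 * (y - k) ≤ s then 1 else 0) := by
  unfold tH
  rw [tA1 y (by omega),
    tA0 y (by omega) hs,
    tA2 (y + 2 * k) (by omega) hs,
    tA1 (y + 2 * k) (by omega),
    tA2 (y - 4 * k - 1) (by omega) hs,
    tA1 (y - 4 * k - 1) (by omega),
    tA2 (y - 3 * k - 1) (by omega) hs,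
    tA2 (y + 3 * k) (by omega) hs,
    tA0 (y - k) (by omega) hs]

lemma tH_2 {k s w : ℤ} (y : ℤ) (hw : w = 3 * y + 2) (hs : s < 12 * k) :
    tH k s w = (if 2 * k ≤ y ∧ 3 * (y) + 2 ≤ s then -1 else 0)
      + (if 0 ≤ y ∧ y < 2 * k ∧ 3 * (y) + 1 ≤ s then -1 else 0)
      - (if 0 ≤ y + 2 * k + 1 ∧ 3 * (y + 2 * k + 1) ≤ s then 1 else 0)
      - (if 2 * k ≤ y + 2 * k ∧ 3 * (y + 2 * k) + 2 ≤ s then -1 else 0)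
      - (if 0 ≤ y - 4 * k ∧ 3 * (y - 4 * k) ≤ s then 1 else 0)
      - (if 2 * k ≤ y - 4 * k - 1 ∧ 3 * (y - 4 * k - 1) + 2 ≤ s then -1 else 0)
      + (if 0 ≤ y - 3 * k ∧ 3 * (y - 3 * k) ≤ s then 1 else 0)
      + (if 0 ≤ y + 3 * k + 1 ∧ 3 * (y + 3 * k + 1) ≤ s then 1 else 0)
      - (if 0 ≤ y - k ∧ y - k < 2 * k ∧ 3 * (y - k) + 1 ≤ s then -1 else 0) := by
  unfold tH
  rw [tA2 y (by omega) hs,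
    tA1 y (by omega),
    tA0 (y + 2 * k + 1) (by omega) hs,
    tA2 (y + 2 * k) (by omega) hs,
    tA0 (y - 4 * k) (by omega) hs,
    tA2 (y - 4 * k - 1) (by omega) hs,
    tA0 (y - 3 * k) (by omega) hs,
    tA0 (y + 3 * k + 1) (by omega) hs,
    tA1 (y - k) (by omega)]

/-- indicator that the six term formula does not vanish -/
def nz (k s w : ℤ) : ℤ := if tH k s w ≠ 0 then 1 else 0

/-- indicator of `s < m` -/
def lt1 (s m : ℤ) : ℤ := if s < m then 1 else 0

lemma sum_lt1 (n : ℕ) (m : ℤ) (h0 : 0 ≤ m) (h1 : m ≤ n) :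
    ∑ s ∈ Finset.range n, lt1 (s : ℤ) m = m := by
  induction n generalizing m with
  | zero => simp at *; omega
  | succ n ih =>
    rw [Finset.sum_range_succ]
    by_cases h : m ≤ n
    · rw [ih m h0 h, lt1, if_neg (by omega), add_zero]
    · have hm : m = n + 1 := by push_cast at h1; omega
      have : ∀ s ∈ Finset.range n, lt1 (s : ℤ) m = lt1 (s : ℤ) (n : ℤ) := by
        intro s hs
        have := Finset.mem_range.1 hs
        rw [lt1, lt1, if_pos (by omega), if_pos (by omega)]
      rw [Finset.sum_congr rfl this, ih n (by omega) le_rfl, lt1, if_pos (by omega), hm]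

lemma col_of (k : ℕ) (w a b c d : ℤ)
    (h : ∀ s : ℤ, 0 ≤ s → s < 12 * k → nz k s w = lt1 s b - lt1 s a + lt1 s d - lt1 s c)
    (ha : 0 ≤ a ∧ a ≤ 12 * k) (hb : 0 ≤ b ∧ b ≤ 12 * k)
    (hc : 0 ≤ c ∧ c ≤ 12 * k) (hd : 0 ≤ d ∧ d ≤ 12 * k) :
    ∑ s ∈ Finset.range (12 * k), nz k s w = b - a + d - c := by
  have : ∀ s ∈ Finset.range (12 * k), nz k s w
      = lt1 (s : ℤ) b - lt1 (s : ℤ) a + lt1 (s : ℤ) d - lt1 (s : ℤ) c := by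
    intro s hs
    have := Finset.mem_range.1 hs
    exact h s (by omega) (by omega)
  rw [Finset.sum_congr rfl this, Finset.sum_sub_distrib, Finset.sum_add_distrib,
    Finset.sum_sub_distrib, sum_lt1, sum_lt1, sum_lt1, sum_lt1] <;> push_cast <;> omega

set_option maxHeartbeats 2000000 in
lemma col_0 (k : ℕ) (y : ℤ) (hy : 0 ≤ y) (hy6 : y ≤ 6 * k) :
    ∑ s ∈ Finset.range (12 * k), nz k s (3 * y)
      = 1 + (6 * k + 1) * lt1 y (5 * k + 1) - (6 * k + 1) * lt1 y (3 * k + 1)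
        + (6 * k - 1) * lt1 y (2 * k + 1) := by
  have hcase : (y ≤ 2 * k) ∨ (2 * k < y ∧ y ≤ 3 * k) ∨ (3 * k < y ∧ y ≤ 4 * k) ∨ (4 * k < y ∧ y ≤ 5 * k) ∨ (5 * k < y ∧ y ≤ 6 * k) := by omega
  rcases hcase with h | h | h | h | h
  · rw [col_of k (3 * y) (3 * y) (3 * y + 6 * k) (0) (0)]
    · simp (disch := omega) only [lt1, if_neg, if_pos]
      ring
    · intro s hs0 hs
      rw [nz, tH_0 y rfl hs]
      simp (disch := omega) only [lt1, if_neg]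
      split_ifs <;> omega
    all_goals omega
  · rw [col_of k (3 * y) (3 * y - 1) (3 * y) (0) (0)]
    · simp (disch := omega) only [lt1, if_neg, if_pos]
      ring
    · intro s hs0 hs
      rw [nz, tH_0 y rfl hs]
      simp (disch := omega) only [lt1, if_neg]
      split_ifs <;> omega
    all_goals omega
  · rw [col_of k (3 * y) (3 * y - 9 * k - 2) (3 * y - 3 * k - 1) (3 * y - 1) (3 * y)]
    · simp (disch := omega) only [lt1, if_neg, if_pos]
      ring
    · intro s hs0 hs
      rw [nz, tH_0 y rfl hs]
      simp (disch := omega) only [lt1, if_neg]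
      split_ifs <;> omega
    all_goals omega
  · rw [col_of k (3 * y) (3 * y - 12 * k - 3) (3 * y - 12 * k - 2) (3 * y - 9 * k - 2) (3 * y - 3 * k - 1)]
    · simp (disch := omega) only [lt1, if_neg, if_pos]
      ring
    · intro s hs0 hs
      rw [nz, tH_0 y rfl hs]
      simp (disch := omega) only [lt1, if_neg]
      split_ifs <;> omega
    all_goals omega
  · rw [col_of k (3 * y) (3 * y - 12 * k - 3) (3 * y - 12 * k - 2) (0) (0)]
    · simp (disch := omega) only [lt1, if_neg, if_pos]
      ring
    · intro s hs0 hs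
      rw [nz, tH_0 y rfl hs]
      simp (disch := omega) only [lt1, if_neg]
      split_ifs <;> omega
    all_goals omega

set_option maxHeartbeats 2000000 in
lemma col_1 (k : ℕ) (y : ℤ) (hy : 0 ≤ y) (hy6 : y ≤ 6 * k) :
    ∑ s ∈ Finset.range (12 * k), nz k s (3 * y + 1)
      = 3 * k + 1 + (6 * k + 1) * lt1 y (5 * k + 1) - (6 * k + 2) * lt1 y (4 * k + 1)
        + (6 * k + 1) * lt1 y (2 * k) - 6 * k * lt1 y k := by
  have hcase : (y < k) ∨ (k ≤ y ∧ y < 2 * k) ∨ (2 * k ≤ y ∧ y ≤ 4 * k) ∨ (4 * k < y ∧ y ≤ 5 * k) ∨ (5 * k < y ∧ y ≤ 6 * k) := by omega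
  rcases hcase with h | h | h | h | h
  · rw [col_of k (3 * y + 1) (3 * y + 1 - 1) (3 * y + 1) (3 * y + 1 + 6 * k + 1) (3 * y + 1 + 9 * k + 1)]
    · simp (disch := omega) only [lt1, if_neg, if_pos]
      ring
    · intro s hs0 hs
      rw [nz, tH_1 y rfl hs]
      simp (disch := omega) only [lt1, if_neg]
      split_ifs <;> omega
    all_goals omega
  · rw [col_of k (3 * y + 1) (3 * y + 1 - 3 * k - 1) (3 * y + 1 - 1) (3 * y + 1) (3 * y + 1 + 6 * k + 1)]
    · simp (disch := omega) only [lt1, if_neg, if_pos]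
      ring
    · intro s hs0 hs
      rw [nz, tH_1 y rfl hs]
      simp (disch := omega) only [lt1, if_neg]
      split_ifs <;> omega
    all_goals omega
  · rw [col_of k (3 * y + 1) (3 * y + 1 - 3 * k - 1) (3 * y + 1 - 1) (0) (0)]
    · simp (disch := omega) only [lt1, if_neg, if_pos]
      ring
    · intro s hs0 hs
      rw [nz, tH_1 y rfl hs]
      simp (disch := omega) only [lt1, if_neg]
      split_ifs <;> omega
    all_goals omega
  · rw [col_of k (3 * y + 1) (3 * y + 1 - 12 * k - 3) (3 * y + 1 - 3 * k - 1) (0) (0)]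
    · simp (disch := omega) only [lt1, if_neg, if_pos]
      ring
    · intro s hs0 hs
      rw [nz, tH_1 y rfl hs]
      simp (disch := omega) only [lt1, if_neg]
      split_ifs <;> omega
    all_goals omega
  · rw [col_of k (3 * y + 1) (3 * y + 1 - 12 * k - 3) (3 * y + 1 - 9 * k - 2) (0) (0)]
    · simp (disch := omega) only [lt1, if_neg, if_pos]
      ring
    · intro s hs0 hs
      rw [nz, tH_1 y rfl hs]
      simp (disch := omega) only [lt1, if_neg]
      split_ifs <;> omega
    all_goals omega

set_option maxHeartbeats 2000000 in
lemma col_2 (k : ℕ) (y : ℤ) (hy : 0 ≤ y) (hy6 : y ≤ 6 * k) :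
    ∑ s ∈ Finset.range (12 * k), nz k s (3 * y + 2)
      = 3 * k + (6 * k + 2) * lt1 y (4 * k) - (6 * k + 1) * lt1 y (3 * k) + 6 * k * lt1 y k := by
  have hcase : (y < k) ∨ (k ≤ y ∧ y < 2 * k) ∨ (2 * k ≤ y ∧ y < 3 * k) ∨ (3 * k ≤ y ∧ y < 4 * k) ∨ (4 * k ≤ y ∧ y ≤ 6 * k) := by omega
  rcases hcase with h | h | h | h | h
  · rw [col_of k (3 * y + 2) (3 * y + 2 - 1) (3 * y + 2 + 6 * k) (3 * y + 2 + 6 * k + 1) (3 * y + 2 + 9 * k + 1)]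
    · simp (disch := omega) only [lt1, if_neg, if_pos]
      ring
    · intro s hs0 hs
      rw [nz, tH_2 y rfl hs]
      simp (disch := omega) only [lt1, if_neg]
      split_ifs <;> omega
    all_goals omega
  · rw [col_of k (3 * y + 2) (3 * y + 2 - 3 * k - 1) (3 * y + 2 - 1) (3 * y + 2 + 6 * k) (3 * y + 2 + 6 * k + 1)]
    · simp (disch := omega) only [lt1, if_neg, if_pos]
      ring
    · intro s hs0 hs
      rw [nz, tH_2 y rfl hs]
      simp (disch := omega) only [lt1, if_neg]
      split_ifs <;> omega
    all_goals omega
  · rw [col_of k (3 * y + 2) (3 * y + 2 - 3 * k - 1) (3 * y + 2) (0) (0)]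
    · simp (disch := omega) only [lt1, if_neg, if_pos]
      ring
    · intro s hs0 hs
      rw [nz, tH_2 y rfl hs]
      simp (disch := omega) only [lt1, if_neg]
      split_ifs <;> omega
    all_goals omega
  · rw [col_of k (3 * y + 2) (3 * y + 2 - 9 * k - 2) (3 * y + 2) (0) (0)]
    · simp (disch := omega) only [lt1, if_neg, if_pos]
      ring
    · intro s hs0 hs
      rw [nz, tH_2 y rfl hs]
      simp (disch := omega) only [lt1, if_neg]
      split_ifs <;> omega
    all_goals omega
  · rw [col_of k (3 * y + 2) (3 * y + 2 - 12 * k - 2) (3 * y + 2 - 9 * k - 2) (0) (0)]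
    · simp (disch := omega) only [lt1, if_neg, if_pos]
      ring
    · intro s hs0 hs
      rw [nz, tH_2 y rfl hs]
      simp (disch := omega) only [lt1, if_neg]
      split_ifs <;> omega
    all_goals omega

lemma sum_range_three (f : ℕ → ℤ) (n : ℕ) :
    ∑ i ∈ Finset.range (3 * n), f i
      = ∑ y ∈ Finset.range n, (f (3 * y) + f (3 * y + 1) + f (3 * y + 2)) := by
  induction n with
  | zero => simp
  | succ n ih =>
    rw [show 3 * (n + 1) = 3 * n + 1 + 1 + 1 by ring, Finset.sum_range_succ,
      Finset.sum_range_succ, Finset.sum_range_succ, ih, Finset.sum_range_succ]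
    ring

lemma total (k : ℕ) :
    ∑ s ∈ Finset.range (12 * k), ∑ w ∈ Finset.range (18 * k + 3), nz k s w
      = 84 * k ^ 2 + 28 * k := by
  rw [Finset.sum_comm, show 18 * k + 3 = 3 * (6 * k + 1) by ring, sum_range_three]
  have : ∀ y ∈ Finset.range (6 * k + 1),
      ((∑ s ∈ Finset.range (12 * k), nz k s ((3 * y : ℕ) : ℤ))
      + (∑ s ∈ Finset.range (12 * k), nz k s ((3 * y + 1 : ℕ) : ℤ))
      + (∑ s ∈ Finset.range (12 * k), nz k s ((3 * y + 2 : ℕ) : ℤ)))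
      = (6 * k + 2 : ℤ) + (12 * k + 2) * lt1 y (5 * k + 1) - (6 * k + 2) * lt1 y (4 * k + 1)
        + (6 * k + 2) * lt1 y (4 * k) - (6 * k + 1) * lt1 y (3 * k + 1)
        - (6 * k + 1) * lt1 y (3 * k)
        + (6 * k - 1) * lt1 y (2 * k + 1) + (6 * k + 1) * lt1 y (2 * k) := by
    intro y hy
    have := Finset.mem_range.1 hy
    push_cast
    rw [col_0 k y (by omega) (by omega), col_1 k y (by omega) (by omega),
      col_2 k y (by omega) (by omega)]
    ring
  rw [Finset.sum_congr rfl this]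
  simp only [Finset.sum_add_distrib, Finset.sum_sub_distrib, ← Finset.mul_sum,
    Finset.sum_const, Finset.card_range, nsmul_eq_mul]
  rw [sum_lt1, sum_lt1, sum_lt1, sum_lt1, sum_lt1, sum_lt1, sum_lt1]
  · push_cast
    ring
  all_goals (push_cast; omega)

lemma diag1_0 {k y : ℤ} (hk : 1 ≤ k) (hy : 0 ≤ y) (hy4 : y < 4 * k) :
    nz k (3 * y) ((3 * y)) = lt1 y (2 * k + 1) := by
  rw [nz, tH_0 (y) (by omega) (by omega)]
  simp (disch := omega) only [lt1, if_neg, if_pos]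
  all_goals (try split_ifs)
  all_goals omega

lemma diag1_1 {k y : ℤ} (hk : 1 ≤ k) (hy : 0 ≤ y) (hy4 : y < 4 * k) :
    nz k (3 * y + 1) ((3 * y + 1)) = lt1 y (2 * k) - lt1 y k := by
  rw [nz, tH_1 (y) (by omega) (by omega)]
  simp (disch := omega) only [lt1, if_neg, if_pos]
  all_goals (try split_ifs)
  all_goals omega

lemma diag1_2 {k y : ℤ} (hk : 1 ≤ k) (hy : 0 ≤ y) (hy4 : y < 4 * k) :
    nz k (3 * y + 2) ((3 * y + 2)) = lt1 y k := by
  rw [nz, tH_2 (y) (by omega) (by omega)]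
  simp (disch := omega) only [lt1, if_neg, if_pos]
  all_goals (try split_ifs)
  all_goals omega

lemma diag1 (k : ℕ) (hk : 1 ≤ k) :
    ∑ s ∈ Finset.range (12 * k), nz k s ((s : ℤ)) = 4 * k + 1 := by
  rw [show 12 * k = 3 * (4 * k) by ring, sum_range_three]
  rw [Finset.sum_congr rfl (g := fun y : ℕ => (lt1 (y : ℤ) (2 * k + 1)) + (lt1 (y : ℤ) (2 * k) - lt1 (y : ℤ) k) + (lt1 (y : ℤ) k))]
  · simp only [Finset.sum_add_distrib, Finset.sum_sub_distrib, Finset.sum_const,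
      Finset.card_range, nsmul_eq_mul]
    repeat rw [sum_lt1]
    all_goals (push_cast; omega)
  · intro y hy
    have := Finset.mem_range.1 hy
    push_cast
    rw [diag1_0 (by omega) (by omega) (by omega), diag1_1 (by omega) (by omega) (by omega),
      diag1_2 (by omega) (by omega) (by omega)]

lemma diag2_0 {k y : ℤ} (hk : 1 ≤ k) (hy : 0 ≤ y) (hy4 : y < 4 * k) :
    nz k (3 * y) (if (3 * y) ≤ 9 * k then (3 * y) + 9 * k + 2 else (3 * y) - 9 * k - 1) = lt1 y k := by
  by_cases h : 3 * y ≤ 9 * k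
  · rw [if_pos h]
    rw [nz, tH_2 (y + 3 * k) (by omega) (by omega)]
    simp (disch := omega) only [lt1, if_neg, if_pos]
    all_goals (try split_ifs)
    all_goals omega
  · rw [if_neg h]
    rw [nz, tH_2 (y - 3 * k - 1) (by omega) (by omega)]
    simp (disch := omega) only [lt1, if_neg, if_pos]
    all_goals (try split_ifs)
    all_goals omega

lemma diag2_1 {k y : ℤ} (hk : 1 ≤ k) (hy : 0 ≤ y) (hy4 : y < 4 * k) :
    nz k (3 * y + 1) (if (3 * y + 1) ≤ 9 * k then (3 * y + 1) + 9 * k + 2 else (3 * y + 1) - 9 * k - 1) = lt1 y (2 * k) := by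
  by_cases h : 3 * y + 1 ≤ 9 * k
  · rw [if_pos h]
    rw [nz, tH_0 (y + 3 * k + 1) (by omega) (by omega)]
    simp (disch := omega) only [lt1, if_neg, if_pos]
    all_goals (try split_ifs)
    all_goals omega
  · rw [if_neg h]
    rw [nz, tH_0 (y - 3 * k) (by omega) (by omega)]
    simp (disch := omega) only [lt1, if_neg, if_pos]
    all_goals (try split_ifs)
    all_goals omega

lemma diag2_2 {k y : ℤ} (hk : 1 ≤ k) (hy : 0 ≤ y) (hy4 : y < 4 * k) :
    nz k (3 * y + 2) (if (3 * y + 2) ≤ 9 * k then (3 * y + 2) + 9 * k + 2 else (3 * y + 2) - 9 * k - 1) = lt1 y (2 * k) - lt1 y k := by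
  by_cases h : 3 * y + 2 ≤ 9 * k
  · rw [if_pos h]
    rw [nz, tH_1 (y + 3 * k + 1) (by omega) (by omega)]
    simp (disch := omega) only [lt1, if_neg, if_pos]
    all_goals (try split_ifs)
    all_goals omega
  · rw [if_neg h]
    rw [nz, tH_1 (y - 3 * k) (by omega) (by omega)]
    simp (disch := omega) only [lt1, if_neg, if_pos]
    all_goals (try split_ifs)
    all_goals omega

lemma diag2 (k : ℕ) (hk : 1 ≤ k) :
    ∑ s ∈ Finset.range (12 * k), nz k s (if (s : ℤ) ≤ 9 * k then (s : ℤ) + 9 * k + 2 else (s : ℤ) - 9 * k - 1) = 4 * k := by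
  rw [show 12 * k = 3 * (4 * k) by ring, sum_range_three]
  rw [Finset.sum_congr rfl (g := fun y : ℕ => (lt1 (y : ℤ) k) + (lt1 (y : ℤ) (2 * k)) + (lt1 (y : ℤ) (2 * k) - lt1 (y : ℤ) k))]
  · simp only [Finset.sum_add_distrib, Finset.sum_sub_distrib, Finset.sum_const,
      Finset.card_range, nsmul_eq_mul]
    repeat rw [sum_lt1]
    all_goals (push_cast; omega)
  · intro y hy
    have := Finset.mem_range.1 hy
    push_cast
    rw [diag2_0 (by omega) (by omega) (by omega), diag2_1 (by omega) (by omega) (by omega),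
      diag2_2 (by omega) (by omega) (by omega)]

lemma diag3_0 {k y : ℤ} (hk : 1 ≤ k) (hy : 0 ≤ y) (hy4 : y < 4 * k) :
    nz k (3 * y) (if (3 * y) ≤ 6 * k - 2 then (3 * y) + 12 * k + 4 else (3 * y) - 6 * k + 1) = 1 - lt1 y (3 * k) := by
  by_cases h : 3 * y ≤ 6 * k - 2
  · rw [if_pos h]
    rw [nz, tH_1 (y + 4 * k + 1) (by omega) (by omega)]
    simp (disch := omega) only [lt1, if_neg, if_pos]
    all_goals (try split_ifs)
    all_goals omega
  · rw [if_neg h]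
    rw [nz, tH_1 (y - 2 * k) (by omega) (by omega)]
    simp (disch := omega) only [lt1, if_neg, if_pos]
    all_goals (try split_ifs)
    all_goals omega

lemma diag3_1 {k y : ℤ} (hk : 1 ≤ k) (hy : 0 ≤ y) (hy4 : y < 4 * k) :
    nz k (3 * y + 1) (if (3 * y + 1) ≤ 6 * k - 2 then (3 * y + 1) + 12 * k + 4 else (3 * y + 1) - 6 * k + 1) = lt1 y (3 * k) - lt1 y (2 * k) := by
  by_cases h : 3 * y + 1 ≤ 6 * k - 2
  · rw [if_pos h]
    rw [nz, tH_2 (y + 4 * k + 1) (by omega) (by omega)]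
    simp (disch := omega) only [lt1, if_neg, if_pos]
    all_goals (try split_ifs)
    all_goals omega
  · rw [if_neg h]
    rw [nz, tH_2 (y - 2 * k) (by omega) (by omega)]
    simp (disch := omega) only [lt1, if_neg, if_pos]
    all_goals (try split_ifs)
    all_goals omega

lemma diag3_2 {k y : ℤ} (hk : 1 ≤ k) (hy : 0 ≤ y) (hy4 : y < 4 * k) :
    nz k (3 * y + 2) (if (3 * y + 2) ≤ 6 * k - 2 then (3 * y + 2) + 12 * k + 4 else (3 * y + 2) - 6 * k + 1) = 1 - lt1 y (2 * k - 1) := by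
  by_cases h : 3 * y + 2 ≤ 6 * k - 2
  · rw [if_pos h]
    rw [nz, tH_0 (y + 4 * k + 2) (by omega) (by omega)]
    simp (disch := omega) only [lt1, if_neg, if_pos]
    all_goals (try split_ifs)
    all_goals omega
  · rw [if_neg h]
    rw [nz, tH_0 (y - 2 * k + 1) (by omega) (by omega)]
    simp (disch := omega) only [lt1, if_neg, if_pos]
    all_goals (try split_ifs)
    all_goals omega

lemma diag3 (k : ℕ) (hk : 1 ≤ k) :
    ∑ s ∈ Finset.range (12 * k), nz k s (if (s : ℤ) ≤ 6 * k - 2 then (s : ℤ) + 12 * k + 4 else (s : ℤ) - 6 * k + 1) = 4 * k + 1 := by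
  rw [show 12 * k = 3 * (4 * k) by ring, sum_range_three]
  rw [Finset.sum_congr rfl (g := fun y : ℕ => (1 - lt1 (y : ℤ) (3 * k)) + (lt1 (y : ℤ) (3 * k) - lt1 (y : ℤ) (2 * k)) + (1 - lt1 (y : ℤ) (2 * k - 1)))]
  · simp only [Finset.sum_add_distrib, Finset.sum_sub_distrib, Finset.sum_const,
      Finset.card_range, nsmul_eq_mul]
    repeat rw [sum_lt1]
    all_goals (push_cast; omega)
  · intro y hy
    have := Finset.mem_range.1 hy
    push_cast
    rw [diag3_0 (by omega) (by omega) (by omega), diag3_1 (by omega) (by omega) (by omega),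
      diag3_2 (by omega) (by omega) (by omega)]

lemma diag4_0 {k y : ℤ} (hk : 1 ≤ k) (hy : 0 ≤ y) (hy4 : y < 4 * k) :
    nz k (3 * y) ((3 * y) + 3 * k + 2) = lt1 y (3 * k) - lt1 y (2 * k) := by
  rw [nz, tH_2 (y + k) (by omega) (by omega)]
  simp (disch := omega) only [lt1, if_neg, if_pos]
  all_goals (try split_ifs)
  all_goals omega

lemma diag4_1 {k y : ℤ} (hk : 1 ≤ k) (hy : 0 ≤ y) (hy4 : y < 4 * k) :
    nz k (3 * y + 1) ((3 * y + 1) + 3 * k + 2) = 1 - lt1 y (2 * k) := by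
  rw [nz, tH_0 (y + k + 1) (by omega) (by omega)]
  simp (disch := omega) only [lt1, if_neg, if_pos]
  all_goals (try split_ifs)
  all_goals omega

lemma diag4_2 {k y : ℤ} (hk : 1 ≤ k) (hy : 0 ≤ y) (hy4 : y < 4 * k) :
    nz k (3 * y + 2) ((3 * y + 2) + 3 * k + 2) = 1 - lt1 y (3 * k) := by
  rw [nz, tH_1 (y + k + 1) (by omega) (by omega)]
  simp (disch := omega) only [lt1, if_neg, if_pos]
  all_goals (try split_ifs)
  all_goals omega

lemma diag4 (k : ℕ) (hk : 1 ≤ k) :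
    ∑ s ∈ Finset.range (12 * k), nz k s ((s : ℤ) + 3 * k + 2) = 4 * k := by
  rw [show 12 * k = 3 * (4 * k) by ring, sum_range_three]
  rw [Finset.sum_congr rfl (g := fun y : ℕ => (lt1 (y : ℤ) (3 * k) - lt1 (y : ℤ) (2 * k)) + (1 - lt1 (y : ℤ) (2 * k)) + (1 - lt1 (y : ℤ) (3 * k)))]
  · simp only [Finset.sum_add_distrib, Finset.sum_sub_distrib, Finset.sum_const,
      Finset.card_range, nsmul_eq_mul]
    repeat rw [sum_lt1]
    all_goals (push_cast; omega)
  · intro y hy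
    have := Finset.mem_range.1 hy
    push_cast
    rw [diag4_0 (by omega) (by omega) (by omega), diag4_1 (by omega) (by omega) (by omega),
      diag4_2 (by omega) (by omega) (by omega)]


lemma cA_rec (k n : ℤ) (hk : 1 ≤ k) :
    cA k n + cA k (n - 1) + cA k (n - 2)
      = (if n = 0 then 1 else 0) + (if n = 6 * k + 1 then 1 else 0)
        + (if n = 12 * k + 2 then 1 else 0) := by
  have h : n % 3 = 0 ∨ n % 3 = 1 ∨ n % 3 = 2 := by omega
  rcases h with h | h | h
  · have h1 : (n - 1) % 3 = 2 := by omega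
    have h2 : (n - 2) % 3 = 1 := by omega
    simp only [cA, h, h1, h2]
    norm_num
    split_ifs <;> omega
  · have h1 : (n - 1) % 3 = 0 := by omega
    have h2 : (n - 2) % 3 = 2 := by omega
    simp only [cA, h, h1, h2]
    norm_num
    split_ifs <;> omega
  · have h1 : (n - 1) % 3 = 1 := by omega
    have h2 : (n - 2) % 3 = 0 := by omega
    simp only [cA, h, h1, h2]
    norm_num
    split_ifs <;> omega

lemma cA_neg (k n : ℤ) (hk : 0 ≤ k) (h : n < 0) : cA k n = 0 := by
  unfold cA; split_ifs <;> omega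

lemma cA_big (k n : ℤ) (hk : 0 ≤ k) (h : 12 * k < n) : cA k n = 0 := by
  unfold cA; split_ifs <;> omega

/-- the coefficient series of `Φ_{3p}` -/
lemma mk_cA (k : ℕ) (hk : 1 ≤ k) :
    (PowerSeries.mk (fun n => cA k n)) * (1 + PowerSeries.X + PowerSeries.X ^ 2)
      = 1 + PowerSeries.X ^ (6 * k + 1) + PowerSeries.X ^ (12 * k + 2) := by
  ext n
  have e : (PowerSeries.mk (fun n : ℕ => cA k n)) * (1 + PowerSeries.X + PowerSeries.X ^ 2)
    = PowerSeries.mk (fun n : ℕ => cA k n) + PowerSeries.mk (fun n : ℕ => cA k n) * PowerSeries.X ^ 1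
      + PowerSeries.mk (fun n : ℕ => cA k n) * PowerSeries.X ^ 2 := by ring
  rw [e]
  simp only [map_add, PowerSeries.coeff_mul_X_pow', PowerSeries.coeff_mk, PowerSeries.coeff_X_pow,
    PowerSeries.coeff_one]
  have := cA_rec k n (by omega)
  have h1 : (if 1 ≤ n then cA k ((n - 1 : ℕ) : ℤ) else 0) = cA k (n - 1) := by
    split_ifs with h
    · congr 1; omega
    · rw [cA_neg] <;> omega
  have h2 : (if 2 ≤ n then cA k ((n - 2 : ℕ) : ℤ) else 0) = cA k (n - 2) := by
    split_ifs with h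
    · congr 1; omega
    · rw [cA_neg] <;> omega
  rw [h1, h2, this]
  congr 1
  · congr 1
    · simp
    · congr 1; apply propext; omega
  · congr 1; apply propext; omega

/-- indicator of a residue class modulo `18k+3` -/
def ib (k t e : ℤ) : ℤ := if (18 * k + 3) ∣ t - e then 1 else 0

/-- the periodic coefficients of the inverse of `Φ_{3p}` -/
def bZ (k t : ℤ) : ℤ :=
  ib k t 0 + ib k t 1 + ib k t 2 - ib k t (6 * k + 1) - ib k t (6 * k + 2) - ib k t (6 * k + 3)

lemma ib_congr {k t t' e e' : ℤ} (h : (18 * k + 3) ∣ (t - e) - (t' - e')) :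
    ib k t e = ib k t' e' := by
  unfold ib
  congr 1
  apply propext
  exact ⟨fun h1 => by have := dvd_sub h1 h; simpa using this,
    fun h1 => by have := dvd_add h h1; simpa using this⟩

lemma bZ_congr {k t t' : ℤ} (h : (18 * k + 3) ∣ t - t') : bZ k t = bZ k t' := by
  have : ∀ e, ib k t e = ib k t' e := fun e => ib_congr (by simpa using h)
  simp only [bZ, this]

lemma bZ_symm (k t : ℤ) : bZ k (6 * k + 3 - t) = - bZ k t := by
  have key : ∀ e, ib k (6 * k + 3 - t) e = ib k t (6 * k + 3 - e) := by
    intro e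
    unfold ib
    congr 1
    apply propext
    rw [← dvd_neg]
    ring_nf
  simp only [bZ, key]
  ring_nf

lemma ib_small {k : ℤ} (n e : ℤ) (hn : 0 ≤ n) (hn' : n < 18 * k + 3) (he : 0 ≤ e)
    (he' : e < 18 * k + 3) : ib k n e = if n = e then 1 else 0 := by
  unfold ib
  congr 1
  apply propext
  constructor
  · intro h
    have := Int.eq_zero_of_abs_lt_dvd h (by rw [abs_lt]; constructor <;> omega)
    omega
  · rintro rfl; simp

lemma mk_bZ (k : ℕ) (hk : 1 ≤ k) :
    (PowerSeries.mk (fun n => bZ k n)) * (1 - PowerSeries.X ^ (18 * k + 3))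
      = (1 + PowerSeries.X + PowerSeries.X ^ 2) * (1 - PowerSeries.X ^ (6 * k + 1)) := by
  ext n
  have e : (PowerSeries.mk (fun n : ℕ => bZ k n)) * (1 - PowerSeries.X ^ (18 * k + 3))
    = PowerSeries.mk (fun n : ℕ => bZ k n)
      - PowerSeries.mk (fun n : ℕ => bZ k n) * PowerSeries.X ^ (18 * k + 3) := by ring
  have e2 : (1 + PowerSeries.X + PowerSeries.X ^ 2) * (1 - PowerSeries.X ^ (6 * k + 1))
      = PowerSeries.X ^ 0 + PowerSeries.X ^ 1 + PowerSeries.X ^ 2 - PowerSeries.X ^ (6 * k + 1)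
        - PowerSeries.X ^ (6 * k + 2) - (PowerSeries.X ^ (6 * k + 3) : PowerSeries ℤ) := by ring
  rw [e, e2]
  simp only [map_add, map_sub, PowerSeries.coeff_mul_X_pow', PowerSeries.coeff_mk,
    PowerSeries.coeff_X_pow]
  by_cases h : 18 * k + 3 ≤ n
  · rw [if_pos h, bZ_congr (t := ((n - (18 * k + 3) : ℕ) : ℤ)) (t' := n)]
    · simp (disch := omega) only [if_neg]
      ring
    · exact ⟨-1, by push_cast [Nat.cast_sub h]; ring⟩
  · rw [if_neg h, bZ, ib_small, ib_small, ib_small, ib_small, ib_small, ib_small]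
    · have c : ∀ e : ℕ, (if n = e then (1:ℤ) else 0) = if (n : ℤ) = (e : ℤ) then 1 else 0 := by
        intro e; congr 1; apply propext; omega
      simp only [c]
      push_cast
      ring
    all_goals omega

lemma cyc3p (k : ℕ) (hk : 1 ≤ k) (hp : (6 * k + 1).Prime) :
     ((cyclotomic (3 * (6 * k + 1)) ℤ : ℤ[X]) : PowerSeries ℤ)
    * (1 + PowerSeries.X + PowerSeries.X ^ 2)
      = 1 + PowerSeries.X ^ (6 * k + 1) + PowerSeries.X ^ (12 * k + 2) := by
  have h := cyclotomic_expand_eq_cyclotomic_mul (n := 3) hp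
    (by intro h; have := Nat.le_of_dvd (by norm_num) h; omega) ℤ
  rw [cyclotomic_three] at h
  have h2 := congrArg (fun f : ℤ[X] => (f : PowerSeries ℤ)) h
  simp only [map_add, map_pow, expand_X, map_one, Polynomial.coe_mul, Polynomial.coe_add,
    Polynomial.coe_pow, Polynomial.coe_X, Polynomial.coe_one] at h2
  rw [show (1 + PowerSeries.X + PowerSeries.X ^ 2 : PowerSeries ℤ)
    = PowerSeries.X ^ 2 + PowerSeries.X + 1 by ring, ← h2]
  ring

lemma poly_ne : (1 + PowerSeries.X + PowerSeries.X ^ 2 : PowerSeries ℤ) ≠ 0 := by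
  intro h
  have := congrArg (PowerSeries.constantCoeff (R := ℤ)) h
  simp at this

lemma cyc3p_coeff (k : ℕ) (hk : 1 ≤ k) (hp : (6 * k + 1).Prime) (n : ℕ) :
     (cyclotomic (3 * (6 * k + 1)) ℤ).coeff n = cA k n := by
  have h : ((cyclotomic (3 * (6 * k + 1)) ℤ : ℤ[X]) : PowerSeries ℤ)
      = PowerSeries.mk (fun n : ℕ => cA k n) := by
    apply mul_right_cancel₀ (poly_ne)
    rw [cyc3p k hk hp, mk_cA k hk]
  rw [← Polynomial.coeff_coe, h, PowerSeries.coeff_mk]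

lemma cyc_series (k q : ℕ) (hk : 1 ≤ k) (hp : (6 * k + 1).Prime) (hq : q.Prime)
    (hgt : 18 * k + 3 < q) :
     ((cyclotomic (3 * (6 * k + 1) * q) ℤ : ℤ[X]) : PowerSeries ℤ)
    = ((expand ℤ q (cyclotomic (3 * (6 * k + 1)) ℤ) : ℤ[X]) : PowerSeries ℤ)
      * PowerSeries.mk (fun n : ℕ => bZ k n) := by
  have h := cyclotomic_expand_eq_cyclotomic_mul (n := 3 * (6 * k + 1)) hq
    (by intro h; have := Nat.le_of_dvd (by omega) h; omega) ℤ
  have hne : (1 - PowerSeries.X ^ (18 * k + 3) : PowerSeries ℤ) ≠ 0 := by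
    intro h
    have := congrArg (PowerSeries.constantCoeff (R := ℤ)) h
    simp at this
  apply mul_right_cancel₀ hne
  rw [mul_assoc ((expand ℤ q (cyclotomic (3 * (6 * k + 1)) ℤ) : ℤ[X]) : PowerSeries ℤ), mk_bZ k hk, h, Polynomial.coe_mul]
  have h3 := cyc3p k hk hp
  have e : (1 - PowerSeries.X ^ (18 * k + 3) : PowerSeries ℤ)
    = (1 + PowerSeries.X ^ (6 * k + 1) + PowerSeries.X ^ (12 * k + 2))
      * (1 - PowerSeries.X ^ (6 * k + 1)) := by ring
  rw [e, ← h3]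
  ring

lemma cyc_coeff (k q : ℕ) (hk : 1 ≤ k) (hp : (6 * k + 1).Prime) (hq : q.Prime)
    (hgt : 18 * k + 3 < q) (s u : ℕ) (hu : u < q) :
    (cyclotomic (3 * (6 * k + 1) * q) ℤ).coeff (q * s + u)
      = ∑ j ∈ Finset.range (s + 1), cA k j * bZ k (q * (s - j) + u) := by
  have hq0 : 0 < q := hq.pos
  rw [← Polynomial.coeff_coe, cyc_series k q hk hp hq hgt, PowerSeries.coeff_mul,
    Finset.Nat.sum_antidiagonal_eq_sum_range_succ_mk]
  symm
  apply Finset.sum_of_injOn (fun j => q * j)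
  · intro a _ b _ h
    exact Nat.eq_of_mul_eq_mul_left hq0 h
  · intro j hj
    simp only [Finset.coe_range, Set.mem_Iio] at hj ⊢
    have : q * j ≤ q * s := Nat.mul_le_mul_left _ (by omega)
    omega
  · intro i hi hni
    rw [Polynomial.coeff_coe, coeff_expand hq0, if_neg, zero_mul]
    rintro ⟨j, rfl⟩
    apply hni
    refine ⟨j, ?_, rfl⟩
    simp only [Finset.mem_range] at hi
    simp only [Finset.coe_range, Set.mem_Iio]
    by_contra hj
    have : q * (s + 1) ≤ q * j := Nat.mul_le_mul_left _ (by omega)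
    rw [Nat.mul_add] at this
    omega
  · intro j hj
    have hj' := Finset.mem_range.1 hj
    have : q * j ≤ q * s := Nat.mul_le_mul_left _ (by omega)
    simp only [Polynomial.coeff_coe, coeff_expand hq0, dvd_mul_right, if_true,
      Nat.mul_div_cancel_left _ hq0, cyc3p_coeff k hk hp, PowerSeries.coeff_mk]
    congr 2
    rw [Nat.cast_sub (by omega)]
    push_cast
    ring

lemma sum_ib (k s x : ℤ) (n : ℕ) (hk : 0 ≤ k) (hn : (n : ℤ) = s) (hs : s < 12 * k)
    (hx : - (18 * k + 3) ≤ x) (hx' : x < 2 * (18 * k + 3)) :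
    ∑ j ∈ Finset.range (n + 1), cA k j * ib k j x
      = tA k s x + tA k s (x - (18 * k + 3)) + tA k s (x + (18 * k + 3)) := by
  have one : ∀ z : ℤ, ∑ j ∈ Finset.range (n + 1), cA k j * (if (j : ℤ) = z then 1 else 0)
      = tA k s z := by
    intro z
    unfold tA
    by_cases hz : 0 ≤ z
    · lift z to ℕ using hz
      simp only [Nat.cast_inj, mul_ite, mul_one, mul_zero, Finset.sum_ite_eq', Finset.mem_range]
      congr 1; apply propext; omega
    · rw [cA_neg k z hk (by omega), ite_self]
      apply Finset.sum_eq_zero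
      intro j _
      rw [if_neg (by omega), mul_zero]
  rw [← one, ← one, ← one, ← Finset.sum_add_distrib, ← Finset.sum_add_distrib]
  apply Finset.sum_congr rfl
  intro j hj
  have hj := Finset.mem_range.1 hj
  rw [← mul_add, ← mul_add]
  congr 1
  unfold ib
  by_cases h : (18 * k + 3) ∣ (j : ℤ) - x
  · rw [if_pos h]
    obtain ⟨c, hc⟩ := h
    have hc1 : c < 2 := by
      by_contra h'
      have : (18 * k + 3) * 2 ≤ (18 * k + 3) * c := by
        apply mul_le_mul_of_nonneg_left <;> omega
      omega
    have hc2 : -2 < c := by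
      by_contra h'
      have : (18 * k + 3) * c ≤ (18 * k + 3) * (-2) := by
        apply mul_le_mul_of_nonneg_left <;> omega
      omega
    have : c = -1 ∨ c = 0 ∨ c = 1 := by omega
    rcases this with rfl | rfl | rfl <;> simp (disch := omega) only [if_pos, if_neg] <;> norm_num
  · rw [if_neg h, if_neg, if_neg, if_neg]
    · norm_num
    · intro h'; apply h; exact ⟨1, by omega⟩
    · intro h'; apply h; exact ⟨-1, by omega⟩
    · intro h'; apply h; exact ⟨0, by omega⟩

lemma tA_neg {k s x : ℤ} (hk : 0 ≤ k) (h : x < 0) : tA k s x = 0 := by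
  rw [tA, cA_neg k x hk h, ite_self]

lemma tA_big {k s x : ℤ} (h : s < x) : tA k s x = 0 := by
  rw [tA, if_neg (by omega)]

lemma core (k w : ℤ) (s : ℕ) (hk : 1 ≤ k) (hs : (s : ℤ) < 12 * k) (hw : 0 ≤ w)
    (hw' : w < 18 * k + 3) (f : ℕ → ℤ)
    (hf : ∀ j : ℕ, (18 * k + 3) ∣ f j - 2 * (w - j)) :
    ∑ j ∈ Finset.range (s + 1), cA k j * bZ k (f j) = tH k s w := by
  -- `2 (9k+2) = (18k+3) + 1`
  have hconv : ∀ (j : ℕ) (e x : ℤ), (18 * k + 3) ∣ e - 2 * (w - x) →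
      ib k (f j) e = ib k j x := by
    intro j e x he
    unfold ib
    congr 1
    apply propext
    have hco : IsCoprime (18 * k + 3) (2 : ℤ) := ⟨1, -(9 * k + 1), by ring⟩
    have h2 : (18 * k + 3) ∣ (f j - e) + 2 * (j - x) := by
      have := dvd_sub (hf j) he
      have e1 : (f j - e) + 2 * ((j : ℤ) - x) = f j - 2 * (w - j) - (e - 2 * (w - x)) := by ring
      rw [e1]
      exact this
    constructor
    · intro h
      have := dvd_sub h2 h
      rw [add_sub_cancel_left] at this
      exact hco.dvd_of_dvd_mul_left this
    · intro h
      have := dvd_sub h2 (h.mul_left 2)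
      rwa [add_sub_cancel_right] at this
  have hb : ∀ j : ℕ, bZ k (f j) = ib k j w + ib k j (w - 9 * k - 2) + ib k j (w - 1)
      - ib k j (w + 6 * k + 1) - ib k j (w - 3 * k - 1) - ib k j (w + 6 * k) := by
    intro j
    unfold bZ
    rw [hconv j 0 w ⟨0, by ring⟩, hconv j 1 (w - 9 * k - 2) ⟨-1, by ring⟩,
      hconv j 2 (w - 1) ⟨0, by ring⟩, hconv j (6 * k + 1) (w + 6 * k + 1) ⟨1, by ring⟩,
      hconv j (6 * k + 2) (w - 3 * k - 1) ⟨0, by ring⟩,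
      hconv j (6 * k + 3) (w + 6 * k) ⟨1, by ring⟩]
  simp only [hb, mul_add, mul_sub, Finset.sum_add_distrib, Finset.sum_sub_distrib]
  have S := fun x h1 h2 => sum_ib k s x s (by omega) rfl hs h1 h2
  rw [S w (by omega) (by omega), S (w - 9 * k - 2) (by omega) (by omega),
    S (w - 1) (by omega) (by omega), S (w + 6 * k + 1) (by omega) (by omega),
    S (w - 3 * k - 1) (by omega) (by omega), S (w + 6 * k) (by omega) (by omega)]
  unfold tH
  rw [tA_neg (x := w - (18 * k + 3)) (by omega) (by omega),
    tA_big (x := w + (18 * k + 3)) (by omega),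
    tA_neg (x := w - 9 * k - 2 - (18 * k + 3)) (by omega) (by omega),
    tA_neg (x := w - 1 - (18 * k + 3)) (by omega) (by omega),
    tA_big (x := w - 1 + (18 * k + 3)) (by omega),
    tA_big (x := w + 6 * k + 1 + (18 * k + 3)) (by omega),
    tA_neg (x := w - 3 * k - 1 - (18 * k + 3)) (by omega) (by omega),
    tA_big (x := w - 3 * k - 1 + (18 * k + 3)) (by omega),
    tA_big (x := w + 6 * k + (18 * k + 3)) (by omega),
    show w - 9 * k - 2 + (18 * k + 3) = w + 9 * k + 1 by ring,
    show w + 6 * k + 1 - (18 * k + 3) = w - 12 * k - 2 by ring,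
    show w + 6 * k - (18 * k + 3) = w - 12 * k - 3 by ring]
  ring
lemma sum_range_blocks (f : ℕ → ℤ) (m q : ℕ) :
    ∑ i ∈ Finset.range (q * m), f i
      = ∑ s ∈ Finset.range m, ∑ u ∈ Finset.range q, f (q * s + u) := by
  induction m with
  | zero => simp
  | succ m ih => rw [Nat.mul_succ, Finset.sum_range_add, ih, Finset.sum_range_succ]

lemma hw_eq (k q : ℕ) (hk : 1 ≤ k) (hp : (6 * k + 1).Prime) (hq : q.Prime)
    (hgt : 18 * k + 3 < q) :
    (hw (cyclotomic (3 * (6 * k + 1) * q) ℤ) : ℤ)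
      = ∑ s ∈ Finset.range (12 * k), ∑ u ∈ Finset.range q,
        (if (cyclotomic (3 * (6 * k + 1) * q) ℤ).coeff (q * s + u) ≠ 0 then (1 : ℤ) else 0) := by
  rw [← sum_range_blocks (fun i =>
    (if (cyclotomic (3 * (6 * k + 1) * q) ℤ).coeff i ≠ 0 then (1 : ℤ) else 0))]
  rw [← Finset.sum_filter, Finset.sum_const, nsmul_eq_mul, mul_one, hw]
  congr 2
  ext i
  rw [mem_support_iff, Finset.mem_filter, Finset.mem_range]
  refine ⟨fun h => ⟨?_, h⟩, fun h => h.2⟩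
  have h1 := le_natDegree_of_ne_zero h
  have c1 : Nat.Coprime 3 (6 * k + 1) := by
    rw [Nat.coprime_primes Nat.prime_three hp]; omega
  have c2 : Nat.Coprime (3 * (6 * k + 1)) q := by
    apply Nat.Coprime.mul_left
    · rw [Nat.coprime_primes Nat.prime_three hq]; omega
    · rw [Nat.coprime_primes hp hq]; omega
  rw [natDegree_cyclotomic, Nat.totient_mul c2, Nat.totient_mul c1, Nat.totient_prime hp,
    Nat.totient_prime hq, Nat.totient_prime Nat.prime_three] at h1
  obtain ⟨r, rfl⟩ : ∃ r, q = r + 1 := ⟨q - 1, by omega⟩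
  simp only [Nat.add_sub_cancel] at h1
  have : (3 - 1) * (6 * k) * r = 12 * k * r := by ring
  have h3 : (r + 1) * (12 * k) = 12 * k * r + 12 * k := by ring
  omega

lemma emod_of (x y d : ℤ) (h0 : 0 ≤ y) (h1 : y < d) (h : d ∣ x - y) : x % d = y := by
  have : x % d = y % d := (Int.modEq_iff_dvd.2 h).symm
  rw [this, Int.emod_eq_of_lt h0 h1]

lemma sum_shift (d : ℕ) (hd : 0 < d) (α h h' : ℤ) (hh : (d : ℤ) ∣ h * h' - 1) (g : ℤ → ℤ) :
    ∑ u ∈ Finset.range d, g ((α + u * h) % d) = ∑ w ∈ Finset.range d, g w := by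
  have hd' : (0 : ℤ) < d := by omega
  have nn : ∀ x : ℤ, 0 ≤ x % d := fun x => Int.emod_nonneg _ (by omega)
  have lt : ∀ x : ℤ, x % d < d := fun x => Int.emod_lt_of_pos _ hd'
  have md : ∀ x : ℤ, (d : ℤ) ∣ x - x % d := fun x => Int.dvd_self_sub_emod
  apply Finset.sum_nbij' (fun u : ℕ => ((α + u * h) % d).toNat)
    (fun w : ℕ => (((w - α) * h') % d).toNat)
  · intro u _
    have := nn (α + u * h); have := lt (α + u * h)
    simp only [Finset.mem_range]; omega
  · intro w _
    have := nn ((w - α) * h'); have := lt ((w - α) * h')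
    simp only [Finset.mem_range]; omega
  · intro u hu
    have := Finset.mem_range.1 hu
    rw [Int.toNat_of_nonneg (nn _), emod_of _ u d (by omega) (by omega)]
    · simp
    · obtain ⟨a, ha⟩ := hh
      obtain ⟨b, hb⟩ := md (α + u * h)
      refine ⟨u * a - b * h', ?_⟩
      linear_combination (u : ℤ) * ha - h' * hb
  · intro w hw
    have := Finset.mem_range.1 hw
    rw [Int.toNat_of_nonneg (nn _), emod_of _ w d (by omega) (by omega)]
    · simp
    · obtain ⟨a, ha⟩ := hh
      obtain ⟨b, hb⟩ := md ((w - α) * h')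
      refine ⟨(w - α) * a - b * h, ?_⟩
      linear_combination ((w : ℤ) - α) * ha - h * hb
  · intro u _
    rw [Int.toNat_of_nonneg (nn _)]

lemma sum_shift_mul (d K : ℕ) (hd : 0 < d) (α h h' : ℤ) (hh : (d : ℤ) ∣ h * h' - 1)
    (g : ℤ → ℤ) :
    ∑ u ∈ Finset.range (d * K), g ((α + u * h) % d) = K * ∑ w ∈ Finset.range d, g w := by
  rw [sum_range_blocks (fun u => g ((α + u * h) % d))]
  have : ∀ s ∈ Finset.range K, ∑ u ∈ Finset.range d, g ((α + ((d * s + u : ℕ) : ℤ) * h) % d)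
      = ∑ w ∈ Finset.range d, g w := by
    intro s _
    rw [← sum_shift d hd α h h' hh g]
    apply Finset.sum_congr rfl
    intro u _
    congr 1
    rw [show α + ((d * s + u : ℕ) : ℤ) * h = α + u * h + d * (s * h) by push_cast; ring,
      Int.add_mul_emod_self_left]
  rw [Finset.sum_congr rfl this, Finset.sum_const, Finset.card_range, nsmul_eq_mul]

lemma case_plus (k K q : ℕ) (hk : 1 ≤ k) (hp : (6 * k + 1).Prime) (hq : q.Prime)
    (hgt : 18 * k + 3 < q) (hqK : q = (18 * k + 3) * K + 2) :
    (hw (cyclotomic (3 * (6 * k + 1) * q) ℤ) : ℤ) = K * (84 * k ^ 2 + 28 * k) + (8 * k + 1) := by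
  rw [hw_eq k q hk hp hq hgt]
  have hco : ∀ s ∈ Finset.range (12 * k), ∑ u ∈ Finset.range q,
        (if (cyclotomic (3 * (6 * k + 1) * q) ℤ).coeff (q * s + u) ≠ 0 then (1 : ℤ) else 0)
      = K * (∑ w ∈ Finset.range (18 * k + 3), nz k s w) + nz k s s
        + nz k s (if (s : ℤ) ≤ 9 * k then (s : ℤ) + 9 * k + 2 else (s : ℤ) - 9 * k - 1) := by
    intro s hs
    have hs := Finset.mem_range.1 hs
    have step : ∀ u ∈ Finset.range q,
        (if (cyclotomic (3 * (6 * k + 1) * q) ℤ).coeff (q * s + u) ≠ 0 then (1 : ℤ) else 0)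
        = nz k s (((s : ℤ) + u * (9 * k + 2)) % ((18 * k + 3 : ℕ) : ℤ)) := by
      intro u hu
      rw [cyc_coeff k q hk hp hq hgt s u (Finset.mem_range.1 hu), nz]
      rw [core k (((s : ℤ) + u * (9 * k + 2)) % ((18 * k + 3 : ℕ) : ℤ)) s (by omega) (by omega)
        (Int.emod_nonneg _ (by omega))
        (by have := Int.emod_lt_of_pos ((s : ℤ) + u * (9 * k + 2))
              (b := ((18 * k + 3 : ℕ) : ℤ)) (by omega)
            push_cast at this ⊢; exact this)]
      intro j
      obtain ⟨b, hb⟩ := Int.dvd_self_sub_emod (x := (s : ℤ) + u * (9 * k + 2))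
        (m := ((18 * k + 3 : ℕ) : ℤ))
      refine ⟨K * (s - j) - u + 2 * b, ?_⟩
      have hq' : (q : ℤ) = (18 * k + 3) * K + 2 := by rw [hqK]; push_cast; ring
      have e : ((18 * k + 3 : ℕ) : ℤ) = 18 * k + 3 := by push_cast; ring
      rw [e] at hb ⊢
      linear_combination ((s : ℤ) - j) * hq' + 2 * hb
    rw [Finset.sum_congr rfl step, hqK, Finset.sum_range_succ, Finset.sum_range_succ,
      sum_shift_mul (18 * k + 3) K (by omega) s (9 * k + 2) 2 ⟨1, by push_cast; ring⟩
        (fun w => nz k s w)]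
    congr 1
    · congr 1
      congr 1
      apply emod_of
      · omega
      · omega
      · exact ⟨K * (9 * k + 2), by push_cast; ring⟩
    · congr 1
      split_ifs with h
      · apply emod_of
        · omega
        · push_cast; omega
        · exact ⟨K * (9 * k + 2), by push_cast; ring⟩
      · apply emod_of
        · omega
        · push_cast; omega
        · exact ⟨K * (9 * k + 2) + 1, by push_cast; ring⟩
  rw [Finset.sum_congr rfl hco, Finset.sum_add_distrib, Finset.sum_add_distrib,
    ← Finset.mul_sum, total, diag1 k hk, diag2 k hk]
  ring

lemma case_minus (k K q : ℕ) (hk : 1 ≤ k) (hp : (6 * k + 1).Prime) (hq : q.Prime)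
    (hgt : 18 * k + 3 < q) (hqK : q + 2 = (18 * k + 3) * K) :
    (hw (cyclotomic (3 * (6 * k + 1) * q) ℤ) : ℤ) = K * (84 * k ^ 2 + 28 * k) - (8 * k + 1) := by
  rw [hw_eq k q hk hp hq hgt]
  have hq' : (q : ℤ) = (18 * k + 3) * K - 2 := by
    have : ((q + 2 : ℕ) : ℤ) = (((18 * k + 3) * K : ℕ) : ℤ) := by rw [hqK]
    push_cast at this
    linarith
  have hco : ∀ s ∈ Finset.range (12 * k), ∑ u ∈ Finset.range q,
        (if (cyclotomic (3 * (6 * k + 1) * q) ℤ).coeff (q * s + u) ≠ 0 then (1 : ℤ) else 0)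
      = K * (∑ w ∈ Finset.range (18 * k + 3), nz k s w)
        - nz k s (if (s : ℤ) ≤ 6 * k - 2 then (s : ℤ) + 12 * k + 4 else (s : ℤ) - 6 * k + 1)
        - nz k s ((s : ℤ) + 3 * k + 2) := by
    intro s hs
    have hs := Finset.mem_range.1 hs
    have step : ∀ u ∈ Finset.range q,
        (if (cyclotomic (3 * (6 * k + 1) * q) ℤ).coeff (q * s + u) ≠ 0 then (1 : ℤ) else 0)
        = nz k s (((s : ℤ) + (6 * k + 3) * (9 * k + 2) + u * (-(9 * k + 2)))
            % ((18 * k + 3 : ℕ) : ℤ)) := by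
      intro u hu
      rw [cyc_coeff k q hk hp hq hgt s u (Finset.mem_range.1 hu), nz]
      set X : ℤ := (s : ℤ) + (6 * k + 3) * (9 * k + 2) + u * (-(9 * k + 2)) with hX
      have neg : ∑ j ∈ Finset.range (s + 1), cA k j * bZ k (q * (s - j) + u)
          = - ∑ j ∈ Finset.range (s + 1), cA k j * bZ k (6 * k + 3 - (q * (s - j) + u)) := by
        rw [← Finset.sum_neg_distrib]
        apply Finset.sum_congr rfl
        intro j _
        rw [bZ_symm]
        ring
      rw [neg, core k (X % ((18 * k + 3 : ℕ) : ℤ)) s (by omega) (by omega)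
        (Int.emod_nonneg _ (by omega))
        (by have := Int.emod_lt_of_pos X (b := ((18 * k + 3 : ℕ) : ℤ)) (by omega)
            push_cast at this ⊢; exact this)
        (fun j => 6 * k + 3 - (q * (s - j) + u))]
      · simp only [ne_eq, neg_eq_zero]
      intro j
      obtain ⟨b, hb⟩ := Int.dvd_self_sub_emod (x := X) (m := ((18 * k + 3 : ℕ) : ℤ))
      refine ⟨-(K * (s - j)) - (6 * k + 3) + u + 2 * b, ?_⟩
      have e : ((18 * k + 3 : ℕ) : ℤ) = 18 * k + 3 := by push_cast; ring
      rw [e] at hb ⊢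
      linear_combination (-((s : ℤ) - j)) * hq' + 2 * hb - 2 * hX
    have full := sum_shift_mul (18 * k + 3) K (by omega)
      ((s : ℤ) + (6 * k + 3) * (9 * k + 2)) (-(9 * k + 2)) (-2) ⟨1, by push_cast; ring⟩
        (fun w => nz k s w)
    rw [← hqK, Finset.sum_range_succ, Finset.sum_range_succ] at full
    rw [Finset.sum_congr rfl step, ← full]
    have e1 : ((s : ℤ) + (6 * k + 3) * (9 * k + 2) + (q : ℤ) * (-(9 * k + 2)))
        % ((18 * k + 3 : ℕ) : ℤ)
        = if (s : ℤ) ≤ 6 * k - 2 then (s : ℤ) + 12 * k + 4 else (s : ℤ) - 6 * k + 1 := by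
      rw [hq']
      split_ifs with h
      · apply emod_of
        · omega
        · push_cast; omega
        · exact ⟨(3 * k + 2) - K * (9 * k + 2), by push_cast; ring⟩
      · apply emod_of
        · omega
        · push_cast; omega
        · exact ⟨(3 * k + 3) - K * (9 * k + 2), by push_cast; ring⟩
    have e2 : ((s : ℤ) + (6 * k + 3) * (9 * k + 2) + ((q + 1 : ℕ) : ℤ) * (-(9 * k + 2)))
        % ((18 * k + 3 : ℕ) : ℤ) = (s : ℤ) + 3 * k + 2 := by
      rw [Nat.cast_add, hq']
      apply emod_of
      · omega
      · push_cast; omega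
      · exact ⟨(3 * k + 2) - K * (9 * k + 2), by push_cast; ring⟩
    rw [e1, e2]
    ring
  rw [Finset.sum_congr rfl hco, Finset.sum_sub_distrib, Finset.sum_sub_distrib,
    ← Finset.mul_sum, total, diag3 k hk, diag4 k hk]
  ring

theorem stmt0 (p₂ p₃ : ℕ) (hp₂ : p₂.Prime) (hp₃ : p₃.Prime)
    (h3 : 3 < p₂) (h23 : p₂ < p₃) (hmod : p₂ % 3 = 1) (hgt : 3 * p₂ < p₃) :
    (p₃ % (3 * p₂) = 2 →
      9 * (p₂ : ℤ) * hw (cyclotomic (3 * p₂ * p₃) ℤ)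
        = 7 * ((p₂ : ℤ) ^ 2 - 1) * ((p₃ : ℤ) - 2) + 3 * (p₂ : ℤ) * (4 * (p₂ : ℤ) - 1)) ∧
    (p₃ % (3 * p₂) = 3 * p₂ - 2 →
      9 * (p₂ : ℤ) * hw (cyclotomic (3 * p₂ * p₃) ℤ)
        = 7 * ((p₂ : ℤ) ^ 2 - 1) * ((p₃ : ℤ) + 2) - 3 * (p₂ : ℤ) * (4 * (p₂ : ℤ) - 1)) := by
  have hodd : p₂ % 2 = 1 := by
    rcases hp₂.eq_two_or_odd with h | h <;> omega
  obtain ⟨k, rfl⟩ : ∃ k, p₂ = 6 * k + 1 := ⟨p₂ / 6, by omega⟩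
  have hk : 1 ≤ k := by omega
  have hdm := Nat.div_add_mod p₃ (3 * (6 * k + 1))
  have hd : 3 * (6 * k + 1) = 18 * k + 3 := by ring
  constructor
  · intro hr
    rw [hr, hd] at hdm
    rw [case_plus k (p₃ / (18 * k + 3)) p₃ hk hp₂ hp₃ (by omega) hdm.symm]
    generalize p₃ / (18 * k + 3) = K at *
    rw [← hdm]
    push_cast
    ring
  · intro hr
    rw [hr, hd] at hdm
    have hdm2 : p₃ + 2 = (18 * k + 3) * (p₃ / (18 * k + 3) + 1) := by
      rw [Nat.mul_add, mul_one]; omega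
    rw [case_minus k (p₃ / (18 * k + 3) + 1) p₃ hk hp₂ hp₃ (by omega) hdm2]
    generalize p₃ / (18 * k + 3) + 1 = K at *
    have : (p₃ : ℤ) + 2 = (18 * k + 3) * K := by exact_mod_cast hdm2
    rw [this]
    push_cast
    ring
end

section
/- Let p₂ and p₃ be primes with 3 < p₂ < p₃, p₂ ≡ 2 (mod 3) and p₃ > 3p₂. If p₃ ≡ 2 (mod 3p₂), then 9·p₂·hw(Φ_{3p₂p₃}) = (p₂ + 1)(7p₂ − 2)(p₃ − 2) + 3p₂(4p₂ + 1); and if p₃ ≡ 3p₂ − 2 (mod 3p₂), then 9·p₂·hw(Φ_{3p₂p₃}) = (p₂ + 1)(7p₂ − 2)(p₃ + 2) − 3p₂(4p₂ + 1). Equivalently, hw(Φ_{3p₂p₃}) = N(p₃ − 2) + (4p₂ + 1)/3 in the first case and N(p₃ + 2) − (4p₂ + 1)/3 in the second, where N = (p₂ + 1)(7p₂ − 2)/(9p₂). -/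
open Polynomial

lemma cyc_reverse (N : ℕ) (hN : 2 ≤ N) : (cyclotomic N ℤ).reverse = cyclotomic N ℤ := by
  have h0 : N ≠ 0 := by omega
  obtain ⟨ζ, hζ⟩ : ∃ ζ : ℂ, IsPrimitiveRoot ζ N := ⟨_, Complex.isPrimitiveRoot_exp N h0⟩
  have hz0 : ζ ≠ 0 := hζ.ne_zero h0
  let _ : Invertible ζ := invertibleOfNonzero hz0
  have hdvd : cyclotomic N ℤ ∣ (cyclotomic N ℤ).reverse := by
    have hinv : IsPrimitiveRoot ζ⁻¹ N := hζ.inv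
    rw [cyclotomic_eq_minpoly hinv (by omega)]
    apply minpoly.isIntegrallyClosed_dvd (hinv.isIntegral (by omega))
    rw [← cyclotomic_eq_minpoly hinv (by omega), aeval_def, ← invOf_eq_inv ζ,
      eval₂_reverse_eq_zero_iff, ← aeval_def, cyclotomic_eq_minpoly hζ (by omega)]
    exact minpoly.aeval ℤ ζ
  have hc0 : (cyclotomic N ℤ).coeff 0 = 1 := cyclotomic_coeff_zero ℤ (by omega)
  have hm : (cyclotomic N ℤ).reverse.Monic := by
    rw [Monic, reverse_leadingCoeff, trailingCoeff, natTrailingDegree_eq_zero.2, hc0]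
    right; rw [hc0]; exact one_ne_zero
  exact (eq_of_monic_of_dvd_of_natDegree_le (cyclotomic.monic N ℤ) hm hdvd (reverse_natDegree_le _))


lemma cyc_pal (N : ℕ) (hN : 2 ≤ N) (k : ℕ) (hk : k ≤ Nat.totient N) :
    (cyclotomic N ℤ).coeff (Nat.totient N - k) = (cyclotomic N ℤ).coeff k := by
  conv_rhs => rw [← cyc_reverse N hN]
  rw [coeff_reverse, natDegree_cyclotomic, revAt_le hk]

/-- product formula for the ternary inclusion-exclusion -/
lemma cyc_id1 (p : ℕ) (hp : p.Prime) (h3 : 3 < p) :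
    cyclotomic (3 * p) ℤ * (1 + X + X ^ 2) = 1 + X ^ p + X ^ (2 * p) := by
  have := cyclotomic_expand_eq_cyclotomic_mul hp (n := 3)
    (fun h => by have := Nat.le_of_dvd (by norm_num) h; omega) ℤ
  rw [cyclotomic_three] at this
  simp only [map_add, map_one, expand_X, map_pow, ← pow_mul] at this
  rw [show (1 + X + X ^ 2 : ℤ[X]) = X ^ 2 + X + 1 by ring, ← this]
  ring

lemma cyc_id2 (p q : ℕ) (hp : p.Prime) (hq : q.Prime) (h3 : 3 < p) (hpq : 3 * p < q) :
    cyclotomic (3 * p * q) ℤ * (1 - X ^ (3 * p)) =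
      expand ℤ q (cyclotomic (3 * p) ℤ) * ((1 + X + X ^ 2) * (1 - X ^ p)) := by
  have := cyclotomic_expand_eq_cyclotomic_mul hq (n := 3 * p)
    (fun h => by have := Nat.le_of_dvd (by omega) h; omega) ℤ
  rw [this]
  have h1 := cyc_id1 p hp h3
  have : (1 - X ^ (3 * p) : ℤ[X]) = (1 + X ^ p + X ^ (2 * p)) * (1 - X ^ p) := by ring
  rw [this, ← h1]; ring

/-- coefficients of `Φ_{3p}` below `p` -/
lemma cyc_small (p : ℕ) (hp : p.Prime) (h3 : 3 < p) (s : ℕ) :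
    (3 * s < p → (cyclotomic (3 * p) ℤ).coeff (3 * s) = 1) ∧
    (3 * s + 1 < p → (cyclotomic (3 * p) ℤ).coeff (3 * s + 1) = -1) ∧
    (3 * s + 2 < p → (cyclotomic (3 * p) ℤ).coeff (3 * s + 2) = 0) := by
  have h1 := cyc_id1 p hp h3
  set A := cyclotomic (3 * p) ℤ
  have hA : A * (1 + X + X ^ 2) = A + A * X + A * X ^ 2 := by ring
  rw [hA] at h1
  have hk : ∀ k, k + 2 < p → A.coeff (k + 2) + A.coeff (k + 1) + A.coeff k = 0 := by
    intro k hk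
    have := congrArg (fun f => f.coeff (k + 2)) h1
    simp only [coeff_add, coeff_mul_X_pow, coeff_X_pow, coeff_one] at this
    rw [show k + 2 = (k + 1) + 1 by rfl, coeff_mul_X] at this
    simp only [show k + 1 + 1 ≠ 0 by omega, show k + 1 + 1 ≠ p by omega,
      show k + 1 + 1 ≠ 2 * p by omega, if_false] at this
    simpa using this
  have h00 : A.coeff 0 = 1 := cyclotomic_coeff_zero ℤ (by omega)
  have h01 : A.coeff 1 = -1 := by
    have := congrArg (fun f => f.coeff 1) h1
    simp only [coeff_add, coeff_mul_X_pow', coeff_X_pow, coeff_one] at this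
    rw [show 1 = 0 + 1 by rfl, coeff_mul_X] at this
    simp only [show 0 + 1 ≠ p by omega,
      show 0 + 1 ≠ 2 * p by omega, if_false, h00] at this
    norm_num at this
    linarith
  induction s with
  | zero =>
    refine ⟨fun _ => h00, fun _ => h01, fun h => ?_⟩
    have := hk 0 h
    simp only [zero_add, h00, h01] at this
    simpa using this
  | succ s ih =>
    have e0 : 3 * (s + 1) < p → A.coeff (3 * (s + 1)) = 1 := by
      intro h
      have := hk (3 * s + 1) (by omega)
      rw [show 3 * s + 1 + 2 = 3 * (s + 1) by ring, show 3 * s + 1 + 1 = 3 * s + 2 by ring,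
        ih.2.1 (by omega), ih.2.2 (by omega)] at this
      linarith
    have e1 : 3 * (s + 1) + 1 < p → A.coeff (3 * (s + 1) + 1) = -1 := by
      intro h
      have := hk (3 * s + 2) (by omega)
      rw [show 3 * s + 2 + 2 = 3 * (s + 1) + 1 by ring, show 3 * s + 2 + 1 = 3 * (s + 1) by ring,
        ih.2.2 (by omega), e0 (by omega)] at this
      linarith
    refine ⟨e0, e1, fun h => ?_⟩
    have := hk (3 * (s + 1)) (by omega)
    rw [e0 (by omega), e1 (by omega)] at this
    linarith

/-- the periodic function -/
def ff (p : ℕ) (z : ℤ) : ℤ :=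
  (if z % (3 * p) < 3 then 1 else 0) - (if p ≤ z % (3 * p) ∧ z % (3 * p) < p + 3 then 1 else 0)

lemma ff_series (p : ℕ) (h3 : 3 < p) :
    (PowerSeries.mk fun k : ℕ => ff p k) * (1 - PowerSeries.X ^ (3 * p)) =
      ((((1 + X + X ^ 2) * (1 - X ^ p) : ℤ[X])) : PowerSeries ℤ) := by
  ext k
  rw [mul_sub, mul_one, map_sub, PowerSeries.coeff_mul_X_pow', PowerSeries.coeff_mk,
    Polynomial.coeff_coe]
  have : ((1 + X + X ^ 2) * (1 - X ^ p) : ℤ[X]) =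
    X ^ 0 + X ^ 1 + X ^ 2 - X ^ p - X ^ (p + 1) - X ^ (p + 2) := by ring
  rw [this]
  simp only [coeff_sub, coeff_add, coeff_X_pow]
  by_cases hk : 3 * p ≤ k
  · rw [if_pos hk, PowerSeries.coeff_mk]
    have : ff p (k - 3 * p : ℕ) = ff p k := by
      unfold ff
      have : ((k - 3 * p : ℕ) : ℤ) % (3 * p) = (k : ℤ) % (3 * p) := by
        push_cast [Nat.cast_sub hk]
        exact Int.sub_emod_right _ _
      rw [this]
    rw [this, sub_self]
    simp only [show k ≠ 0 by omega, show k ≠ 1 by omega, show k ≠ 2 by omega, show k ≠ p by omega,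
      show k ≠ p + 1 by omega, show k ≠ p + 2 by omega, if_false]
    norm_num
  · rw [if_neg hk]
    unfold ff
    have : (k : ℤ) % (3 * p) = k := Int.emod_eq_of_lt (by omega) (by omega)
    rw [this]
    split_ifs <;> omega

lemma coeff_formula (p q : ℕ) (hp : p.Prime) (hq : q.Prime) (h3 : 3 < p) (hpq : 3 * p < q)
    (u v : ℕ) (hv : v < q) :
    (cyclotomic (3 * p * q) ℤ).coeff (q * u + v) =
      ∑ j ∈ Finset.range (u + 1), (cyclotomic (3 * p) ℤ).coeff j *
        ff p ((v : ℤ) + q * ((u : ℤ) - j)) := by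
  have h1 := cyc_id2 p q hp hq h3 hpq
  set A := cyclotomic (3 * p * q) ℤ
  set B := cyclotomic (3 * p) ℤ
  have h2 : (A : PowerSeries ℤ) = (expand ℤ q B : PowerSeries ℤ) *
      (PowerSeries.mk fun k : ℕ => ff p k) := by
    have h := congrArg (fun f : ℤ[X] => (f : PowerSeries ℤ)) h1
    simp only [Polynomial.coe_mul (φ := A), Polynomial.coe_mul (φ := expand ℤ q B)] at h
    rw [← ff_series p h3, ← mul_assoc] at h
    have hx : ((1 - X ^ (3 * p) : ℤ[X]) : PowerSeries ℤ) = 1 - PowerSeries.X ^ (3 * p) := by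
      simp
    rw [hx] at h
    refine mul_right_cancel₀ ?_ h
    intro h0
    have := congrArg (PowerSeries.coeff 0) h0
    simp [show p ≠ 0 by omega] at this
  rw [← Polynomial.coeff_coe, h2]
  have hB : expand ℤ q B = ∑ j ∈ Finset.range (B.natDegree + u + 1), C (B.coeff j) * X ^ (q * j) := by
    conv_lhs => rw [B.as_sum_range_C_mul_X_pow' (n := B.natDegree + u + 1) (by omega)]
    simp [map_sum, ← pow_mul]
  rw [hB]
  have hc : ((∑ j ∈ Finset.range (B.natDegree + u + 1), C (B.coeff j) * X ^ (q * j) : ℤ[X]) :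
      PowerSeries ℤ) = ∑ j ∈ Finset.range (B.natDegree + u + 1),
        PowerSeries.C (B.coeff j) * PowerSeries.X ^ (q * j) := by
    rw [← Polynomial.coeToPowerSeries.ringHom_apply, map_sum]
    apply Finset.sum_congr rfl
    intro j _
    simp only [Polynomial.coeToPowerSeries.ringHom_apply, Polynomial.coe_mul, Polynomial.coe_C,
      Polynomial.coe_pow, Polynomial.coe_X]
  rw [hc, Finset.sum_mul, map_sum]
  symm
  have hsub : Finset.range (u + 1) ⊆ Finset.range (B.natDegree + u + 1) := by
    intro x; simp; omega
  have hterm : ∀ j, PowerSeries.coeff (q * u + v) (PowerSeries.C (B.coeff j) *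
      PowerSeries.X ^ (q * j) * (PowerSeries.mk fun k : ℕ => ff p k)) =
      B.coeff j * (if q * j ≤ q * u + v then ff p ((q * u + v - q * j : ℕ) : ℤ) else 0) := by
    intro j
    rw [mul_assoc, PowerSeries.coeff_C_mul, PowerSeries.coeff_X_pow_mul']
    simp
  simp only [hterm]
  rw [← Finset.sum_subset hsub]
  · apply Finset.sum_congr rfl
    intro j hj
    have hj : j ≤ u := by simp at hj; omega
    have : q * j ≤ q * u := Nat.mul_le_mul_left _ hj
    rw [if_pos (by omega), Nat.cast_sub (by omega)]
    congr 2; push_cast; ring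
  · intro j _ hj
    have hj : u + 1 ≤ j := by simp at hj; omega
    have : q * (u + 1) ≤ q * j := Nat.mul_le_mul_left _ hj
    rw [if_neg (by nlinarith), mul_zero]

/-- sign `(-1)^i * b` -/
def sg (i : ℕ) (b : ℤ) : ℤ := if i % 2 = 0 then b else -b

/-- indicator -/
def iv (P : Prop) [Decidable P] : ℤ := if P then 1 else 0

/-- the basic four-term pattern -/
def tm (n i w : ℕ) : ℤ :=
  iv (w = 3 * i) + iv (w = 3 * i + 1) - iv (w = 3 * i + 6 * n + 5) - iv (w = 3 * i + 6 * n + 6)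

/-- alternating sum of the pattern -/
def XX (n L w : ℕ) : ℤ := ∑ i ∈ Finset.range L, sg i (tm n i w)

lemma XX_closed (n L w : ℕ) : XX n L w = sg (w / 3)
    (if w % 3 = 0 then iv (w / 3 < L) - iv (2 * n + 2 ≤ w / 3 ∧ w / 3 < L + 2 * n + 2)
     else if w % 3 = 1 then iv (w / 3 < L)
     else iv (2 * n + 1 ≤ w / 3 ∧ w / 3 < L + 2 * n + 1)) := by
  induction L with
  | zero =>
    unfold XX sg iv
    simp only [Finset.range_zero, Finset.sum_empty]
    split_ifs <;> omega
  | succ L ih =>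
    have : XX n (L + 1) w = XX n L w + sg L (tm n L w) := Finset.sum_range_succ _ _
    rw [this, ih]
    clear this ih
    obtain ⟨i, r, hr, rfl⟩ : ∃ i r, r < 3 ∧ w = 3 * i + r :=
      ⟨w / 3, w % 3, Nat.mod_lt _ (by norm_num), by omega⟩
    have e1 : (3 * i + r) / 3 = i := by omega
    have e2 : (3 * i + r) % 3 = r := by omega
    rw [e1, e2]
    unfold sg tm iv
    interval_cases r
    · simp only [if_true, show ¬ (3 * i + 0 = 3 * L + 1) by omega, if_false,
        show ¬ (3 * i + 0 = 3 * L + 6 * n + 5) by omega]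
      split_ifs <;> omega
    · simp only [if_true, show ¬ (3 * i + 1 = 3 * L) by omega, if_false, one_ne_zero,
        show ¬ (3 * i + 1 = 3 * L + 6 * n + 5) by omega,
        show ¬ (3 * i + 1 = 3 * L + 6 * n + 6) by omega]
      split_ifs <;> omega
    · simp only [show ¬ (3 * i + 2 = 3 * L) by omega, if_false, show ¬ (2 = 0) by norm_num,
        show ¬ (2 = 1) by norm_num,
        show ¬ (3 * i + 2 = 3 * L + 1) by omega,
        show ¬ (3 * i + 2 = 3 * L + 6 * n + 6) by omega]
      split_ifs <;> omega

lemma ff_val (p : ℕ) (z : ℤ) (h1 : -(2 * p) + 3 ≤ z) (h2 : z < 3 * p) :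
    ff p z = iv (0 ≤ z ∧ z < 3) - iv (p ≤ z ∧ z < p + 3) := by
  unfold ff iv
  by_cases hz : 0 ≤ z
  · rw [Int.emod_eq_of_lt hz h2]
    simp [hz]
  · have : z % (3 * p) = z + 3 * p := by
      rw [← Int.add_emod_right, Int.emod_eq_of_lt (by omega) (by omega)]
    rw [this]
    split_ifs <;> omega

/-- the basic correlation sum -/
noncomputable def EE (p u : ℕ) (z : ℤ) : ℤ :=
  ∑ j ∈ Finset.range (u + 1), (cyclotomic (3 * p) ℤ).coeff j * ff p (z - 2 * j)

lemma EE_succ (p u : ℕ) (z : ℤ) : EE p (u + 1) z =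
    EE p u z + (cyclotomic (3 * p) ℤ).coeff (u + 1) * ff p (z - 2 * (u + 1 : ℕ)) :=
  Finset.sum_range_succ _ _

lemma XX_succ (n L w : ℕ) : XX n (L + 1) w = XX n L w + sg L (tm n L w) :=
  Finset.sum_range_succ _ _

set_option maxHeartbeats 4000000 in
lemma EE_closed (n p : ℕ) (hn : p = 6 * n + 5) (hp : p.Prime) (w : ℕ) (hw : w < 3 * p) (s : ℕ) :
    (3 * s + 2 ≤ p → EE p (3 * s) w =
      XX n (2 * s + 1) w + iv (w = 6 * s + 2) - iv (w = 6 * s + 2 + p)) ∧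
    (3 * s + 3 ≤ p → EE p (3 * s + 1) w = XX n (2 * s + 2) w) ∧
    (3 * s + 4 ≤ p → EE p (3 * s + 2) w = XX n (2 * s + 2) w) := by
  have h3 : 3 < p := by omega
  have aux : ∀ s, (3 * s + 2 ≤ p → EE p (3 * s) w =
      XX n (2 * s + 1) w + iv (w = 6 * s + 2) - iv (w = 6 * s + 2 + p)) → 
      (3 * s + 3 ≤ p → EE p (3 * s + 1) w = XX n (2 * s + 2) w) ∧
      (3 * s + 4 ≤ p → EE p (3 * s + 2) w = XX n (2 * s + 2) w) := by
    intro s h0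
    have hb : (3 * s + 3 ≤ p → EE p (3 * s + 1) w = XX n (2 * s + 2) w) := by
      intro h
      rw [EE_succ, h0 (by omega), (cyc_small p hp h3 s).2.1 (by omega), XX_succ n (2 * s + 1),
        ff_val p _ (by push_cast; omega) (by push_cast; omega)]
      unfold sg tm iv
      rw [if_neg (show ¬ (2 * s + 1) % 2 = 0 by omega)]
      push_cast
      split_ifs <;> omega
    refine ⟨hb, fun h => ?_⟩
    rw [EE_succ, hb (by omega), (cyc_small p hp h3 s).2.2 (by omega)]
    ring
  induction s with
  | zero =>
    refine ⟨?_, aux 0 ?_⟩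
    all_goals
      intro _
      unfold EE XX
      simp only [mul_zero, zero_add, Finset.sum_range_one]
      have := (cyc_small p hp h3 0).1 (by omega)
      rw [mul_zero] at this
      rw [this, ff_val p _ (by push_cast; omega) (by push_cast; omega)]
      unfold sg tm iv
      split_ifs <;> omega
  | succ s ih =>
    have : 3 * (s + 1) + 2 ≤ p → EE p (3 * (s + 1)) w =
        XX n (2 * (s + 1) + 1) w + iv (w = 6 * (s + 1) + 2) - iv (w = 6 * (s + 1) + 2 + p) := by
      intro h
      have c := (cyc_small p hp h3 (s + 1)).1 (by omega)
      rw [show 3 * (s + 1) = 3 * s + 2 + 1 by ring] at c ⊢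
      rw [EE_succ, ih.2.2 (by omega), c, show 2 * (s + 1) + 1 = 2 * s + 2 + 1 by ring, XX_succ n (2 * s + 2),
        ff_val p _ (by push_cast; omega) (by push_cast; omega)]
      unfold sg tm iv
      rw [if_pos (show (2 * s + 2) % 2 = 0 by omega)]
      push_cast
      split_ifs <;> omega
    exact ⟨this, aux _ this⟩

/-- nonvanishing pattern, `r = 0` -/
def NA (n L w : ℕ) : Prop :=
  (w % 3 = 0 ∧ (w / 3 < min L (2 * n + 2) ∨ (max L (2 * n + 2) ≤ w / 3 ∧ w / 3 < L + 2 * n + 2))) ∨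
  (w % 3 = 1 ∧ w / 3 < L) ∨
  (w % 3 = 2 ∧ 2 * n + 1 ≤ w / 3 ∧ w / 3 < L + 2 * n + 1)

lemma XX_ne (n L w : ℕ) : XX n L w ≠ 0 ↔ NA n L w := by
  rw [XX_closed]
  unfold NA sg iv
  split_ifs <;> omega

lemma XY_ne (n s w : ℕ) : XX n (2 * s + 1) w + iv (w = 6 * s + 2) -
    iv (w = 6 * s + 2 + (6 * n + 5)) ≠ 0 ↔
    (NA n (2 * s + 1) w ∨ w = 6 * s + 2 ∨ w = 6 * s + 2 + (6 * n + 5)) := by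
  rw [XX_closed]
  unfold NA sg iv
  split_ifs <;> omega

instance NA_dec (n L w : ℕ) : Decidable (NA n L w) := by unfold NA; infer_instance

/-- nonvanishing pattern -/
def NZ (n u w : ℕ) : Prop :=
  NA n (2 * (u / 3) + (if u % 3 = 0 then 1 else 2)) w ∨
    (u % 3 = 0 ∧ (w = 2 * u + 2 ∨ w = 2 * u + 2 + (6 * n + 5)))

instance NZ_dec (n u w : ℕ) : Decidable (NZ n u w) := by unfold NZ; infer_instance

lemma NZ0 (n s w : ℕ) : NZ n (3 * s) w ↔
    (NA n (2 * s + 1) w ∨ w = 6 * s + 2 ∨ w = 6 * s + 2 + (6 * n + 5)) := by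
  unfold NZ
  rw [show 3 * s / 3 = s by omega, if_pos (by omega), show 2 * (3 * s) = 6 * s by ring]
  simp

lemma NZ1 (n s w : ℕ) : NZ n (3 * s + 1) w ↔ NA n (2 * s + 2) w := by
  unfold NZ
  rw [show (3 * s + 1) / 3 = s by omega, if_neg (by omega)]
  simp

lemma NZ2 (n s w : ℕ) : NZ n (3 * s + 2) w ↔ NA n (2 * s + 2) w := by
  unfold NZ
  rw [show (3 * s + 2) / 3 = s by omega, if_neg (by omega)]
  simp

lemma iv_congr {P Q : Prop} [Decidable P] [Decidable Q] (h : P ↔ Q) : iv P = iv Q := by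
  unfold iv; simp [h]

lemma EE_ne (n p : ℕ) (hn : p = 6 * n + 5) (hp : p.Prime) (w : ℕ) (hw : w < 3 * p) (u : ℕ)
    (hu : u + 2 ≤ p) : EE p u w ≠ 0 ↔ NZ n u w := by
  have h := EE_closed n p hn hp w hw (u / 3)
  obtain ⟨s, r, hr, rfl⟩ : ∃ s r, r < 3 ∧ u = 3 * s + r :=
    ⟨u / 3, u % 3, Nat.mod_lt _ (by norm_num), by omega⟩
  rw [show (3 * s + r) / 3 = s by omega] at h
  interval_cases r
  · rw [add_zero, NZ0, h.1 (by omega), hn, XY_ne]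
  · rw [NZ1, h.2.1 (by omega), XX_ne]
  · rw [NZ2, h.2.2 (by omega), XX_ne]

lemma ff_mod (p : ℕ) (z z' : ℤ) (h : (3 * p : ℤ) ∣ z - z') : ff p z = ff p z' := by
  unfold ff
  have : z % (3 * p) = z' % (3 * p) := 
    Int.emod_eq_emod_iff_emod_sub_eq_zero.2 (Int.emod_eq_zero_of_dvd h)
  rw [this]

lemma ff_anti (p : ℕ) (hp : 3 < p) (z : ℤ) : ff p (p + 2 - z) = - ff p z := by
  have h0 := Int.emod_nonneg z (show (3 * p : ℤ) ≠ 0 by omega)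
  have h1 := Int.emod_lt_of_pos z (show (0 : ℤ) < 3 * p by omega)
  have h2 := Int.emod_add_mul_ediv z (3 * p)
  rw [ff_mod p z (z % (3 * p)) ⟨z / (3 * p), by linarith⟩,
    ff_mod p (p + 2 - z) (p + 2 - z % (3 * p)) ⟨- (z / (3 * p)), by linarith⟩]
  generalize z % (3 * p) = y at h0 h1
  rw [ff_val p _ (by omega) (by omega), ff_val p _ (by omega) (by omega)]
  unfold iv
  split_ifs <;> omega

lemma EE_mod (p u : ℕ) (z z' : ℤ) (h : (3 * p : ℤ) ∣ z - z') : EE p u z = EE p u z' := by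
  unfold EE
  apply Finset.sum_congr rfl
  intro j _
  rw [ff_mod p (z - 2 * j) (z' - 2 * j) (by simpa using h)]

lemma coeff_case1 (n p q t : ℕ) (hn : p = 6 * n + 5) (hp : p.Prime) (hq : q.Prime)
    (hpq : 3 * p < q) (ht : q = 3 * p * t + 2) (u v : ℕ) (hu : u + 2 ≤ p) (hv : v < q) :
    (cyclotomic (3 * p * q) ℤ).coeff (q * u + v) ≠ 0 ↔ NZ n u ((2 * u + v) % (3 * p)) := by
  rw [coeff_formula p q hp hq (by omega) hpq u v hv,
    ← EE_ne n p hn hp _ (Nat.mod_lt _ (by omega)) u hu]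
  apply not_congr
  have : EE p u ((2 * u + v) % (3 * p) : ℕ) = EE p u (2 * u + v) := by
    apply EE_mod
    push_cast
    exact Int.dvd_emod_sub_self
  rw [this]
  unfold EE
  have : ∀ j, ff p ((v : ℤ) + q * ((u : ℤ) - j)) = ff p (2 * u + v - 2 * j) := by
    intro j
    apply ff_mod
    exact ⟨t * (u - j), by rw [ht]; push_cast; ring⟩
  simp only [this]

lemma coeff_case2 (n p q t : ℕ) (hn : p = 6 * n + 5) (hp : p.Prime) (hq : q.Prime)
    (hpq : 3 * p < q) (ht : q + 2 = 3 * p * t) (u v : ℕ) (hu : u + 2 ≤ p) (hv : v < q) :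
    (cyclotomic (3 * p * q) ℤ).coeff (q * u + (q - 1 - v)) ≠ 0 ↔
      NZ n u ((2 * u + p + 5 + v) % (3 * p)) := by
  rw [coeff_formula p q hp hq (by omega) hpq u _ (by omega),
    ← EE_ne n p hn hp _ (Nat.mod_lt _ (by omega)) u hu]
  apply not_congr
  have : EE p u ((2 * u + p + 5 + v) % (3 * p) : ℕ) = EE p u (2 * u + p + 5 + v) := by
    apply EE_mod
    push_cast
    exact Int.dvd_emod_sub_self
  rw [this]
  unfold EE
  have ht' : (q : ℤ) = 3 * p * t - 2 := by
    have : (q : ℤ) + 2 = 3 * p * t := by exact_mod_cast ht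
    linarith
  have : ∀ j, ff p (((q - 1 - v : ℕ) : ℤ) + q * ((u : ℤ) - j)) =
      - ff p (2 * u + p + 5 + v - 2 * j) := by
    intro j
    rw [← ff_anti p (by omega)]
    apply ff_mod
    rw [Nat.cast_sub (by omega), Nat.cast_sub (by omega)]
    exact ⟨t * (u - j) + t, by rw [ht']; push_cast; ring⟩
  simp only [this, mul_neg, Finset.sum_neg_distrib, neg_eq_zero]

lemma sum3 (G : ℕ → ℤ) (M : ℕ) : ∑ w ∈ Finset.range (3 * M), G w =
    ∑ i ∈ Finset.range M, (G (3 * i) + G (3 * i + 1) + G (3 * i + 2)) := by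
  induction M with
  | zero => simp
  | succ M ih =>
    rw [show 3 * (M + 1) = 3 * M + 1 + 1 + 1 by ring]
    simp only [Finset.sum_range_succ, ih]
    ring

lemma intv (M a b : ℕ) (hab : a ≤ b) (hb : b ≤ M) :
    ∑ i ∈ Finset.range M, iv (a ≤ i ∧ i < b) = (b : ℤ) - a := by
  unfold iv
  rw [Finset.sum_boole]
  have : (Finset.range M).filter (fun i => a ≤ i ∧ i < b) = Finset.Ico a b := by
    ext x; simp; omega
  rw [this, Nat.card_Ico, Nat.cast_sub hab]

lemma sum_lin (K : ℕ) (a b : ℤ) :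
    2 * ∑ s ∈ Finset.range K, (a * s + b) = a * K * (K - 1) + 2 * b * K := by
  induction K with
  | zero => simp
  | succ K ih =>
    rw [Finset.sum_range_succ, mul_add, ih]
    push_cast; ring

/-- block count for residue `1, 2` -/
lemma cntA (n L : ℕ) (hL : L ≤ 4 * n + 3) :
    ∑ w ∈ Finset.range (3 * (6 * n + 5)), iv (NA n L w) =
      2 * L + 2 * ((min L (2 * n + 2) : ℕ) : ℤ) := by
  rw [sum3]
  have h : ∀ i, iv (NA n L (3 * i)) + iv (NA n L (3 * i + 1)) + iv (NA n L (3 * i + 2)) =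
      iv (0 ≤ i ∧ i < min L (2 * n + 2)) + iv (max L (2 * n + 2) ≤ i ∧ i < L + 2 * n + 2) +
      iv (0 ≤ i ∧ i < L) + iv (2 * n + 1 ≤ i ∧ i < L + 2 * n + 1) := by
    intro i
    have a0 : iv (NA n L (3 * i)) =
        iv (0 ≤ i ∧ i < min L (2 * n + 2)) + iv (max L (2 * n + 2) ≤ i ∧ i < L + 2 * n + 2) := by
      unfold NA iv; split_ifs <;> omega
    have a1 : iv (NA n L (3 * i + 1)) = iv (0 ≤ i ∧ i < L) := by
      unfold NA iv; split_ifs <;> omega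
    have a2 : iv (NA n L (3 * i + 2)) = iv (2 * n + 1 ≤ i ∧ i < L + 2 * n + 1) := by
      unfold NA iv; split_ifs <;> omega
    rw [a0, a1, a2]
  simp only [h, Finset.sum_add_distrib]
  rw [intv _ _ _ (by omega) (by omega), intv _ _ _ (by omega) (by omega),
    intv _ _ _ (by omega) (by omega), intv _ _ _ (by omega) (by omega)]
  push_cast
  rcases le_total (L : ℤ) (2 * n + 2) with h | h
  · rw [max_eq_right h, min_eq_left h]; ring
  · rw [max_eq_left h, min_eq_right h]; ring

/-- block count for residue `0` -/
lemma cntB (n s : ℕ) (hL : s ≤ 2 * n + 1) :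
    ∑ w ∈ Finset.range (3 * (6 * n + 5)), iv (NZ n (3 * s) w) =
      2 * (2 * s + 1) + 2 * ((min (2 * s + 1) (2 * n + 2) : ℕ) : ℤ) + 1 + iv (s ≤ n) := by
  have h : ∀ w, iv (NZ n (3 * s) w) = iv (NA n (2 * s + 1) w) +
      iv (6 * s + 2 + (6 * n + 5) ≤ w ∧ w < 6 * s + 2 + (6 * n + 5) + 1) +
      iv (6 * s + 2 ≤ w ∧ w < 6 * s + 2 + (if s ≤ n then 1 else 0)) := by
    intro w
    rw [iv_congr (NZ0 n s w)]
    unfold NA iv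
    by_cases hs : s ≤ n
    · simp only [hs, if_true]
      split_ifs <;> omega
    · simp only [hs, if_false]
      split_ifs <;> omega
  simp only [h, Finset.sum_add_distrib]
  rw [cntA n (2 * s + 1) (by omega), intv _ _ _ (by omega) (by omega),
    intv _ _ _ (by omega) (by split_ifs <;> omega)]
  unfold iv
  split_ifs <;> (push_cast; ring)

lemma sum_u (G : ℕ → ℤ) (n : ℕ) : ∑ u ∈ Finset.range (6 * n + 4), G u =
    ∑ s ∈ Finset.range (2 * n + 1), (G (3 * s) + G (3 * s + 1) + G (3 * s + 2)) +
      G (3 * (2 * n + 1)) := by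
  rw [show 6 * n + 4 = 3 * (2 * n + 1) + 1 by ring, Finset.sum_range_succ, sum3]

lemma total_N (n : ℕ) : ∑ u ∈ Finset.range (6 * n + 4),
    ∑ w ∈ Finset.range (3 * (6 * n + 5)), iv (NZ n u w) = (n + 1) * (42 * n + 33) := by
  rw [sum_u, cntB n _ le_rfl]
  simp only [iv_congr (NZ1 n _ _), iv_congr (NZ2 n _ _)]
  have h1 : ∀ s ∈ Finset.range (2 * n + 1),
      (∑ w ∈ Finset.range (3 * (6 * n + 5)), iv (NZ n (3 * s) w) +
      ∑ w ∈ Finset.range (3 * (6 * n + 5)), iv (NA n (2 * s + 2) w)) +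
      ∑ w ∈ Finset.range (3 * (6 * n + 5)), iv (NA n (2 * s + 2) w) =
      if s ≤ n then 24 * (s : ℤ) + 22 else 12 * s + 12 * n + 23 := by
    intro s hs
    rw [Finset.mem_range] at hs
    rw [cntB n s (by omega), cntA n _ (by omega)]
    unfold iv
    split_ifs with h
    · rw [min_eq_left (by omega), min_eq_left (by omega)]; push_cast; ring
    · rw [min_eq_right (by omega), min_eq_right (by omega)]; push_cast; ring
  rw [Finset.sum_congr rfl h1, show 2 * n + 1 = (n + 1) + n by ring, Finset.sum_range_add]
  have h2 : ∑ s ∈ Finset.range (n + 1), (if s ≤ n then 24 * (s : ℤ) + 22 else 12 * s + 12 * n + 23) =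
      ∑ s ∈ Finset.range (n + 1), (24 * (s : ℤ) + 22) := by
    apply Finset.sum_congr rfl
    intro s hs
    rw [Finset.mem_range] at hs
    rw [if_pos (by omega)]
  have h3 : ∑ s ∈ Finset.range n, (if n + 1 + s ≤ n then 24 * ((n + 1 + s : ℕ) : ℤ) + 22
      else 12 * ((n + 1 + s : ℕ) : ℤ) + 12 * n + 23) =
      ∑ s ∈ Finset.range n, (12 * (s : ℤ) + (24 * n + 35)) := by
    apply Finset.sum_congr rfl
    intro s hs
    rw [if_neg (by omega)]
    push_cast; ring
  rw [h2, h3]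
  have e1 := sum_lin (n + 1) 24 22
  have e2 := sum_lin n 12 (24 * n + 35)
  rw [min_eq_right (by omega)]
  have e3 : iv (n + 1 + n ≤ n) = 0 := by unfold iv; rw [if_neg (by omega)]
  rw [e3]
  push_cast at *
  linarith

lemma NZ_last (n w : ℕ) : NZ n (6 * n + 3) w ↔
    (NA n (4 * n + 3) w ∨ w = 12 * n + 8 ∨ w = 18 * n + 13) := by
  rw [show 6 * n + 3 = 3 * (2 * n + 1) by ring, NZ0,
    show 2 * (2 * n + 1) + 1 = 4 * n + 3 by ring, show 6 * (2 * n + 1) + 2 = 12 * n + 8 by ring,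
    show 12 * n + 8 + (6 * n + 5) = 18 * n + 13 by ring]

lemma total_C1 (n : ℕ) : ∑ u ∈ Finset.range (6 * n + 4),
    (iv (NZ n u (2 * u)) + iv (NZ n u (2 * u + 1))) = 8 * n + 6 := by
  rw [sum_u]
  have h1 : ∀ s ∈ Finset.range (2 * n + 1),
      (iv (NZ n (3 * s) (2 * (3 * s))) + iv (NZ n (3 * s) (2 * (3 * s) + 1))) +
      (iv (NZ n (3 * s + 1) (2 * (3 * s + 1))) + iv (NZ n (3 * s + 1) (2 * (3 * s + 1) + 1))) +
      (iv (NZ n (3 * s + 2) (2 * (3 * s + 2))) + iv (NZ n (3 * s + 2) (2 * (3 * s + 2) + 1))) =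
      4 + iv (n ≤ s ∧ s < n + 1) := by
    intro s hs
    rw [Finset.mem_range] at hs
    have a0 : iv (NZ n (3 * s) (2 * (3 * s))) = iv (s ≤ n) := by
      apply iv_congr; rw [NZ0]; unfold NA; omega
    have a1 : iv (NZ n (3 * s) (2 * (3 * s) + 1)) = iv (0 ≤ s) := by
      apply iv_congr; rw [NZ0]; unfold NA; omega
    have a2 : iv (NZ n (3 * s + 1) (2 * (3 * s + 1))) = iv (n + 1 ≤ s) := by
      apply iv_congr; rw [NZ1]; unfold NA; omega
    have a3 : iv (NZ n (3 * s + 1) (2 * (3 * s + 1) + 1)) = iv (s ≤ n) := by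
      apply iv_congr; rw [NZ1]; unfold NA; omega
    have a4 : iv (NZ n (3 * s + 2) (2 * (3 * s + 2))) = iv (0 ≤ s) := by
      apply iv_congr; rw [NZ2]; unfold NA; omega
    have a5 : iv (NZ n (3 * s + 2) (2 * (3 * s + 2) + 1)) = iv (n ≤ s) := by
      apply iv_congr; rw [NZ2]; unfold NA; omega
    rw [a0, a1, a2, a3, a4, a5]
    unfold iv
    split_ifs <;> omega
  rw [Finset.sum_congr rfl h1, Finset.sum_add_distrib, intv _ _ _ (by omega) (by omega)]
  have a0 : iv (NZ n (3 * (2 * n + 1)) (2 * (3 * (2 * n + 1)))) = 0 := by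
    unfold iv; rw [if_neg]; rw [NZ0]; unfold NA; omega
  have a1 : iv (NZ n (3 * (2 * n + 1)) (2 * (3 * (2 * n + 1)) + 1)) = 1 := by
    unfold iv; rw [if_pos]; rw [NZ0]; unfold NA; omega
  rw [a0, a1, Finset.sum_const, Finset.card_range]
  push_cast; ring

lemma total_C2 (n : ℕ) : ∑ u ∈ Finset.range (6 * n + 4),
    (iv (NZ n u ((2 * u + 6 * n + 8) % (3 * (6 * n + 5)))) +
      iv (NZ n u ((2 * u + 6 * n + 9) % (3 * (6 * n + 5))))) = 1 := by
  rw [sum_u]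
  have h1 : ∀ u, u < 6 * n + 3 →
      iv (NZ n u ((2 * u + 6 * n + 8) % (3 * (6 * n + 5)))) = 0 ∧
      iv (NZ n u ((2 * u + 6 * n + 9) % (3 * (6 * n + 5)))) = 0 := by
    intro u hu
    rw [Nat.mod_eq_of_lt (by omega), Nat.mod_eq_of_lt (by omega)]
    obtain ⟨s, r, hr, rfl⟩ : ∃ s r, r < 3 ∧ u = 3 * s + r :=
      ⟨u / 3, u % 3, Nat.mod_lt _ (by norm_num), by omega⟩
    unfold iv
    interval_cases r
    · rw [if_neg, if_neg]
      · exact ⟨rfl, rfl⟩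
      · rw [add_zero, NZ0]; unfold NA; omega
      · rw [add_zero, NZ0]; unfold NA; omega
    · rw [if_neg, if_neg]
      · exact ⟨rfl, rfl⟩
      · rw [NZ1]; unfold NA; omega
      · rw [NZ1]; unfold NA; omega
    · rw [if_neg, if_neg]
      · exact ⟨rfl, rfl⟩
      · rw [NZ2]; unfold NA; omega
      · rw [NZ2]; unfold NA; omega
  rw [Finset.sum_eq_zero]
  · have e1 : (2 * (3 * (2 * n + 1)) + 6 * n + 8) % (3 * (6 * n + 5)) = 18 * n + 14 := by
      rw [Nat.mod_eq_of_lt (by omega)]; ring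
    have e2 : (2 * (3 * (2 * n + 1)) + 6 * n + 9) % (3 * (6 * n + 5)) = 0 := by
      rw [show 2 * (3 * (2 * n + 1)) + 6 * n + 9 = 3 * (6 * n + 5) by ring, Nat.mod_self]
    rw [e1, e2]
    unfold iv
    rw [if_neg, if_pos]
    · norm_num
    · rw [NZ0]; unfold NA; omega
    · rw [NZ0]; unfold NA; omega
  · intro s hs
    rw [Finset.mem_range] at hs
    rw [(h1 (3 * s) (by omega)).1, (h1 (3 * s) (by omega)).2, (h1 (3 * s + 1) (by omega)).1,
      (h1 (3 * s + 1) (by omega)).2, (h1 (3 * s + 2) (by omega)).1, (h1 (3 * s + 2) (by omega)).2]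
    norm_num

lemma total_W (n : ℕ) : ∑ k ∈ Finset.range (12 * n + 7), iv (NZ n (6 * n + 3) (1 + k)) =
    8 * n + 5 := by
  rw [show 12 * n + 7 = 3 * (4 * n + 2) + 1 by ring, Finset.sum_range_succ, sum3]
  have h1 : ∀ i ∈ Finset.range (4 * n + 2),
      iv (NZ n (6 * n + 3) (1 + 3 * i)) + iv (NZ n (6 * n + 3) (1 + (3 * i + 1))) +
      iv (NZ n (6 * n + 3) (1 + (3 * i + 2))) = 2 := by
    intro i hi
    rw [Finset.mem_range] at hi
    have a0 : iv (NZ n (6 * n + 3) (1 + 3 * i)) = iv (0 ≤ i) := by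
      apply iv_congr; rw [NZ_last]; unfold NA; omega
    have a1 : iv (NZ n (6 * n + 3) (1 + (3 * i + 1))) = iv (2 * n + 1 ≤ i) := by
      apply iv_congr; rw [NZ_last]; unfold NA; omega
    have a2 : iv (NZ n (6 * n + 3) (1 + (3 * i + 2))) = iv (i < 2 * n + 1) := by
      apply iv_congr; rw [NZ_last]; unfold NA; omega
    rw [a0, a1, a2]
    unfold iv
    split_ifs <;> omega
  rw [Finset.sum_congr rfl h1]
  have a0 : iv (NZ n (6 * n + 3) (1 + 3 * (4 * n + 2))) = 1 := by
    unfold iv; rw [if_pos]; rw [NZ_last]; unfold NA; omega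
  rw [a0, Finset.sum_const, Finset.card_range]
  push_cast; ring

lemma period_one (G : ℕ → ℤ) (m c : ℕ) :
    ∑ v ∈ Finset.range m, G ((c + v) % m) = ∑ w ∈ Finset.range m, G w := by
  induction c with
  | zero =>
    apply Finset.sum_congr rfl
    intro v hv
    rw [Finset.mem_range] at hv
    rw [zero_add, Nat.mod_eq_of_lt hv]
  | succ c ih =>
    rw [← ih]
    have h1 := Finset.sum_range_succ (fun v => G ((c + v) % m)) m
    have h2 := Finset.sum_range_succ' (fun v => G ((c + v) % m)) m
    simp only [Nat.add_mod_right, add_zero] at h1 h2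
    have : ∀ v, c + 1 + v = c + (v + 1) := by intro v; ring
    simp only [this]
    linarith

lemma period_many (G : ℕ → ℤ) (m c t : ℕ) :
    ∑ v ∈ Finset.range (m * t), G ((c + v) % m) = t * ∑ w ∈ Finset.range m, G w := by
  induction t with
  | zero => simp
  | succ t ih =>
    rw [Nat.mul_succ, Finset.sum_range_add, ih]
    have : ∀ v, c + (m * t + v) = (c + v) + m * t := by intro v; ring
    simp only [this, Nat.add_mul_mod_self_left]
    rw [period_one]
    push_cast; ring

lemma sum_grid (b : ℕ → ℤ) (q U : ℕ) : ∑ k ∈ Finset.range (q * U), b k =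
    ∑ u ∈ Finset.range U, ∑ v ∈ Finset.range q, b (q * u + v) := by
  induction U with
  | zero => simp
  | succ U ih => rw [Nat.mul_succ, Finset.sum_range_add, ih, Finset.sum_range_succ]

lemma hw_sum (f : ℤ[X]) (N : ℕ) (h : f.natDegree < N) :
    (hw f : ℤ) = ∑ k ∈ Finset.range N, iv (f.coeff k ≠ 0) := by
  unfold hw iv
  rw [Finset.sum_boole]
  congr 2
  ext k
  simp only [mem_support_iff, Finset.mem_filter, Finset.mem_range]
  constructor
  · intro hk
    exact ⟨lt_of_le_of_lt (le_natDegree_of_ne_zero hk) h, hk⟩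
  · exact fun hk => hk.2

lemma hw_fold (p q : ℕ) (hp : p.Prime) (hq : q.Prime) (h3 : 3 < p) (hpq : 3 * p < q) :
    (hw (cyclotomic (3 * p * q) ℤ) : ℤ) =
      2 * ∑ u ∈ Finset.range (p - 1), ∑ v ∈ Finset.range q,
        iv ((cyclotomic (3 * p * q) ℤ).coeff (q * u + v) ≠ 0) -
      ∑ k ∈ Finset.range (2 * p - 3),
        iv ((cyclotomic (3 * p * q) ℤ).coeff (q * (p - 2) + (q - (2 * p - 3) + k)) ≠ 0) := by
  have hN : 2 ≤ 3 * p * q := by nlinarith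
  have htot : Nat.totient (3 * p * q) = 2 * (p - 1) * (q - 1) := by
    have c1 : Nat.Coprime 3 p := (Nat.coprime_primes Nat.prime_three hp).2 (by omega)
    have c2 : Nat.Coprime (3 * p) q := Nat.Coprime.mul_left
      ((Nat.coprime_primes Nat.prime_three hq).2 (by omega))
      ((Nat.coprime_primes hp hq).2 (by omega))
    rw [Nat.totient_mul c2, Nat.totient_mul c1, Nat.totient_prime hp, Nat.totient_prime hq,
      Nat.totient_prime Nat.prime_three]
  have hpal := cyc_pal (3 * p * q) hN
  have hdeg := natDegree_cyclotomic (3 * p * q) ℤ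
  rw [htot] at hpal hdeg
  set A := cyclotomic (3 * p * q) ℤ
  obtain ⟨a, rfl⟩ : ∃ a, p = a + 2 := ⟨p - 2, by omega⟩
  obtain ⟨d, rfl⟩ : ∃ d, q = d + (2 * a + 1) := ⟨q - (2 * a + 1), by omega⟩
  set q := d + (2 * a + 1) with hqd
  have e1 : 2 * (a + 2) - 3 = 2 * a + 1 := by omega
  have e2 : a + 2 - 1 = a + 1 := by omega
  have e3 : a + 2 - 2 = a := by omega
  have e4 : q - (2 * a + 1) = d := by omega
  rw [e1, e2, e3, e4]
  rw [e2] at hpal hdeg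
  -- `K` is the number of coefficients in the upper half
  have hM : q * (a + 1) = (q * a + d) + (2 * a + 1) := by rw [hqd]; ring
  have hD : 2 * (a + 1) * (q - 1) + 1 = q * (a + 1) + (q * a + d) := by
    have : q - 1 = d + 2 * a := by omega
    rw [this, hqd]; ring
  rw [hw_sum A (q * (a + 1) + (q * a + d)) (by omega), Finset.sum_range_add]
  have hrefl : ∑ x ∈ Finset.range (q * a + d), iv (A.coeff (q * (a + 1) + x) ≠ 0) =
      ∑ x ∈ Finset.range (q * a + d), iv (A.coeff x ≠ 0) := by
    rw [← Finset.sum_range_reflect]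
    apply Finset.sum_congr rfl
    intro x hx
    rw [Finset.mem_range] at hx
    have : q * (a + 1) + (q * a + d - 1 - x) = 2 * (a + 1) * (q - 1) - x := by omega
    rw [this, hpal x (by omega)]
  rw [hrefl, ← sum_grid (fun k => iv (A.coeff k ≠ 0)) q (a + 1), hM,
    Finset.sum_range_add (fun k => iv (A.coeff k ≠ 0)) (q * a + d)]
  simp only [add_assoc]
  ring

lemma case1 (n p q t : ℕ) (hn : p = 6 * n + 5) (hp : p.Prime) (hq : q.Prime)
    (hpq : 3 * p < q) (ht : q = 3 * p * t + 2) :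
    (hw (cyclotomic (3 * p * q) ℤ) : ℤ) = 2 * (t * ((n + 1) * (42 * n + 33))) + (8 * n + 7) := by
  rw [hw_fold p q hp hq (by omega) hpq]
  have hA : ∀ u ∈ Finset.range (p - 1), ∑ v ∈ Finset.range q,
      iv ((cyclotomic (3 * p * q) ℤ).coeff (q * u + v) ≠ 0) =
      (iv (NZ n u (2 * u)) + iv (NZ n u (2 * u + 1))) +
        t * ∑ w ∈ Finset.range (3 * p), iv (NZ n u w) := by
    intro u hu
    rw [Finset.mem_range] at hu
    have : ∀ v ∈ Finset.range q, iv ((cyclotomic (3 * p * q) ℤ).coeff (q * u + v) ≠ 0) =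
        iv (NZ n u ((2 * u + v) % (3 * p))) := by
      intro v hv
      rw [Finset.mem_range] at hv
      exact iv_congr (coeff_case1 n p q t hn hp hq hpq ht u v (by omega) hv)
    rw [Finset.sum_congr rfl this, ht, Finset.sum_range_succ', Finset.sum_range_succ']
    rw [← period_many (fun w => iv (NZ n u w)) (3 * p) (2 * u + 2) t]
    have e : ∑ x ∈ Finset.range (3 * p * t), iv (NZ n u ((2 * u + (x + 1 + 1)) % (3 * p))) =
        ∑ x ∈ Finset.range (3 * p * t), iv (NZ n u ((2 * u + 2 + x) % (3 * p))) := by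
      apply Finset.sum_congr rfl
      intro x _
      rw [show 2 * u + (x + 1 + 1) = 2 * u + 2 + x by ring]
    rw [e, Nat.mod_eq_of_lt (a := 2 * u + (0 + 1)) (by omega),
      Nat.mod_eq_of_lt (a := 2 * u + 0) (by omega)]
    simp only [zero_add, add_zero]
    ring
  have hW : ∀ k ∈ Finset.range (2 * p - 3),
      iv ((cyclotomic (3 * p * q) ℤ).coeff (q * (p - 2) + (q - (2 * p - 3) + k)) ≠ 0) =
      iv (NZ n (6 * n + 3) (1 + k)) := by
    intro k hk
    rw [Finset.mem_range] at hk
    rw [iv_congr (coeff_case1 n p q t hn hp hq hpq ht (p - 2) (q - (2 * p - 3) + k) (by omega)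
      (by omega))]
    rw [show 2 * (p - 2) + (q - (2 * p - 3) + k) = (1 + k) + (3 * p) * t by omega,
      Nat.add_mul_mod_self_left, Nat.mod_eq_of_lt (by omega), show p - 2 = 6 * n + 3 by omega]
  rw [Finset.sum_congr rfl hA, Finset.sum_congr rfl hW, Finset.sum_add_distrib, ← Finset.mul_sum,
    show 2 * p - 3 = 12 * n + 7 by omega, show p - 1 = 6 * n + 4 by omega, hn, total_W, total_N,
    total_C1]
  ring

lemma case2 (n p q t : ℕ) (hn : p = 6 * n + 5) (hp : p.Prime) (hq : q.Prime)
    (hpq : 3 * p < q) (ht : q + 2 = 3 * p * t) :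
    (hw (cyclotomic (3 * p * q) ℤ) : ℤ) = 2 * (t * ((n + 1) * (42 * n + 33))) - (8 * n + 7) := by
  rw [hw_fold p q hp hq (by omega) hpq]
  have hA : ∀ u ∈ Finset.range (p - 1), ∑ v ∈ Finset.range q,
      iv ((cyclotomic (3 * p * q) ℤ).coeff (q * u + v) ≠ 0) =
      t * ∑ w ∈ Finset.range (3 * p), iv (NZ n u w) -
      (iv (NZ n u ((2 * u + 6 * n + 8) % (3 * (6 * n + 5)))) +
        iv (NZ n u ((2 * u + 6 * n + 9) % (3 * (6 * n + 5))))) := by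
    intro u hu
    rw [Finset.mem_range] at hu
    rw [← Finset.sum_range_reflect]
    have : ∀ v ∈ Finset.range q,
        iv ((cyclotomic (3 * p * q) ℤ).coeff (q * u + (q - 1 - v)) ≠ 0) =
        iv (NZ n u ((2 * u + p + 5 + v) % (3 * p))) := by
      intro v hv
      rw [Finset.mem_range] at hv
      exact iv_congr (coeff_case2 n p q t hn hp hq hpq ht u v (by omega) hv)
    rw [Finset.sum_congr rfl this]
    rw [← period_many (fun w => iv (NZ n u w)) (3 * p) (2 * u + p + 5) t, ← ht,
      Finset.sum_range_succ, Finset.sum_range_succ]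
    have e1 : (2 * u + p + 5 + q) % (3 * p) = (2 * u + 6 * n + 8) % (3 * (6 * n + 5)) := by
      rw [show 2 * u + p + 5 + q = (2 * u + 6 * n + 8) + 3 * p * t by omega,
        Nat.add_mul_mod_self_left, hn]
    have e2 : (2 * u + p + 5 + (q + 1)) % (3 * p) = (2 * u + 6 * n + 9) % (3 * (6 * n + 5)) := by
      rw [show 2 * u + p + 5 + (q + 1) = (2 * u + 6 * n + 9) + 3 * p * t by omega,
        Nat.add_mul_mod_self_left, hn]
    rw [e1, e2]
    ring
  have hW : ∀ k ∈ Finset.range (2 * p - 3),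
      iv ((cyclotomic (3 * p * q) ℤ).coeff
        (q * (p - 2) + (q - (2 * p - 3) + (2 * p - 3 - 1 - k))) ≠ 0) =
      iv (NZ n (6 * n + 3) (1 + k)) := by
    intro k hk
    rw [Finset.mem_range] at hk
    rw [show q - (2 * p - 3) + (2 * p - 3 - 1 - k) = q - 1 - k by omega,
      iv_congr (coeff_case2 n p q t hn hp hq hpq ht (p - 2) k (by omega) (by omega))]
    rw [show 2 * (p - 2) + p + 5 + k = (1 + k) + 3 * p by omega,
      Nat.add_mod_right, Nat.mod_eq_of_lt (by omega), show p - 2 = 6 * n + 3 by omega]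
  rw [Finset.sum_congr rfl hA, ← Finset.sum_range_reflect (n := 2 * p - 3),
    Finset.sum_congr rfl hW, Finset.sum_sub_distrib, ← Finset.mul_sum,
    show 2 * p - 3 = 12 * n + 7 by omega, show p - 1 = 6 * n + 4 by omega, hn, total_W, total_N,
    total_C2]
  ring

theorem stmt1 (p₂ p₃ : ℕ) (hp₂ : p₂.Prime) (hp₃ : p₃.Prime)
    (h3 : 3 < p₂) (h23 : p₂ < p₃) (hmod : p₂ % 3 = 2) (hgt : 3 * p₂ < p₃) :
    (p₃ % (3 * p₂) = 2 →
      9 * (p₂ : ℤ) * hw (cyclotomic (3 * p₂ * p₃) ℤ)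
        = ((p₂ : ℤ) + 1) * (7 * (p₂ : ℤ) - 2) * ((p₃ : ℤ) - 2) + 3 * (p₂ : ℤ) * (4 * (p₂ : ℤ) + 1)) ∧
    (p₃ % (3 * p₂) = 3 * p₂ - 2 →
      9 * (p₂ : ℤ) * hw (cyclotomic (3 * p₂ * p₃) ℤ)
        = ((p₂ : ℤ) + 1) * (7 * (p₂ : ℤ) - 2) * ((p₃ : ℤ) + 2) - 3 * (p₂ : ℤ) * (4 * (p₂ : ℤ) + 1)) := by
  have hodd : p₂ % 2 = 1 := (hp₂.eq_two_or_odd).resolve_left (by omega)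
  obtain ⟨n, hn⟩ : ∃ n, p₂ = 6 * n + 5 := ⟨p₂ / 6, by omega⟩
  have hdm := Nat.div_add_mod p₃ (3 * p₂)
  have hn' : (p₂ : ℤ) = 6 * n + 5 := by exact_mod_cast hn
  constructor
  · intro h
    rw [h] at hdm
    have hq : (p₃ : ℤ) = 3 * p₂ * (p₃ / (3 * p₂) : ℕ) + 2 := by exact_mod_cast hdm.symm
    rw [case1 n p₂ p₃ (p₃ / (3 * p₂)) hn hp₂ hp₃ hgt hdm.symm]
    generalize ((p₃ / (3 * p₂) : ℕ) : ℤ) = t at hq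
    rw [hq, hn']; ring
  · intro h
    rw [h] at hdm
    have ht : p₃ + 2 = 3 * p₂ * (p₃ / (3 * p₂) + 1) := by rw [Nat.mul_succ]; omega
    have hq : (p₃ : ℤ) = 3 * p₂ * (p₃ / (3 * p₂) + 1 : ℕ) - 2 := by
      have : (p₃ : ℤ) + 2 = 3 * p₂ * (p₃ / (3 * p₂) + 1 : ℕ) := by exact_mod_cast ht
      linarith
    rw [case2 n p₂ p₃ (p₃ / (3 * p₂) + 1) hn hp₂ hp₃ hgt ht]
    generalize ((p₃ / (3 * p₂) + 1 : ℕ) : ℤ) = t at hq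
    rw [hq, hn']; ring
end

section
/- Let m > 1 be an integer and p > m a prime, and write r = p mod m and q = ⌊p/m⌋. For all 0 ≤ i ≤ φ(m) − 1, 0 ≤ j ≤ q − 1 and 0 ≤ k < m, the coefficient of x^{ip + jm + k} in Φ_{mp} equals −Σ_{s=0}^{i} a_s · b_{(k + (i−s)r) mod m}, where a_s is the coefficient of x^s in Φ_m and b_t is the coefficient of x^t in Ψ_m. In particular, this coefficient is independent of j for 0 ≤ j ≤ q − 1. -/
open Polynomial

/-- The `m`-th inverse cyclotomic polynomial `Ψ_m = (x^m - 1)/Φ_m` over `ℤ`. -/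
noncomputable def invCyclotomic (m : ℕ) : Polynomial ℤ :=
  (X ^ m - 1) /ₘ cyclotomic m ℤ

theorem invCyclotomic_mul (m : ℕ) : cyclotomic m ℤ * invCyclotomic m = X ^ m - 1 := by
  unfold invCyclotomic
  obtain ⟨c, hc⟩ := cyclotomic.dvd_X_pow_sub_one m ℤ
  rw [hc, mul_divByMonic_cancel_left _ (cyclotomic.monic m ℤ)]

theorem invCyclotomic_coeff_of_le (m : ℕ) (hm : 1 < m) (n : ℕ) (hn : m ≤ n) :
    (invCyclotomic m).coeff n = 0 := by
  apply coeff_eq_zero_of_natDegree_lt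
  unfold invCyclotomic
  rw [natDegree_divByMonic _ (cyclotomic.monic m ℤ), natDegree_cyclotomic]
  have h1 : (X ^ m - 1 : ℤ[X]).natDegree = m := natDegree_X_pow_sub_C (r := (1 : ℤ))
  have := Nat.totient_pos.2 (show 0 < m by omega)
  omega

theorem periodic_series (m : ℕ) (hm : 1 < m) :
    (PowerSeries.mk fun n => (invCyclotomic m).coeff (n % m)) * (1 - PowerSeries.X ^ m)
      = ((invCyclotomic m : ℤ[X]) : PowerSeries ℤ) := by
  ext n
  rw [mul_sub, mul_one, map_sub, PowerSeries.coeff_mul_X_pow', PowerSeries.coeff_mk,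
    Polynomial.coeff_coe]
  split_ifs with h
  · rw [PowerSeries.coeff_mk, ← Nat.mod_eq_sub_mod h, invCyclotomic_coeff_of_le m hm n h, sub_self]
  · rw [Nat.mod_eq_of_lt (by omega), sub_zero]

theorem cyclotomic_series (m p : ℕ) (hm : 1 < m) (hp : p.Prime) (hpm : m < p) :
    ((cyclotomic (m * p) ℤ : ℤ[X]) : PowerSeries ℤ)
      = -(((expand ℤ p (cyclotomic m ℤ) : ℤ[X]) : PowerSeries ℤ) *
        PowerSeries.mk fun n => (invCyclotomic m).coeff (n % m)) := by
  have hnd : ¬ p ∣ m := Nat.not_dvd_of_pos_of_lt (by omega) hpm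
  have h1 := cyclotomic_expand_eq_cyclotomic_mul hp hnd ℤ
  have h2 := invCyclotomic_mul m
  have h3 : cyclotomic (m * p) ℤ * (X ^ m - 1)
      = expand ℤ p (cyclotomic m ℤ) * invCyclotomic m := by
    rw [h1, ← h2]; ring
  have h4 := congrArg (fun f : ℤ[X] => (f : PowerSeries ℤ)) h3
  simp only [Polynomial.coe_mul, Polynomial.coe_sub, Polynomial.coe_pow, Polynomial.coe_X,
    Polynomial.coe_one] at h4
  rw [← periodic_series m hm] at h4
  have hne : (1 - PowerSeries.X ^ m : PowerSeries ℤ) ≠ 0 := by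
    intro h
    have := congrArg (PowerSeries.coeff 0) h
    rw [map_sub, PowerSeries.coeff_X_pow, if_neg (by omega)] at this
    simp at this
  apply mul_right_cancel₀ hne
  linear_combination -h4

theorem stmt2 (m p : ℕ) (hm : 1 < m) (hp : p.Prime) (hpm : m < p)
    (i j k : ℕ) (hi : i ≤ Nat.totient m - 1) (hj : j ≤ p / m - 1) (hk : k < m) :
    (cyclotomic (m * p) ℤ).coeff (i * p + j * m + k)
      = -∑ s ∈ Finset.range (i + 1),
          (cyclotomic m ℤ).coeff s *
            (invCyclotomic m).coeff ((k + (i - s) * (p % m)) % m) := by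
  have hlt : j * m + k < p := by
    have h0 : 0 < p / m := Nat.div_pos hpm.le (by omega)
    have h1 : (j + 1) * m ≤ p / m * m := Nat.mul_le_mul_right _ (by omega)
    have h2 := Nat.div_mul_le_self p m
    rw [Nat.add_mul] at h1
    omega
  rw [← Polynomial.coeff_coe, cyclotomic_series m p hm hp hpm, map_neg, PowerSeries.coeff_mul,
    Finset.Nat.sum_antidiagonal_eq_sum_range_succ_mk, neg_inj]
  simp only [Polynomial.coeff_coe, PowerSeries.coeff_mk, coeff_expand hp.pos]
  symm
  apply Finset.sum_of_injOn (fun s => s * p)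
  · intro a _ b _ h
    exact Nat.eq_of_mul_eq_mul_right hp.pos h
  · intro s hs
    simp only [Finset.coe_range, Set.mem_Iio] at hs ⊢
    have := Nat.mul_le_mul_right p (show s ≤ i by omega)
    omega
  · intro t ht hnot
    rw [if_neg, zero_mul]
    rintro ⟨s, rfl⟩
    apply hnot
    refine ⟨s, ?_, mul_comm _ _⟩
    simp only [Finset.coe_range, Set.mem_Iio, Finset.mem_range] at ht ⊢
    by_contra hs
    have := Nat.mul_le_mul_right p (show i + 1 ≤ s by omega)
    rw [Nat.add_mul, mul_comm s p] at this
    omega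
  · intro s hs
    simp only [Finset.mem_range] at hs
    rw [if_pos (Dvd.intro_left _ rfl), Nat.mul_div_cancel _ hp.pos]
    congr 2
    obtain ⟨d, rfl⟩ := Nat.exists_eq_add_of_le (show s ≤ i by omega)
    have e : (s + d) * p + j * m + k - s * p = (k + d * p) + j * m := by
      rw [Nat.add_mul]; omega
    rw [e, Nat.add_mul_mod_self_right, Nat.add_sub_cancel_left]
    exact Nat.ModEq.add_left k (Nat.ModEq.mul_left d (Nat.mod_modEq p m))
end

section
/- (Repetition and Truncation) Let m > 1 be an integer and p > m a prime, and write r = p mod m and q = ⌊p/m⌋. Then for all 0 ≤ i ≤ φ(m) − 1: (1) for every 0 ≤ j ≤ q − 1 and 0 ≤ k < m, the coefficient of x^{ip + jm + k} in Φ_{mp} equals the coefficient of x^{ip + k} in Φ_{mp}; (2) for every 0 ≤ k < r, the coefficient of x^{ip + qm + k} in Φ_{mp} equals the coefficient of x^{ip + k} in Φ_{mp}. -/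
open Polynomial

lemma stmt3_step (m p : ℕ) (hm : 1 < m) (hp : p.Prime) (hpm : m < p) (i t : ℕ)
    (ht : t + m < p) :
    (cyclotomic (m * p) ℤ).coeff (i * p + t + m) = (cyclotomic (m * p) ℤ).coeff (i * p + t) := by
  obtain ⟨Y, hY⟩ := cyclotomic.dvd_X_pow_sub_one m ℤ
  have hdeg : Y.natDegree < m := by
    have h1 := congrArg natDegree hY
    have hY0 : Y ≠ 0 := by
      rintro rfl
      rw [mul_zero] at hY
      exact X_pow_sub_C_ne_zero (R := ℤ) (by omega : 0 < m) 1 (by simpa using hY)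
    rw [natDegree_mul (cyclotomic_ne_zero m ℤ) hY0, natDegree_cyclotomic,
      ← C_1, natDegree_X_pow_sub_C] at h1
    have := Nat.totient_pos.2 (by omega : 0 < m)
    omega
  have hE := cyclotomic_expand_eq_cyclotomic_mul hp
    (fun h => absurd (Nat.le_of_dvd (by omega) h) (by omega) : ¬ p ∣ m) ℤ
  have key : cyclotomic (m * p) ℤ * (X ^ m - 1) = expand ℤ p (cyclotomic m ℤ) * Y := by
    rw [hE, hY, mul_assoc]
  have h0 : (expand ℤ p (cyclotomic m ℤ) * Y).coeff (i * p + t + m) = 0 := by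
    rw [coeff_mul]
    refine Finset.sum_eq_zero ?_
    rintro ⟨a, b⟩ hab
    rw [Finset.HasAntidiagonal.mem_antidiagonal] at hab
    simp only at hab ⊢
    by_cases hb : b < m
    · rw [coeff_expand hp.pos, if_neg, zero_mul]
      rintro ⟨c, rfl⟩
      have h1 : i < c := by
        by_contra h
        have := Nat.mul_le_mul_left p (not_lt.1 h)
        rw [mul_comm p i] at this
        omega
      have h2 := Nat.mul_le_mul_left p h1
      have h3 : p * i.succ = i * p + p := by rw [Nat.succ_eq_add_one]; ring
      omega
    · rw [coeff_eq_zero_of_natDegree_lt (by omega : Y.natDegree < b), mul_zero]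
  rw [← key, mul_sub, mul_one, coeff_sub, coeff_mul_X_pow] at h0
  linarith

lemma stmt3_rep (m p : ℕ) (hm : 1 < m) (hp : p.Prime) (hpm : m < p) (i k j : ℕ)
    (h : j * m + k < p) :
    (cyclotomic (m * p) ℤ).coeff (i * p + j * m + k) = (cyclotomic (m * p) ℤ).coeff (i * p + k) := by
  induction j with
  | zero => simp
  | succ j ih =>
    rw [Nat.succ_mul] at h
    rw [← ih (by omega), add_assoc _ (j * m) k,
      ← stmt3_step m p hm hp hpm i (j * m + k) (by omega)]
    congr 1
    ring

theorem stmt3 (m p : ℕ) (hm : 1 < m) (hp : p.Prime) (hpm : m < p) (i : ℕ)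
    (hi : i ≤ Nat.totient m - 1) :
    (∀ j k : ℕ, j ≤ p / m - 1 → k < m →
      (cyclotomic (m * p) ℤ).coeff (i * p + j * m + k)
        = (cyclotomic (m * p) ℤ).coeff (i * p + k)) ∧
    (∀ k : ℕ, k < p % m →
      (cyclotomic (m * p) ℤ).coeff (i * p + (p / m) * m + k)
        = (cyclotomic (m * p) ℤ).coeff (i * p + k)) := by
  have hq : 0 < p / m := Nat.div_pos hpm.le (by omega)
  have hd := Nat.div_add_mod' p m
  refine ⟨fun j k hj hk => stmt3_rep m p hm hp hpm i k j ?_,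
    fun k hk => stmt3_rep m p hm hp hpm i k _ (by omega)⟩
  have := Nat.mul_le_mul_right m (by omega : j + 1 ≤ p / m)
  rw [Nat.succ_mul] at this
  omega
end

section
/- (Linear and parallel structure of the Hamming weight) Let m > 1 be an odd squarefree integer and let 0 < r < m with gcd(r, m) = 1. Then there exist integers S and T, depending only on m and r, such that: for every prime p > m with p ≡ r (mod m), hw(Φ_{mp}) = S·(p − r)/m + T; and for every prime p̃ > m with p̃ ≡ m − r (mod m), hw(Φ_{m p̃}) = S·(p̃ + r)/m − T. Equivalently, hw(Φ_{mp}) = A·p + B and hw(Φ_{m p̃}) = A·p̃ − B for the rational numbers A = S/m and B = T − Sr/m. -/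
open Polynomial

lemma cyc_palin (m : ℕ) (hm : 1 < m) (s : ℕ) (hs : s ≤ m.totient) :
    (cyclotomic m ℤ).coeff (m.totient - s) = (cyclotomic m ℤ).coeff s := by
  have hrev : (cyclotomic m ℤ).reverse = cyclotomic m ℤ := by
    have h0 : (cyclotomic m ℤ).coeff 0 = 1 := cyclotomic_coeff_zero ℤ hm
    have htd : (cyclotomic m ℤ).natTrailingDegree = 0 := by
      rw [natTrailingDegree_eq_zero]; right; rw [h0]; exact one_ne_zero
    have hmon : (cyclotomic m ℤ).reverse.Monic := by
      rw [Monic, reverse_leadingCoeff, trailingCoeff, htd, h0]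
    have hdeg : (cyclotomic m ℤ).reverse.natDegree = (cyclotomic m ℤ).natDegree := by
      rw [reverse_natDegree, htd, Nat.sub_zero]
    have hz := Complex.isPrimitiveRoot_exp m (by omega)
    set z := Complex.exp (2 * Real.pi * Complex.I / m) with hzdef
    have hz0 : z ≠ 0 := hz.ne_zero (by omega)
    have hzi : IsPrimitiveRoot z⁻¹ m := hz.inv
    have hroot : eval₂ (Int.castRingHom ℂ) z (cyclotomic m ℤ) = 0 := by
      have := hz.isRoot_cyclotomic (by omega)
      rw [IsRoot.def, ← map_cyclotomic_int, eval_map] at this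
      exact this
    have hroot2 : aeval z⁻¹ (cyclotomic m ℤ).reverse = 0 := by
      let _ : Invertible z := invertibleOfNonzero hz0
      rw [aeval_def]
      have h3 := eval₂_reverse_eq_zero_iff (Int.castRingHom ℂ) z (cyclotomic m ℤ)
      rw [invOf_eq_inv] at h3
      exact h3.2 hroot
    have hdvd : cyclotomic m ℤ ∣ (cyclotomic m ℤ).reverse := by
      have h := minpoly.isIntegrallyClosed_dvd (hzi.isIntegral (by omega)) hroot2
      rwa [← cyclotomic_eq_minpoly hzi (by omega)] at h
    exact (eq_of_monic_of_dvd_of_natDegree_le (cyclotomic.monic m ℤ) hmon hdvd hdeg.le)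
  have := coeff_reverse (cyclotomic m ℤ) s
  rw [hrev, natDegree_cyclotomic, revAt_le hs] at this
  exact this.symm

/-- negative of the coefficients of the cofactor, as a periodic function -/
noncomputable def cB (m : ℕ) (u : ZMod m) : ℤ :=
  -((X ^ m - 1 : ℤ[X]) /ₘ cyclotomic m ℤ).coeff u.val

noncomputable def cG (m : ℕ) (ρ : ZMod m) (i : ℕ) (u : ZMod m) : ℤ :=
  ∑ s ∈ Finset.range (m.totient + 1),
    if s ≤ i then (cyclotomic m ℤ).coeff s * cB m (u + ((i : ZMod m) - s) * ρ) else 0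

lemma cyc_mul_series (m : ℕ) (hm : 1 < m) :
    ((cyclotomic m ℤ : ℤ[X]) : PowerSeries ℤ) * PowerSeries.mk (fun n => cB m (n : ZMod m)) = 1 := by
  have : NeZero m := ⟨by omega⟩
  set Ψ := (X ^ m - 1 : ℤ[X]) /ₘ cyclotomic m ℤ with hΨ
  have hmul : cyclotomic m ℤ * Ψ = X ^ m - 1 := by
    have h := modByMonic_add_div (X ^ m - 1 : ℤ[X]) (cyclotomic m ℤ)
    rwa [(modByMonic_eq_zero_iff_dvd (cyclotomic.monic m ℤ)).2 (cyclotomic.dvd_X_pow_sub_one m ℤ),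
      zero_add] at h
  have hdeg : Ψ.natDegree < m := by
    rw [hΨ, natDegree_divByMonic _ (cyclotomic.monic m ℤ), natDegree_cyclotomic,
      ← C_1, natDegree_X_pow_sub_C]
    have := Nat.totient_pos.2 (show 0 < m by omega)
    omega
  have hW : (PowerSeries.X ^ m - 1 : PowerSeries ℤ) * PowerSeries.mk (fun n => cB m (n : ZMod m))
      = (Ψ : PowerSeries ℤ) := by
    ext n
    rw [sub_mul, one_mul, map_sub, PowerSeries.coeff_X_pow_mul', PowerSeries.coeff_mk,
      Polynomial.coeff_coe]
    split_ifs with h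
    · rw [PowerSeries.coeff_mk, Nat.cast_sub h, ZMod.natCast_self, sub_zero, sub_self,
        coeff_eq_zero_of_natDegree_lt (by omega)]
    · have e : cB m (n : ZMod m) = -Ψ.coeff n := by
        have e1 : (n : ZMod m).val = n := by
          rw [ZMod.val_natCast, Nat.mod_eq_of_lt (by omega)]
        unfold cB
        rw [e1]
      rw [PowerSeries.coeff_mk, e]
      simp
  have hne : (PowerSeries.X ^ m - 1 : PowerSeries ℤ) ≠ 0 := by
    intro h
    have := congrArg PowerSeries.constantCoeff h
    rw [map_sub, map_pow, PowerSeries.constantCoeff_X, zero_pow (by omega)] at this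
    simp at this
  apply mul_left_cancel₀ hne
  rw [mul_left_comm, hW, mul_one, ← Polynomial.coe_mul, hmul]
  simp

lemma coeff_formula_s5 (m : ℕ) (hm : 1 < m) (p : ℕ) (hp : p.Prime) (hpm : m < p) (n : ℕ) :
    (cyclotomic (m * p) ℤ).coeff n = ∑ s ∈ Finset.range (m.totient + 1),
      if p * s ≤ n then (cyclotomic m ℤ).coeff s * cB m ((n - p * s : ℕ) : ZMod m) else 0 := by
  have hdiv : ¬ p ∣ m := fun h => by have := Nat.le_of_dvd (by omega) h; omega
  have h1 := cyclotomic_expand_eq_cyclotomic_mul hp hdiv ℤ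
  have h2 : ((cyclotomic (m * p) ℤ : ℤ[X]) : PowerSeries ℤ) =
      ((expand ℤ p (cyclotomic m ℤ) : ℤ[X]) : PowerSeries ℤ) *
        PowerSeries.mk (fun n => cB m (n : ZMod m)) := by
    rw [h1, Polynomial.coe_mul, mul_assoc, cyc_mul_series m hm, mul_one]
  have h3 : expand ℤ p (cyclotomic m ℤ) = ∑ s ∈ Finset.range (m.totient + 1),
      C ((cyclotomic m ℤ).coeff s) * X ^ (p * s) := by
    conv_lhs => rw [(cyclotomic m ℤ).as_sum_range_C_mul_X_pow, natDegree_cyclotomic]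
    simp [map_sum, ← pow_mul]
  rw [← Polynomial.coeff_coe, h2, h3, ← Polynomial.coeToPowerSeries.ringHom_apply, map_sum,
    Finset.sum_mul, map_sum]
  refine Finset.sum_congr rfl fun s _ => ?_
  rw [Polynomial.coeToPowerSeries.ringHom_apply, Polynomial.coe_mul, Polynomial.coe_C,
    Polynomial.coe_pow, Polynomial.coe_X, mul_assoc, PowerSeries.coeff_C_mul,
    PowerSeries.coeff_X_pow_mul']
  split_ifs <;> simp

lemma coeff_block (m : ℕ) (hm : 1 < m) (p : ℕ) (hp : p.Prime) (hpm : m < p) (i t : ℕ)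
    (ht : t < p) :
    (cyclotomic (m * p) ℤ).coeff (p * i + t) = cG m (p : ZMod m) i (t : ZMod m) := by
  rw [coeff_formula_s5 m hm p hp hpm, cG]
  refine Finset.sum_congr rfl fun s _ => ?_
  have hiff : p * s ≤ p * i + t ↔ s ≤ i := by
    constructor
    · intro h
      by_contra! hc
      have : p * (i + 1) ≤ p * s := Nat.mul_le_mul_left p hc
      rw [mul_add] at this
      omega
    · intro h
      have := Nat.mul_le_mul_left p h
      omega
  by_cases h : s ≤ i
  · rw [if_pos h, if_pos (hiff.2 h), Nat.cast_sub (hiff.2 h)]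
    congr 2
    push_cast
    ring
  · rw [if_neg h, if_neg (fun h' => h (hiff.1 h'))]

lemma natDegree_lt' (m : ℕ) (hm : 1 < m) (p : ℕ) (hp : p.Prime) (hpm : m < p) :
    (cyclotomic (m * p) ℤ).natDegree < p * m.totient := by
  have hcop : Nat.Coprime m p := (Nat.coprime_of_lt_prime (by omega) hpm hp).symm
  rw [natDegree_cyclotomic, Nat.totient_mul hcop, Nat.totient_prime hp, mul_comm]
  have := Nat.totient_pos.2 (show 0 < m by omega)
  have := hp.pos
  exact Nat.mul_lt_mul_of_pos_right (by omega) (by omega)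

lemma full_sum_zero (m : ℕ) (hm : 1 < m) (p : ℕ) (hp : p.Prime) (hpm : m < p) (u : ZMod m) :
    ∑ s ∈ Finset.range (m.totient + 1),
      (cyclotomic m ℤ).coeff s * cB m (u - s * (p : ZMod m)) = 0 := by
  have : NeZero m := ⟨by omega⟩
  have h := coeff_formula_s5 m hm p hp hpm (u.val + m * (p * m.totient))
  have hle : p * m.totient ≤ m * (p * m.totient) := Nat.le_mul_of_pos_left _ (by omega)
  rw [coeff_eq_zero_of_natDegree_lt (by
    have := natDegree_lt' m hm p hp hpm
    omega)] at h
  rw [h]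
  refine Finset.sum_congr rfl fun s hs => ?_
  have h1 : p * s ≤ p * m.totient :=
    Nat.mul_le_mul_left p (by have := Finset.mem_range.1 hs; omega)
  have h2 : p * s ≤ u.val + m * (p * m.totient) := by omega
  rw [if_pos h2, Nat.cast_sub h2]
  congr 2
  push_cast
  rw [ZMod.natCast_zmod_val, ZMod.natCast_self]
  ring

lemma cG_dual (m : ℕ) (hm : 1 < m) (p : ℕ) (hp : p.Prime) (hpm : m < p) (u : ZMod m) (i : ℕ)
    (hi : i < m.totient) :
    cG m (p : ZMod m) i u = - cG m (-(p : ZMod m)) (m.totient - 1 - i) (u - p) := by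
  have h := full_sum_zero m hm p hp hpm (u + i * p)
  rw [cG, cG, ← Finset.sum_range_reflect (fun s => if s ≤ m.totient - 1 - i then _ else _),
    eq_neg_iff_add_eq_zero, ← Finset.sum_add_distrib]
  refine Eq.trans ?_ h
  refine Finset.sum_congr rfl fun s hs => ?_
  have hs' : s ≤ m.totient := by have := Finset.mem_range.1 hs; omega
  have e : m.totient + 1 - 1 - s = m.totient - s := by omega
  rw [e, cyc_palin m hm s hs']
  by_cases hc : s ≤ i
  · rw [if_pos hc, if_neg (by omega), add_zero]
    congr 2; ring
  · rw [if_neg hc, if_pos (by omega), zero_add]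
    congr 2
    rw [Nat.cast_sub hs', Nat.cast_sub (by omega), Nat.cast_sub (by omega)]
    push_cast
    ring

lemma count_blocks (Q : ℕ → Prop) [DecidablePred Q] (p k : ℕ) :
    Nat.count Q (p * k) = ∑ i ∈ Finset.range k, Nat.count (fun t => Q (p * i + t)) p := by
  induction k with
  | zero => simp
  | succ k ih => rw [Finset.sum_range_succ, ← ih, mul_add, mul_one, Nat.count_add]

lemma count_congr' (Q R : ℕ → Prop) [DecidablePred Q] [DecidablePred R] (n : ℕ)
    (h : ∀ t < n, Q t ↔ R t) : Nat.count Q n = Nat.count R n := by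
  rw [Nat.count_eq_card_filter_range, Nat.count_eq_card_filter_range]
  congr 1
  exact Finset.filter_congr fun t ht => h t (Finset.mem_range.1 ht)

lemma count_periodic (m : ℕ) (Q : ZMod m → Prop) [DecidablePred Q] (q r : ℕ) :
    Nat.count (fun t : ℕ => Q (t : ZMod m)) (m * q + r) =
      q * Nat.count (fun t : ℕ => Q (t : ZMod m)) m + Nat.count (fun t : ℕ => Q (t : ZMod m)) r := by
  rw [Nat.count_add, count_blocks]
  simp

lemma hw_eq_s5 (m : ℕ) (hm : 1 < m) (p : ℕ) (hp : p.Prime) (hpm : m < p) :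
    hw (cyclotomic (m * p) ℤ) = ∑ i ∈ Finset.range m.totient,
      Nat.count (fun t : ℕ => cG m (p : ZMod m) i (t : ZMod m) ≠ 0) p := by
  have h1 : hw (cyclotomic (m * p) ℤ) =
      Nat.count (fun n => (cyclotomic (m * p) ℤ).coeff n ≠ 0) (p * m.totient) := by
    rw [hw, Nat.count_eq_card_filter_range]
    congr 1
    ext n
    rw [mem_support_iff, Finset.mem_filter, Finset.mem_range]
    refine ⟨fun h => ⟨?_, h⟩, fun h => h.2⟩
    exact (le_natDegree_of_ne_zero h).trans_lt (natDegree_lt' m hm p hp hpm)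
  rw [h1, count_blocks]
  refine Finset.sum_congr rfl fun i _ => ?_
  apply count_congr'
  intro t ht
  rw [coeff_block m hm p hp hpm i t ht]

theorem stmt5 (m : ℕ) (hm : 1 < m) (hodd : Odd m) (hsf : Squarefree m)
    (r : ℕ) (hr0 : 0 < r) (hrm : r < m) (hgcd : Nat.gcd r m = 1) :
    ∃ S T : ℤ,
      (∀ p : ℕ, p.Prime → m < p → p % m = r →
        (hw (cyclotomic (m * p) ℤ) : ℤ) = S * (((p - r) / m : ℕ) : ℤ) + T) ∧
      (∀ p : ℕ, p.Prime → m < p → p % m = m - r →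
        (hw (cyclotomic (m * p) ℤ) : ℤ) = S * (((p + r) / m : ℕ) : ℤ) - T) := by
  refine ⟨((∑ i ∈ Finset.range m.totient,
      Nat.count (fun t : ℕ => cG m (r : ZMod m) i (t : ZMod m) ≠ 0) m : ℕ) : ℤ),
    ((∑ i ∈ Finset.range m.totient,
      Nat.count (fun t : ℕ => cG m (r : ZMod m) i (t : ZMod m) ≠ 0) r : ℕ) : ℤ), ?_, ?_⟩
  · intro p hp hpm hpr
    have hpe : p = m * (p / m) + r := by rw [← hpr]; exact (Nat.div_add_mod p m).symm
    have hq : (p - r) / m = p / m := by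
      conv_lhs => rw [hpe, Nat.add_sub_cancel, Nat.mul_div_cancel_left _ (by omega)]
    have hc : (p : ZMod m) = r := by
      rw [← hpr, ZMod.natCast_mod]
    rw [hw_eq_s5 m hm p hp hpm, hq, hc]
    norm_cast
    rw [Finset.sum_mul, ← Finset.sum_add_distrib]
    refine Finset.sum_congr rfl fun i _ => ?_
    conv_lhs => rw [hpe]
    rw [count_periodic m (fun u => cG m (r : ZMod m) i u ≠ 0), mul_comm]
  · intro p hp hpm hpr
    have hpe : p + r = m * (p / m + 1) := by
      have := Nat.div_add_mod p m
      rw [mul_add]; omega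
    have hq : (p + r) / m = p / m + 1 := by
      rw [hpe, Nat.mul_div_cancel_left _ (by omega)]
    have hc : (p : ZMod m) = -r := by
      have : ((p + r : ℕ) : ZMod m) = 0 := by rw [hpe]; simp
      rw [eq_neg_iff_add_eq_zero]; exact_mod_cast this
    rw [eq_sub_iff_add_eq, hw_eq_s5 m hm p hp hpm, hq]
    norm_cast
    rw [← Finset.sum_range_reflect (fun i => Nat.count _ p), ← Finset.sum_add_distrib,
      Finset.sum_mul]
    refine Finset.sum_congr rfl fun i hi => ?_
    have hi' := Finset.mem_range.1 hi
    have h1 : Nat.count (fun t : ℕ => cG m (p : ZMod m) (m.totient - 1 - i) (t : ZMod m) ≠ 0) p =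
        Nat.count (fun t : ℕ => cG m (r : ZMod m) i ((r + t : ℕ) : ZMod m) ≠ 0) p := by
      apply count_congr'
      intro t _
      rw [cG_dual m hm p hp hpm _ _ (by omega), hc, neg_neg, sub_neg_eq_add, neg_ne_zero,
        show m.totient - 1 - (m.totient - 1 - i) = i by omega]
      push_cast
      rw [add_comm]
    have h2 := Nat.count_add (fun t : ℕ => cG m (r : ZMod m) i (t : ZMod m) ≠ 0) r p
    have h3 := count_periodic m (fun u => cG m (r : ZMod m) i u ≠ 0) (p / m + 1) 0
    rw [add_zero, ← hpe, add_comm p r, h2] at h3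
    rw [h1, add_comm, h3]
    simp [mul_comm]
end

section
/- Let p₂ > 3 be a prime. For every 0 ≤ i ≤ p₂ − 1, the coefficient of x^i in Φ_{3p₂} equals 1 if i ≡ 0 (mod 3), equals −1 if i ≡ 1 (mod 3), and equals 0 if i ≡ 2 (mod 3). -/
open Polynomial

theorem stmt6 (p₂ : ℕ) (hp : p₂.Prime) (h3 : 3 < p₂) (i : ℕ) (hi : i ≤ p₂ - 1) :
    (cyclotomic (3 * p₂) ℤ).coeff i =
      if i % 3 = 0 then 1 else if i % 3 = 1 then -1 else 0 := by
  have hd : ¬ p₂ ∣ 3 := fun h => by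
    have := Nat.le_of_dvd (by norm_num) h
    omega
  have key := cyclotomic_expand_eq_cyclotomic_mul hp hd ℤ
  rw [cyclotomic_three] at key
  simp only [map_add, map_pow, expand_X, map_one] at key
  generalize cyclotomic (3 * p₂) ℤ = F at key ⊢
  have e : F * (X ^ 2 + X + 1) = F * X * X + F * X + F := by ring
  rw [e, ← pow_mul] at key
  have hc : ∀ n, n < p₂ → (F * X * X + F * X + F).coeff n = if n = 0 then 1 else 0 := by
    intro n hn
    rw [← key]
    simp only [coeff_add, coeff_X_pow, coeff_one]
    rw [if_neg (by omega), if_neg (by omega)]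
    simp
  have h0 : F.coeff 0 = 1 := by
    have := hc 0 (by omega)
    simpa using this
  have h1 : F.coeff 1 = -1 := by
    have := hc 1 (by omega)
    rw [coeff_add, coeff_add, coeff_mul_X F 0, coeff_mul_X (F * X) 0] at this
    simp [h0] at this
    linarith
  have hs : ∀ n, n + 2 < p₂ → F.coeff (n + 2) = - F.coeff (n + 1) - F.coeff n := by
    intro n hn
    have := hc (n + 2) hn
    rw [coeff_add, coeff_add, coeff_mul_X F (n + 1), coeff_mul_X (F * X) (n + 1),
      coeff_mul_X F n, if_neg (by omega)] at this
    linarith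
  have hi' : i < p₂ := by omega
  clear hi
  induction i using Nat.strong_induction_on with
  | _ i ih =>
    match i, ih, hi' with
    | 0, _, _ => simpa using h0
    | 1, _, _ => simpa using h1
    | n + 2, ih, hi' =>
      rw [hs n hi', ih (n + 1) (by omega) (by omega), ih n (by omega) (by omega)]
      have : n % 3 = 0 ∨ n % 3 = 1 ∨ n % 3 = 2 := by omega
      rcases this with h | h | h <;> simp [Nat.add_mod, h]
end

section
/- Let p₂ be a prime with p₂ ≡ 2 (mod 3). For every i with p₂ ≤ i ≤ 2(p₂ − 1), the coefficient of x^i in Φ_{3p₂} equals 0 if i ≡ 0 (mod 3), equals −1 if i ≡ 1 (mod 3), and equals 1 if i ≡ 2 (mod 3). -/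
open Polynomial

theorem stmt7 (p₂ : ℕ) (hp : p₂.Prime) (hmod : p₂ % 3 = 2)
    (i : ℕ) (h1 : p₂ ≤ i) (h2 : i ≤ 2 * (p₂ - 1)) :
    (cyclotomic (3 * p₂) ℤ).coeff i =
      if i % 3 = 0 then 0 else if i % 3 = 1 then -1 else 1 := by
  have hp2 := hp.two_le
  have hnd : ¬ p₂ ∣ 3 := by
    intro h
    rcases (Nat.dvd_prime Nat.prime_three).1 h with h | h <;> omega
  have key := cyclotomic_expand_eq_cyclotomic_mul hp hnd ℤ
  have hdeg : (cyclotomic (3 * p₂) ℤ).natDegree = 2 * (p₂ - 1) := by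
    rw [natDegree_cyclotomic, Nat.totient_mul, Nat.totient_prime hp,
      Nat.totient_prime Nat.prime_three]
    exact ((Nat.coprime_primes Nat.prime_three hp).2 (by omega))
  generalize hC : cyclotomic (3 * p₂) ℤ = C at *
  rw [cyclotomic_three] at key
  have hrec : ∀ n, C.coeff n + C.coeff (n + 1) + C.coeff (n + 2) =
      (if n + 2 = p₂ * 2 then 1 else 0) + (if n + 2 = p₂ then 1 else 0) := by
    intro n
    have h := congrArg (fun q => coeff q (n + 2)) key
    have e : C * (X ^ 2 + X + 1) = C * X ^ 2 + C * X + C := by ring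
    simp only [e, map_add, map_pow, expand_X, map_one, ← pow_mul, coeff_add, coeff_X_pow,
      coeff_mul_X_pow, coeff_one] at h
    rw [show n + 2 = (n + 1) + 1 from rfl, coeff_mul_X] at h
    simp at h
    rw [← h]
  have main : ∀ k n, n + k = 2 * (p₂ - 1) → p₂ ≤ n →
      C.coeff n = (if n % 3 = 0 then 0 else if n % 3 = 1 then -1 else 1) ∧
      C.coeff (n + 1) =
        (if (n + 1) % 3 = 0 then 0 else if (n + 1) % 3 = 1 then -1 else 1) := by
    intro k
    induction k with
    | zero =>
      intro n hn hpn
      have a := hrec n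
      have b : C.coeff (n + 1) = 0 := coeff_eq_zero_of_natDegree_lt (by omega)
      have c : C.coeff (n + 2) = 0 := coeff_eq_zero_of_natDegree_lt (by omega)
      rw [b, c, if_pos (by omega), if_neg (by omega)] at a
      rw [b, if_neg (by omega), if_neg (by omega), if_pos (by omega)]
      exact ⟨by linarith, rfl⟩
    | succ k ih =>
      intro n hn hpn
      obtain ⟨b, c⟩ := ih (n + 1) (by omega) (by omega)
      have a := hrec n
      refine ⟨?_, b⟩
      rw [if_neg (by omega), if_neg (by omega)] at a
      rw [b, c] at a
      split_ifs at a ⊢ <;> omega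
  exact (main (2 * (p₂ - 1) - i) i (by omega) h1).1
end

section
/- Let p₂ > 3 be a prime with p₂ ≡ 1 (mod 3). For every i with p₂ − 1 ≤ i ≤ 2(p₂ − 1), the coefficient of x^i in Φ_{3p₂} equals 1 if i ≡ 0 (mod 3), equals 0 if i ≡ 1 (mod 3), and equals −1 if i ≡ 2 (mod 3); in particular, Φ_{3p₂} = (1 − x)·Σ_{j=0}^{q₂−1} x^{3j} + (1 − x²)·x^{p₂−1}·Σ_{j=0}^{q₂−1} x^{3j} + x^{2(p₂−1)}, where q₂ = (p₂ − 1)/3. -/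
open Polynomial

theorem aux_coeff (q n : ℕ) :
    (∑ j ∈ Finset.range q, (X : ℤ[X]) ^ (3 * j)).coeff n =
      if n % 3 = 0 ∧ n < 3 * q then 1 else 0 := by
  induction q with
  | zero => simp
  | succ q ih =>
    rw [Finset.sum_range_succ, coeff_add, ih, coeff_X_pow]
    split_ifs <;> first | omega | rfl

theorem aux_geom (q : ℕ) :
    (∑ j ∈ Finset.range q, (X : ℤ[X]) ^ (3 * j)) * (X ^ 3 - 1) = X ^ (3 * q) - 1 := by
  simp only [pow_mul]
  exact geom_sum_mul _ _

theorem stmt8 (p₂ : ℕ) (hp : p₂.Prime) (h3 : 3 < p₂) (hmod : p₂ % 3 = 1) :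
    (∀ i : ℕ, p₂ - 1 ≤ i → i ≤ 2 * (p₂ - 1) →
      (cyclotomic (3 * p₂) ℤ).coeff i =
        if i % 3 = 0 then 1 else if i % 3 = 1 then 0 else -1) ∧
    cyclotomic (3 * p₂) ℤ =
      (1 - X) * ∑ j ∈ Finset.range ((p₂ - 1) / 3), X ^ (3 * j)
        + (1 - X ^ 2) * X ^ (p₂ - 1) * ∑ j ∈ Finset.range ((p₂ - 1) / 3), X ^ (3 * j)
        + X ^ (2 * (p₂ - 1)) := by
  have hdiv : ¬ p₂ ∣ 3 := fun h => by
    have := Nat.le_of_dvd (by norm_num) h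
    omega
  have key := cyclotomic_expand_eq_cyclotomic_mul hp hdiv ℤ
  obtain ⟨q, rfl⟩ : ∃ q, p₂ = 3 * q + 1 := ⟨p₂ / 3, by omega⟩
  have e1 : 3 * q + 1 - 1 = 3 * q := by omega
  have e2 : 3 * q / 3 = q := by omega
  rw [e1, e2]
  have hS := aux_geom q
  have hC := aux_coeff q
  generalize (∑ j ∈ Finset.range q, (X : ℤ[X]) ^ (3 * j)) = S at hS hC ⊢
  have main : cyclotomic (3 * (3 * q + 1)) ℤ =
      (1 - X) * S + (1 - X ^ 2) * X ^ (3 * q) * S + X ^ (2 * (3 * q)) := by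
    apply mul_right_cancel₀ (cyclotomic_ne_zero 3 ℤ)
    rw [← key, cyclotomic_three]
    simp only [map_add, map_pow, expand_X, map_one]
    linear_combination (1 + (1 + X) * X ^ (3 * q)) * hS
  refine ⟨fun i h1 h2 => ?_, main⟩
  have main2 : cyclotomic (3 * (3 * q + 1)) ℤ =
      S - X ^ 1 * S + X ^ (3 * q) * S - X ^ (3 * q + 2) * S + X ^ (2 * (3 * q)) := by
    rw [main]; ring
  rw [main2]
  simp only [coeff_add, coeff_sub, coeff_X_pow_mul', coeff_X_pow, hC]
  split_ifs <;> omega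
end

section
/- Let p₂ > 3 be a prime. For every i with 1 ≤ i ≤ p₂ − 2, the truncation rem(Φ_{3p₂}(x), x^{i+1}) equals (1 − x)·Σ_{j=0}^{⌊(i−1)/3⌋} x^{3j} + x^i if i ≡ 0 (mod 3), and equals (1 − x)·Σ_{j=0}^{⌊i/3⌋} x^{3j} if i ≡ 1 or 2 (mod 3). -/
open Polynomial

lemma aux_main (p : ℕ) (hp : p.Prime) (h3 : 3 < p) (i : ℕ) (h2 : i + 1 ≤ p)
    (r Q : ℤ[X]) (hr : (X ^ 2 + X + 1) * r = 1 + X ^ (i + 1) * Q) (hd : r.natDegree ≤ i) :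
    cyclotomic (3 * p) ℤ %ₘ X ^ (i + 1) = r := by
  have hnd : ¬ p ∣ 3 := fun h => by
    have := Nat.le_of_dvd (by norm_num) h
    omega
  have hc := cyclotomic_expand_eq_cyclotomic_mul hp hnd ℤ
  rw [cyclotomic_three] at hc
  simp only [map_add, map_pow, expand_X, map_one] at hc
  obtain ⟨k, rfl⟩ := Nat.exists_eq_add_of_le h2
  have hdvd : (X ^ (i + 1) : ℤ[X]) ∣
      (X ^ 2 + X + 1) * (cyclotomic (3 * (i + 1 + k)) ℤ - r) := by
    refine ⟨X ^ k + X ^ k * X ^ (i + 1 + k) - Q, ?_⟩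
    have e : (X : ℤ[X]) ^ (i + 1 + k) = X ^ (i + 1) * X ^ k := pow_add _ _ _
    rw [e] at hc ⊢
    linear_combination -hc - hr
  have hcop : IsCoprime (X ^ (i + 1) : ℤ[X]) (X ^ 2 + X + 1) :=
    IsCoprime.pow_left ⟨-(1 + X), 1, by ring⟩
  obtain ⟨q, hq⟩ := hcop.dvd_of_dvd_mul_left hdvd
  refine (div_modByMonic_unique q r (monic_X_pow (i + 1)) ⟨?_, ?_⟩).2
  · linear_combination -hq
  · rw [degree_X_pow]
    exact lt_of_le_of_lt degree_le_natDegree (by exact_mod_cast Nat.lt_succ_of_le hd)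

lemma aux_sum (n : ℕ) :
    (X ^ 2 + X + 1) * ((1 - X) * ∑ j ∈ Finset.range n, (X : ℤ[X]) ^ (3 * j)) = 1 - X ^ (3 * n) := by
  have h := geom_sum_mul ((X : ℤ[X]) ^ 3) n
  simp only [← pow_mul] at h
  linear_combination -h

lemma aux_deg (n : ℕ) :
    ((1 - X) * ∑ j ∈ Finset.range (n + 1), (X : ℤ[X]) ^ (3 * j)).natDegree ≤ 3 * n + 1 := by
  refine natDegree_mul_le.trans ?_
  have h1 : (1 - X : ℤ[X]).natDegree ≤ 1 := by compute_degree
  have h2 : (∑ j ∈ Finset.range (n + 1), (X : ℤ[X]) ^ (3 * j)).natDegree ≤ 3 * n := by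
    refine natDegree_sum_le_of_forall_le _ _ fun j hj => ?_
    rw [natDegree_X_pow]
    have := Finset.mem_range.1 hj
    omega
  omega

theorem stmt9 (p₂ : ℕ) (hp : p₂.Prime) (h3 : 3 < p₂)
    (i : ℕ) (h1 : 1 ≤ i) (h2 : i ≤ p₂ - 2) :
    cyclotomic (3 * p₂) ℤ %ₘ X ^ (i + 1) =
      if i % 3 = 0 then
        (1 - X) * ∑ j ∈ Finset.range ((i - 1) / 3 + 1), X ^ (3 * j) + X ^ i
      else
        (1 - X) * ∑ j ∈ Finset.range (i / 3 + 1), X ^ (3 * j) := by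
  split_ifs with h
  · have e : 3 * ((i - 1) / 3 + 1) = i := by omega
    refine aux_main p₂ hp h3 i (by omega) _ (1 + X) ?_ ?_
    · have := aux_sum ((i - 1) / 3 + 1)
      rw [e] at this
      rw [mul_add, this]
      ring
    · refine (natDegree_add_le _ _).trans (max_le ((aux_deg _).trans (by omega)) ?_)
      rw [natDegree_X_pow]
  · refine aux_main p₂ hp h3 i (by omega) _ (-X ^ (3 * (i / 3 + 1) - (i + 1))) ?_
      ((aux_deg _).trans (by omega))
    rw [aux_sum, mul_neg, ← pow_add, show i + 1 + (3 * (i / 3 + 1) - (i + 1)) = 3 * (i / 3 + 1) by omega]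
    ring
end

section
/- Let p₂ > 3 be a prime and let p be a prime with p > 3p₂ and p ≡ 2 (mod 3p₂). For every 0 ≤ i ≤ p₂ − 2, the block polynomial f_{3p₂,p,i,0} equals −rem( x^{3p₂ − 2i} · Ψ_{3p₂}(x) · T_i(x²), x^{3p₂} − 1 ), where T_i(x) = rem(Φ_{3p₂}(x), x^{i+1}) is the truncation of Φ_{3p₂} to degrees < i + 1. -/
open Polynomial

/-- The block `f_{m,p,i,0}`: the polynomial of degree `< m` whose coefficient of `x^k`
is the coefficient of `x^(i*p + k)` in `Φ_{mp}`, for `0 ≤ k < m`. -/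
noncomputable def blockPoly (m p i : ℕ) : Polynomial ℤ :=
  ∑ k ∈ Finset.range m, C ((cyclotomic (m * p) ℤ).coeff (i * p + k)) * X ^ k

/-- cyclic shift of the coefficients of `q` -/
noncomputable def shiftPoly (m : ℕ) (q : Polynomial ℤ) (s : ℕ) : Polynomial ℤ :=
  ∑ k ∈ Finset.range m, C (q.coeff ((s + k) % m)) * X ^ k

lemma shiftPoly_zero (m : ℕ) (q : Polynomial ℤ) (hq : q.natDegree < m) :
    shiftPoly m q 0 = q := by
  conv_rhs => rw [q.as_sum_range' m hq]
  unfold shiftPoly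
  refine Finset.sum_congr rfl fun k hk => ?_
  rw [zero_add, Nat.mod_eq_of_lt (Finset.mem_range.mp hk), C_mul_X_pow_eq_monomial]

lemma shiftPoly_succ (m : ℕ) (q : Polynomial ℤ) (s : ℕ) :
    X * shiftPoly m q (s + 1) = shiftPoly m q s + (X ^ m - 1) * C (q.coeff (s % m)) := by
  have h1 := Finset.sum_range_succ (fun k => C (q.coeff ((s + k) % m)) * X ^ k) m
  have h2 := Finset.sum_range_succ' (fun k => C (q.coeff ((s + k) % m)) * X ^ k) m
  rw [h1] at h2
  have h3 : X * shiftPoly m q (s + 1)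
      = ∑ k ∈ Finset.range m, C (q.coeff ((s + (k + 1)) % m)) * X ^ (k + 1) := by
    unfold shiftPoly
    rw [Finset.mul_sum]
    refine Finset.sum_congr rfl fun k _ => ?_
    rw [show s + 1 + k = s + (k + 1) by ring]
    ring
  rw [h3]
  simp only [Nat.add_mod_right, add_zero, pow_zero, mul_one] at h2
  unfold shiftPoly
  linear_combination -h2

lemma shiftPoly_dvd (m : ℕ) (q : Polynomial ℤ) (hq : q.natDegree < m) (s : ℕ) :
    (X ^ m - 1 : Polynomial ℤ) ∣ X ^ s * shiftPoly m q s - q := by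
  induction s with
  | zero => simp [shiftPoly_zero m q hq]
  | succ s ih =>
    have : X ^ (s + 1) * shiftPoly m q (s + 1) - q
        = (X ^ s * shiftPoly m q s - q) + (X ^ m - 1) * (X ^ s * C (q.coeff (s % m))) := by
      rw [pow_succ, mul_assoc, shiftPoly_succ]; ring
    rw [this]
    exact dvd_add ih (dvd_mul_right _ _)

lemma series_mul (m : ℕ) (q : Polynomial ℤ) (hq : q.natDegree < m) :
    (1 - PowerSeries.X ^ m) * PowerSeries.mk (fun n => q.coeff (n % m))
      = (q : PowerSeries ℤ) := by
  ext n
  rw [sub_mul, one_mul, map_sub, PowerSeries.coeff_X_pow_mul', PowerSeries.coeff_mk,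
    Polynomial.coeff_coe]
  split_ifs with h
  · rw [PowerSeries.coeff_mk, coeff_eq_zero_of_natDegree_lt (hq.trans_le h),
      ← Nat.mod_eq_sub_mod h, sub_self]
  · rw [Nat.mod_eq_of_lt (by omega), sub_zero]

lemma coeff_main (m p : ℕ) (F A q : Polynomial ℤ) (hm : 0 < m) (hq : q.natDegree < m)
    (h : F * (X ^ m - 1) = A.comp (X ^ p) * q) (i k : ℕ) (hk : k < p) :
    F.coeff (i * p + k) =
      -∑ j ∈ Finset.range (i + 1), A.coeff j * q.coeff (((i - j) * p + k) % m) := by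
  set G : PowerSeries ℤ := PowerSeries.mk (fun n => q.coeff (n % m)) with hG
  have hE : A.comp (X ^ p) =
      ∑ j ∈ Finset.range (A.natDegree + i + 1), C (A.coeff j) * X ^ (j * p) := by
    conv_lhs => rw [A.as_sum_range' (A.natDegree + i + 1) (by omega)]
    rw [Polynomial.sum_comp]
    refine Finset.sum_congr rfl fun j _ => ?_
    rw [monomial_comp, ← pow_mul, mul_comm p j]
  have h1 : (F : PowerSeries ℤ) = -(((A.comp (X ^ p) : Polynomial ℤ) : PowerSeries ℤ) * G) := by
    have hne : (1 - PowerSeries.X ^ m : PowerSeries ℤ) ≠ 0 := by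
      intro h0
      have := congrArg (PowerSeries.coeff 0) h0
      rw [map_sub, PowerSeries.coeff_X_pow, if_neg hm.ne] at this
      simp at this
    have h2 := congrArg (fun f : Polynomial ℤ => (f : PowerSeries ℤ)) h
    simp only [Polynomial.coe_mul, Polynomial.coe_sub, Polynomial.coe_pow, Polynomial.coe_X,
      Polynomial.coe_one] at h2
    apply mul_right_cancel₀ hne
    rw [← series_mul m q hq] at h2
    linear_combination -h2
  have h3 : F.coeff (i * p + k) = PowerSeries.coeff (i * p + k) (F : PowerSeries ℤ) := by
    rw [Polynomial.coeff_coe]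
  rw [h3, h1, map_neg, hE]
  congr 1
  have h4 : ((∑ j ∈ Finset.range (A.natDegree + i + 1), C (A.coeff j) * X ^ (j * p) :
      Polynomial ℤ) : PowerSeries ℤ) = ∑ j ∈ Finset.range (A.natDegree + i + 1),
        PowerSeries.C (A.coeff j) * PowerSeries.X ^ (j * p) := by
    rw [← Polynomial.coeToPowerSeries.ringHom_apply, map_sum]
    refine Finset.sum_congr rfl fun j _ => ?_
    rw [Polynomial.coeToPowerSeries.ringHom_apply, Polynomial.coe_mul, Polynomial.coe_pow,
      Polynomial.coe_X, Polynomial.coe_C]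
  rw [h4, Finset.sum_mul, map_sum]
  have hterm : ∀ j, PowerSeries.coeff (i * p + k)
      (PowerSeries.C (A.coeff j) * PowerSeries.X ^ (j * p) * G)
      = if j ≤ i then A.coeff j * q.coeff (((i - j) * p + k) % m) else 0 := by
    intro j
    rw [mul_assoc, PowerSeries.coeff_C_mul, PowerSeries.coeff_X_pow_mul']
    by_cases hj : j ≤ i
    · have hle : j * p ≤ i * p := Nat.mul_le_mul_right p hj
      rw [if_pos (by omega), if_pos hj, hG, PowerSeries.coeff_mk, Nat.sub_mul,
        Nat.sub_add_comm hle]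
    · have hle : (i + 1) * p ≤ j * p := Nat.mul_le_mul_right p (by omega)
      rw [add_mul, one_mul] at hle
      rw [if_neg (by omega), if_neg hj, mul_zero]
  simp only [hterm]
  rw [← Finset.sum_filter]
  refine Finset.sum_congr ?_ fun _ _ => rfl
  ext j
  simp only [Finset.mem_filter, Finset.mem_range]
  omega

lemma trunc_eq (A : Polynomial ℤ) (n : ℕ) :
    A %ₘ X ^ n = ∑ j ∈ Finset.range n, C (A.coeff j) * X ^ j := by
  have hmon : (X ^ n : Polynomial ℤ).Monic := monic_X_pow n
  have hd : (X ^ n : Polynomial ℤ) ∣ A - ∑ j ∈ Finset.range n, C (A.coeff j) * X ^ j := by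
    rw [X_pow_dvd_iff]
    intro d hd
    simp [coeff_X_pow, hd]
  obtain ⟨g, hg⟩ := hd
  refine (div_modByMonic_unique g _ hmon ⟨by rw [← hg]; ring, ?_⟩).2
  rw [degree_X_pow]
  rw [← mem_degreeLT]
  refine Submodule.sum_mem _ fun k hk => ?_
  rw [mem_degreeLT]
  exact (degree_C_mul_X_pow_le _ _).trans_lt (by exact_mod_cast Finset.mem_range.mp hk)

theorem stmt10 (p₂ p : ℕ) (hp₂ : p₂.Prime) (h3 : 3 < p₂) (hp : p.Prime)
    (hgt : 3 * p₂ < p) (hmod : p % (3 * p₂) = 2) (i : ℕ) (hi : i ≤ p₂ - 2) :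
    blockPoly (3 * p₂) p i =
      -((X ^ (3 * p₂ - 2 * i) *
          (invCyclotomic (3 * p₂) *
            (cyclotomic (3 * p₂) ℤ %ₘ X ^ (i + 1)).comp (X ^ 2))) %ₘ
        (X ^ (3 * p₂) - 1)) := by
  have h2i : 2 * i ≤ 3 * p₂ := by omega
  have hm : 0 < 3 * p₂ := by omega
  clear hi h3 hp₂
  generalize 3 * p₂ = m at *
  set q := invCyclotomic m with hqdef
  set A := cyclotomic m ℤ with hA
  have hAq : A * q = X ^ m - 1 := by
    have h := modByMonic_add_div (X ^ m - 1 : Polynomial ℤ) A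
    rw [(modByMonic_eq_zero_iff_dvd (cyclotomic.monic m ℤ)).2
      (cyclotomic.dvd_X_pow_sub_one m ℤ), zero_add] at h
    exact h
  have hmon : (X ^ m - 1 : Polynomial ℤ).Monic := monic_X_pow_sub_C 1 hm.ne'
  have hdeg : (X ^ m - 1 : Polynomial ℤ).natDegree = m := natDegree_X_pow_sub_C (r := (1 : ℤ))
  have hq : q.natDegree < m := by
    have hq0 : q ≠ 0 := by
      rintro h0
      rw [h0, mul_zero] at hAq
      exact hmon.ne_zero hAq.symm
    have := natDegree_mul (cyclotomic_ne_zero m ℤ) hq0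
    rw [hAq, hdeg, natDegree_cyclotomic] at this
    have := Nat.totient_pos.2 hm
    omega
  have hF : cyclotomic (m * p) ℤ * (X ^ m - 1) = A.comp (X ^ p) * q := by
    have hnd : ¬ p ∣ m := fun h => absurd (Nat.le_of_dvd hm h) (by omega)
    have := cyclotomic_expand_eq_cyclotomic_mul hp hnd ℤ
    rw [expand_eq_comp_X_pow] at this
    rw [hA, this, ← hAq]; ring
  have hblock : blockPoly m p i =
      -∑ j ∈ Finset.range (i + 1), C (A.coeff j) * shiftPoly m q (2 * (i - j)) := by
    unfold blockPoly shiftPoly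
    simp only [Finset.mul_sum]
    rw [Finset.sum_comm, ← Finset.sum_neg_distrib]
    refine Finset.sum_congr rfl fun k hk => ?_
    rw [coeff_main m p _ A q hm hq hF i k ((Finset.mem_range.mp hk).trans hgt), map_neg, map_sum,
      neg_mul, Finset.sum_mul]
    congr 1
    refine Finset.sum_congr rfl fun j _ => ?_
    have : ((i - j) * p + k) % m = (2 * (i - j) + k) % m := by
      have hpm : p ≡ 2 [MOD m] := by
        have := Nat.mod_modEq p m
        rw [hmod] at this
        exact this.symm
      have := (hpm.mul_left (i - j)).add_right k
      rw [mul_comm (i - j) 2] at this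
      exact this
    rw [this, C_mul, mul_assoc]
  rw [hblock]
  congr 1
  symm
  have hd : (X ^ m - 1 : Polynomial ℤ) ∣
      X ^ (m - 2 * i) * (q * (A %ₘ X ^ (i + 1)).comp (X ^ 2)) -
        ∑ j ∈ Finset.range (i + 1), C (A.coeff j) * shiftPoly m q (2 * (i - j)) := by
    rw [trunc_eq, Polynomial.sum_comp, Finset.mul_sum, Finset.mul_sum,
      ← Finset.sum_sub_distrib]
    refine Finset.dvd_sum fun j hj => ?_
    have hj' : j ≤ i := by have := Finset.mem_range.mp hj; omega
    obtain ⟨g, hg⟩ := shiftPoly_dvd m q hq (2 * (i - j))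
    have e1 : (X ^ m : Polynomial ℤ) = X ^ (m - 2 * i) * X ^ (2 * j) * X ^ (2 * (i - j)) := by
      rw [← pow_add, ← pow_add]; congr 1; omega
    refine ⟨C (A.coeff j) * shiftPoly m q (2 * (i - j))
      - C (A.coeff j) * X ^ (m - 2 * i) * X ^ (2 * j) * g, ?_⟩
    rw [mul_comp, C_comp, pow_comp, X_comp, ← pow_mul]
    linear_combination (-C (A.coeff j) * X ^ (m - 2 * i) * X ^ (2 * j)) * hg
      - C (A.coeff j) * shiftPoly m q (2 * (i - j)) * e1
  obtain ⟨g, hg⟩ := hd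
  refine (div_modByMonic_unique g _ hmon ⟨by rw [← hg]; ring, ?_⟩).2
  rw [degree_eq_natDegree hmon.ne_zero, hdeg, ← mem_degreeLT]
  refine Submodule.sum_mem _ fun j _ => ?_
  rw [← smul_eq_C_mul]
  refine Submodule.smul_mem _ _ (Submodule.sum_mem _ fun k hk => ?_)
  rw [mem_degreeLT]
  exact (degree_C_mul_X_pow_le _ _).trans_lt (by exact_mod_cast Finset.mem_range.mp hk)
end

section
/- Let p₂ > 3 be a prime with p₂ ≡ 1 (mod 3), set q₂ = (p₂ − 1)/3 (which is even), and let p₃ be a prime with p₃ > 3p₂ and p₃ ≡ 2 (mod 3p₂). Let i = 3u + v with v ∈ {1, 2} and i < p₂ − 1. Then hw(f_{3p₂,p₃,i,0}) = 8(u + 1) if 0 ≤ u ≤ q₂/2 − 1, and hw(f_{3p₂,p₃,i,0}) = 4(u + 1 + q₂/2) if q₂/2 ≤ u ≤ q₂ − 1. -/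
open Polynomial

/-- Periodic coefficients of the power series `1 / Φ_{3p}`. -/
def cper (p n : ℕ) : ℤ :=
  if n % (3 * p) < 3 then 1
  else if p ≤ n % (3 * p) ∧ n % (3 * p) < p + 3 then -1 else 0

/-- The shifted block coefficients. -/
def gper (p u k : ℕ) : ℤ :=
  ∑ s ∈ Finset.range (u + 1), (cper p (k + 6 * s + 2) - cper p (k + 6 * s))

theorem cper_congr (p a b : ℕ) (h : a % (3 * p) = b % (3 * p)) : cper p a = cper p b := by
  simp only [cper, h]

theorem cper_series (p : ℕ) (hp : 3 < p) :
    (PowerSeries.mk (cper p)) * (1 - PowerSeries.X ^ (3 * p)) =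
      (1 - PowerSeries.X ^ p) * (1 + PowerSeries.X + PowerSeries.X ^ 2) := by
  have h : (1 - PowerSeries.X ^ p) * (1 + PowerSeries.X + PowerSeries.X ^ 2)
      = (PowerSeries.X ^ 0 + PowerSeries.X ^ 1 + PowerSeries.X ^ 2
        - PowerSeries.X ^ p - PowerSeries.X ^ (p + 1) - PowerSeries.X ^ (p + 2)
        : PowerSeries ℤ) := by ring
  rw [h]
  ext n
  rw [mul_sub, mul_one, map_sub, PowerSeries.coeff_mul_X_pow']
  simp only [map_sub, map_add, PowerSeries.coeff_X_pow, PowerSeries.coeff_mk]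
  by_cases hn : 3 * p ≤ n
  · have : cper p (n - 3 * p) = cper p n := by
      apply cper_congr
      conv_rhs => rw [← Nat.sub_add_cancel hn]
      simp
    rw [if_pos hn, this]
    repeat rw [if_neg (by omega)]
    simp
  · rw [if_neg hn]
    have : n % (3 * p) = n := Nat.mod_eq_of_lt (by omega)
    simp only [cper, this]
    split_ifs <;> omega

theorem cyc_identity (p r : ℕ) (hp : p.Prime) (h3 : 3 < p) (hr : r.Prime) (hgt : 3 * p < r) :
    cyclotomic (3 * p * r) ℤ * (1 - X ^ (3 * r)) * (1 - X ^ (3 * p)) =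
      (1 - X ^ r) * (1 + X ^ (p * r) + X ^ (2 * (p * r))) *
        ((1 - X ^ p) * (1 + X + X ^ 2)) := by
  have e1 := cyclotomic_expand_eq_cyclotomic_mul (n := 3 * p) hr
    (fun h => by have := Nat.le_of_dvd (by omega) h; omega) ℤ
  have e2 := cyclotomic_expand_eq_cyclotomic_mul (n := 3) hp
    (fun h => by have := Nat.le_of_dvd (by omega) h; omega) ℤ
  have e3 := congrArg (expand ℤ r) e2
  rw [map_mul, e1] at e3
  rw [cyclotomic_three] at e2 e3
  simp only [map_add, map_pow, map_one, expand_X] at e2 e3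
  have hne : (cyclotomic (3 * p) ℤ) * (1 + X + X ^ 2) ≠ 0 := by
    apply mul_ne_zero (cyclotomic_ne_zero _ _)
    rw [show (1 + X + X ^ 2 : ℤ[X]) = cyclotomic 3 ℤ by rw [cyclotomic_three]; ring]
    exact cyclotomic_ne_zero _ _
  have f : (cyclotomic (3 * p) ℤ) * (1 + X + X ^ 2) * (1 - X ^ p) = 1 - X ^ (3 * p) := by
    rw [show (X : ℤ[X]) ^ (3 * p) = (X ^ p) ^ 3 by rw [← pow_mul, mul_comm]]
    linear_combination (-(1 - X ^ p)) * e2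
  apply mul_left_cancel₀ hne
  have g1 : (X : ℤ[X]) ^ (3 * r) = (X ^ r) ^ 3 := by rw [← pow_mul, mul_comm]
  have g2 : (X : ℤ[X]) ^ (p * r) = (X ^ r) ^ p := by rw [← pow_mul, mul_comm]
  have g3 : (X : ℤ[X]) ^ (2 * (p * r)) = ((X ^ r) ^ p) ^ 2 := by
    rw [← pow_mul, ← pow_mul]; congr 1; ring
  rw [← f, g1, g2, g3]
  have g4 : ((X : ℤ[X]) ^ p) ^ r = (X ^ r) ^ p := by rw [← pow_mul, ← pow_mul, mul_comm]
  try rw [g4] at e3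
  linear_combination (-(cyclotomic (3 * p) ℤ * (1 + X + X ^ 2) * (1 - X ^ p) * (1 + X + X ^ 2) * (1 - X ^ r))) * e3

theorem coeff_formula_s11 (p r : ℕ) (hp : p.Prime) (h3 : 3 < p) (hr : r.Prime) (hgt : 3 * p < r)
    (u n : ℕ) (hup : 3 * (u + 1) ≤ p) (hn1 : 3 * r * u + r ≤ n) (hn2 : n < 3 * r * (u + 1)) :
    (cyclotomic (3 * p * r) ℤ).coeff n =
      ∑ t ∈ Finset.range (u + 1), (cper p (n - 3 * r * t) - cper p (n - (3 * r * t + r))) := by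
  have id1 := congrArg (fun f : ℤ[X] => (f : PowerSeries ℤ)) (cyc_identity p r hp h3 hr hgt)
  simp only [Polynomial.coe_mul, Polynomial.coe_sub, Polynomial.coe_add, Polynomial.coe_one,
    Polynomial.coe_pow, Polynomial.coe_X] at id1
  rw [← cper_series p h3, ← mul_assoc] at id1
  have hne : (1 - PowerSeries.X ^ (3 * p) : PowerSeries ℤ) ≠ 0 := by
    intro h
    have := congrArg (PowerSeries.coeff 0) h
    rw [map_sub, PowerSeries.coeff_X_pow] at this
    rw [if_neg (by omega)] at this
    simp at this
  have id2 := mul_right_cancel₀ hne id1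
  set F : PowerSeries ℤ := ((cyclotomic (3 * p * r) ℤ : ℤ[X]) : PowerSeries ℤ) with hF
  set M := PowerSeries.mk (cper p)
  have geo : (∑ t ∈ Finset.range (u + 1), (PowerSeries.X ^ (3 * r) : PowerSeries ℤ) ^ t)
      * (1 - PowerSeries.X ^ (3 * r)) = 1 - PowerSeries.X ^ (3 * r * (u + 1)) := by
    have := geom_sum_mul_neg (PowerSeries.X ^ (3 * r) : PowerSeries ℤ) (u + 1)
    rwa [← pow_mul] at this
  set S := ∑ t ∈ Finset.range (u + 1), (PowerSeries.X ^ (3 * r) : PowerSeries ℤ) ^ t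
  have e : F = S * (1 - PowerSeries.X ^ r) * M + F * PowerSeries.X ^ (3 * r * (u + 1))
      + (S * (1 - PowerSeries.X ^ r) * M * (1 + PowerSeries.X ^ (p * r))) * PowerSeries.X ^ (p * r) := by
    have : (PowerSeries.X : PowerSeries ℤ) ^ (2 * (p * r)) = (PowerSeries.X ^ (p * r)) ^ 2 := by
      rw [← pow_mul, mul_comm]
    rw [this] at id2
    linear_combination S * id2 - F * geo
  have hpr : n < p * r := by nlinarith
  rw [← Polynomial.coeff_coe, ← hF, e, map_add, map_add, PowerSeries.coeff_mul_X_pow',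
    PowerSeries.coeff_mul_X_pow', if_neg (by omega), if_neg (by omega), add_zero, add_zero]
  have e' : S * (1 - PowerSeries.X ^ r) * M = ∑ t ∈ Finset.range (u + 1),
      (PowerSeries.X ^ (3 * r * t) * M - PowerSeries.X ^ (3 * r * t + r) * M) := by
    simp only [S, Finset.sum_mul]
    refine Finset.sum_congr rfl fun t _ => ?_
    rw [← pow_mul, pow_add]; ring
  rw [e', map_sum]
  refine Finset.sum_congr rfl fun t ht => ?_
  have ht' : t ≤ u := by simpa [Nat.lt_succ_iff] using ht
  have : 3 * r * t ≤ 3 * r * u := Nat.mul_le_mul_left _ ht'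
  rw [map_sub, PowerSeries.coeff_X_pow_mul', PowerSeries.coeff_X_pow_mul', if_pos (by omega),
    if_pos (by omega), PowerSeries.coeff_mk, PowerSeries.coeff_mk]

theorem coeff_gper (p r : ℕ) (hp : p.Prime) (h3 : 3 < p) (hr : r.Prime) (hgt : 3 * p < r)
    (hmod : r % (3 * p) = 2)
    (u w k : ℕ) (hup : 3 * (u + 1) ≤ p) (hw2 : w ≤ 1) (hk : k < 3 * p) :
    (cyclotomic (3 * p * r) ℤ).coeff ((3 * u + (w + 1)) * r + k) = gper p u (k + 2 * w) := by
  rw [coeff_formula_s11 p r hp h3 hr hgt u _ hup (by nlinarith) (by nlinarith), gper,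
    ← Finset.sum_range_reflect]
  have hr2 : r ≡ 2 [MOD (3 * p)] := by
    rw [Nat.ModEq, hmod, Nat.mod_eq_of_lt (by omega)]
  refine Finset.sum_congr rfl fun s hs => ?_
  obtain ⟨t, rfl⟩ : ∃ t, u = s + t := ⟨u - s, by simp at hs; omega⟩
  have h1 : s + t + 1 - 1 - s = t := by omega
  rw [h1]
  have h2 : (3 * (s + t) + (w + 1)) * r + k - 3 * r * t = (3 * s + w + 1) * r + k := by
    apply Nat.sub_eq_of_eq_add; ring
  have h3 : (3 * (s + t) + (w + 1)) * r + k - (3 * r * t + r) = (3 * s + w) * r + k := by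
    apply Nat.sub_eq_of_eq_add; ring
  rw [h2, h3]
  congr 1
  · apply cper_congr
    have := (hr2.mul_left (3 * s + w + 1)).add_right k
    rw [show k + 2 * w + 6 * s + 2 = (3 * s + w + 1) * 2 + k by ring]
    exact this
  · apply cper_congr
    have := (hr2.mul_left (3 * s + w)).add_right k
    rw [show k + 2 * w + 6 * s = (3 * s + w) * 2 + k by ring]
    exact this

theorem gper_periodic (p u k : ℕ) : gper p u (k + 3 * p) = gper p u k := by
  refine Finset.sum_congr rfl fun s _ => ?_
  congr 1
  · apply cper_congr
    rw [show k + 3 * p + 6 * s + 2 = k + 6 * s + 2 + 3 * p by ring]; simp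
  · apply cper_congr
    rw [show k + 3 * p + 6 * s = k + 6 * s + 3 * p by ring]; simp

/-- Indicator that `k + 6 s = a` for some `s ≤ u`. -/
def ind (u k a : ℕ) : ℤ := if k ≤ a ∧ (a - k) % 6 = 0 ∧ a - k ≤ 6 * u then 1 else 0

theorem sum_ind (u k a : ℕ) :
    ∑ s ∈ Finset.range (u + 1), (if k + 6 * s = a then (1 : ℤ) else 0) = ind u k a := by
  unfold ind
  split_ifs with h
  · rw [Finset.sum_eq_single ((a - k) / 6)]
    · rw [if_pos (by omega)]
    · intro b _ hb
      rw [if_neg (by omega)]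
    · intro hb
      simp at hb
      omega
  · apply Finset.sum_eq_zero
    intro s hs
    simp at hs
    rw [if_neg (by omega)]

theorem cper_window (p n : ℕ) (hp : 3 < p) (h1 : p + 6 ≤ n) (h2 : n < 6 * p) :
    cper p n = (if 3 * p ≤ n ∧ n < 3 * p + 3 then 1 else 0)
      - (if 4 * p ≤ n ∧ n < 4 * p + 3 then 1 else 0) := by
  by_cases hn : 3 * p ≤ n
  · have : n % (3 * p) = n - 3 * p := by
      rw [Nat.mod_eq_sub_mod hn, Nat.mod_eq_of_lt (by omega)]
    simp only [cper, this]
    split_ifs <;> omega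
  · have : n % (3 * p) = n := Nat.mod_eq_of_lt (by omega)
    simp only [cper, this]
    split_ifs <;> omega

theorem gper_window (h u k : ℕ) (hh : 0 < h) (hu : u + 1 ≤ 2 * h) (h1 : 6 * h + 7 ≤ k)
    (h2 : k < 24 * h + 10) :
    gper (6 * h + 1) u k = ind u k (18 * h + 1) + ind u k (18 * h + 2) - ind u k (18 * h + 4)
      - ind u k (18 * h + 5) - ind u k (24 * h + 2) - ind u k (24 * h + 3)
      + ind u k (24 * h + 5) + ind u k (24 * h + 6) := by
  simp only [← sum_ind, ← Finset.sum_add_distrib, ← Finset.sum_sub_distrib, gper]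
  refine Finset.sum_congr rfl fun s hs => ?_
  simp at hs
  rw [cper_window _ _ (by omega) (by omega) (by omega),
    cper_window _ _ (by omega) (by omega) (by omega)]
  generalize hx : k + 6 * s = x
  have hc : (x = 18*h+1 ∨ x = 18*h+2 ∨ x = 18*h+3 ∨ x = 18*h+4 ∨ x = 18*h+5 ∨ x = 24*h+2
    ∨ x = 24*h+3 ∨ x = 24*h+4 ∨ x = 24*h+5 ∨ x = 24*h+6) ∨ (x < 18*h+1 ∨ (18*h+5 < x ∧ x < 24*h+2)
    ∨ 24*h+6 < x) := by omega
  rcases hc with (h | h | h | h | h | h | h | h | h | h) | h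
  all_goals
    repeat first | rw [if_pos (by omega)] | rw [if_neg (by omega)]
    try norm_num

/-- Arithmetic progression with difference `6`. -/
def prog (a n : ℕ) : Finset ℕ := (Finset.range n).image (fun s => a + 6 * s)

theorem card_prog (a n : ℕ) : (prog a n).card = n := by
  rw [prog, Finset.card_image_of_injective _ (fun x y h => by simpa using h), Finset.card_range]

theorem mem_prog (a n k : ℕ) : k ∈ prog a n ↔ a ≤ k ∧ (k - a) % 6 = 0 ∧ k < a + 6 * n := by
  simp only [prog, Finset.mem_image, Finset.mem_range]
  constructor
  · rintro ⟨s, hs, rfl⟩; omega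
  · rintro ⟨h1, h2, h3⟩; exact ⟨(k - a) / 6, by omega, by omega⟩

theorem prog_false (a n k : ℕ) (h : k % 6 ≠ a % 6) : (k ∈ prog a n) ↔ False := by
  rw [mem_prog, iff_false]
  rintro ⟨h1, h2, -⟩
  omega

theorem prog_disj (a n b m : ℕ) (h : a % 6 ≠ b % 6 ∨ a + 6 * n ≤ b) :
    Disjoint (prog a n) (prog b m) := by
  rw [Finset.disjoint_left]
  intro k h1 h2
  rw [mem_prog] at h1 h2
  obtain ⟨a1, a2, a3⟩ := h1
  obtain ⟨b1, b2, b3⟩ := h2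
  omega

theorem ind_zero (u k a : ℕ) (h : k % 6 ≠ a % 6) : ind u k a = 0 := by
  unfold ind
  rw [if_neg (by omega)]

set_option maxHeartbeats 4000000 in
theorem count_window (h u w : ℕ) (hh : 0 < h) (hu : u + 1 ≤ 2 * h)
    (hw1 : w = min (u + 1) h) :
    ((Finset.Ico (6 * h + 7) (6 * h + 7 + 3 * (6 * h + 1))).filter
      (fun k => gper (6 * h + 1) u k ≠ 0)).card = 4 * (u + 1) + 4 * w := by
  have w1 : w ≤ u + 1 := by omega
  have w2 : w ≤ h := by omega
  have w3 : w = u + 1 ∨ w = h := by omega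
  clear hw1
  have key : (Finset.Ico (6 * h + 7) (6 * h + 7 + 3 * (6 * h + 1))).filter
      (fun k => gper (6 * h + 1) u k ≠ 0) =
      (((((((prog (18*h+1-6*u) (u+1) ∪ prog (18*h+4-6*u) (u+1)) ∪ prog (24*h+3-6*u) (u+1))
      ∪ prog (24*h+6-6*u) (u+1)) ∪ prog (18*h+2-6*u) w) ∪ prog (24*h+8-6*w) w)
      ∪ prog (18*h+5-6*u) w) ∪ prog (24*h+11-6*w) w) := by
    ext k
    by_cases hk : 6 * h + 7 ≤ k ∧ k < 6 * h + 7 + 3 * (6 * h + 1)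
    · simp only [Finset.mem_filter, Finset.mem_Ico, Finset.mem_union]
      rw [gper_window h u k hh hu hk.1 (by omega)]
      simp only [hk, true_and, and_self]
      have hm : k % 6 = 0 ∨ k % 6 = 1 ∨ k % 6 = 2 ∨ k % 6 = 3 ∨ k % 6 = 4 ∨ k % 6 = 5 := by omega
      rcases hm with hm | hm | hm | hm | hm | hm
      all_goals
        simp (disch := omega) only [ind_zero, prog_false, or_false, false_or]
        simp only [mem_prog, ind]
        split_ifs <;> omega
    · simp only [Finset.mem_filter, Finset.mem_Ico, Finset.mem_union, mem_prog]
      constructor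
      · exact fun h => absurd h.1 hk
      · intro hx
        exfalso
        apply hk
        rcases hx with ((((((hx | hx) | hx) | hx) | hx) | hx) | hx) | hx
        all_goals
          obtain ⟨x1, x2, x3⟩ := hx
          omega
  rw [key]
  repeat rw [Finset.card_union_of_disjoint]
  · simp only [card_prog]; ring
  all_goals
    try simp only [Finset.disjoint_union_left]
    repeat' apply And.intro
    all_goals
      apply prog_disj
      omega

theorem hw_block (m p i : ℕ) : hw (blockPoly m p i) =
    ((Finset.range m).filter fun k => (cyclotomic (m * p) ℤ).coeff (i * p + k) ≠ 0).card := by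
  unfold hw
  congr 1
  ext k
  simp only [blockPoly, mem_support_iff, finsetSum_coeff, coeff_C_mul, coeff_X_pow, mul_ite,
    mul_one, mul_zero, Finset.sum_ite_eq, Finset.mem_filter]
  split_ifs with h <;> simp [h]

theorem hw_main (h u w r : ℕ) (hp : (6 * h + 1).Prime) (hr : r.Prime) (hh : 0 < h)
    (hgt : 3 * (6 * h + 1) < r) (hmod : r % (3 * (6 * h + 1)) = 2) (hu : u + 1 ≤ 2 * h)
    (hw1 : w ≤ 1) :
    hw (blockPoly (3 * (6 * h + 1)) r (3 * u + (w + 1))) = 4 * (u + 1) + 4 * min (u + 1) h := by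
  rw [hw_block, ← count_window h u _ hh hu rfl]
  have per : Function.Periodic (fun k => gper (6 * h + 1) u k ≠ 0) (3 * (6 * h + 1)) := by
    intro k
    simp only [gper_periodic]
  rw [Nat.filter_Ico_card_eq_of_periodic _ _ _ per,
    ← Nat.filter_Ico_card_eq_of_periodic (2 * w) _ _ per]
  refine Finset.card_bij (fun k _ => k + 2 * w) ?_ ?_ ?_
  · intro k hk
    simp only [Finset.mem_filter, Finset.mem_range, Finset.mem_Ico] at hk ⊢
    rw [coeff_gper _ r hp (by omega) hr hgt hmod u w k (by omega) hw1 hk.1] at hk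
    exact ⟨by omega, hk.2⟩
  · intro a _ b _ hab
    simpa using hab
  · intro b hb
    simp only [Finset.mem_filter, Finset.mem_range, Finset.mem_Ico] at hb ⊢
    have hb' : b - 2 * w + 2 * w = b := by omega
    refine ⟨b - 2 * w, ⟨by omega, ?_⟩, hb'⟩
    rw [coeff_gper _ r hp (by omega) hr hgt hmod u w _ (by omega) hw1 (by omega), hb']
    exact hb.2

theorem stmt11 (p₂ p₃ q₂ : ℕ) (hp₂ : p₂.Prime) (h3 : 3 < p₂) (hq₂ : 3 * q₂ + 1 = p₂)
    (hp₃ : p₃.Prime) (hgt : 3 * p₂ < p₃) (hmod : p₃ % (3 * p₂) = 2)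
    (u v i : ℕ) (hv : v = 1 ∨ v = 2) (hiv : i = 3 * u + v) (hi : i < p₂ - 1) :
    (u ≤ q₂ / 2 - 1 → hw (blockPoly (3 * p₂) p₃ i) = 8 * (u + 1)) ∧
    (q₂ / 2 ≤ u → u ≤ q₂ - 1 → hw (blockPoly (3 * p₂) p₃ i) = 4 * (u + 1 + q₂ / 2)) := by
  have hodd : p₂ % 2 = 1 := by
    rcases hp₂.eq_two_or_odd with h | h <;> omega
  obtain ⟨h, rfl⟩ : ∃ h, p₂ = 6 * h + 1 := ⟨q₂ / 2, by omega⟩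
  obtain ⟨w, rfl⟩ : ∃ w, v = w + 1 := ⟨v - 1, by omega⟩
  subst hiv
  rw [hw_main h u w p₃ hp₂ hp₃ (by omega) hgt hmod (by omega) (by omega)]
  constructor <;> intros <;> omega
end
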